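/- Let α > 0 be a fixed non-integer and let θ, ε, D be fixed constants with 0 < ε < θ < 1/3, ε < α/20, D > 1. Suppose 1 ≤ h ≤ (log X)^D, 2 < q ≤ X^{θ−ε}, 1 ≤ a ≤ q−1, gcd(a,q)=1, and X < Y ≤ 2X. Then the von Mangoldt-weighted exponential sum W(Y) = Σ_{X ≤ n < Y, n ≡ a (mod q)} Λ(n) e(h n^α) satisfies W(Y) ≪ X^{1 + 3δ − 2ε³/(5α²)} for any 0 < δ ≤ ε³/(50α²), with implied constant depending on α, ε and D. -/

import Mathlib

open scoped Classical

open ArithmeticFunction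

/-- `e(x) = e^{2πix}`. -/
noncomputable def e (x : ℝ) : ℂ := Complex.exp (2 * Real.pi * Complex.I * x)

/-- The number of pairs in `T` on which `w` takes the same value. -/
noncomputable def coincidences {ι V : Type*} (T : Finset ι) (w : ι → V) : ℕ :=
  ((T ×ˢ T).filter fun x => w x.1 = w x.2).card

/-- The character sum attached to a family of group elements. -/
noncomputable def charSum {ι V : Type*} [AddCommGroup V] (T : Finset ι) (w : ι → V)
    (ψ : AddChar V ℂ) : ℂ := ∑ t ∈ T, ψ (w t)

lemma coincidences_mono {ι V : Type*} {T T' : Finset ι} (h : T ⊆ T') (w : ι → V) :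
    coincidences T w ≤ coincidences T' w :=
  Finset.card_le_card (Finset.filter_subset_filter _ (Finset.product_subset_product h h))

/-- Orthogonality of characters. -/
lemma sum_norm_charSum_sq {ι V : Type*} [AddCommGroup V] [Fintype V] (T : Finset ι) (w : ι → V) :
    ∑ ψ : AddChar V ℂ, ‖charSum T w ψ‖ ^ 2 = Fintype.card V * coincidences T w := by
  have h1 : ∀ ψ : AddChar V ℂ, ((‖charSum T w ψ‖ ^ 2 : ℝ) : ℂ)
      = ∑ x ∈ T ×ˢ T, ψ (w x.1 - w x.2) := by
    intro ψ
    rw [Complex.ofReal_pow, ← Complex.mul_conj', charSum, map_sum, Finset.sum_mul_sum,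
      Finset.sum_product]
    refine Finset.sum_congr rfl fun x _ => Finset.sum_congr rfl fun y _ => ?_
    rw [sub_eq_add_neg, AddChar.map_add_eq_mul, AddChar.map_neg_eq_conj]
  have h2 : ((∑ ψ : AddChar V ℂ, ‖charSum T w ψ‖ ^ 2 : ℝ) : ℂ)
      = ((Fintype.card V * coincidences T w : ℝ) : ℂ) := by
    rw [Complex.ofReal_sum, Finset.sum_congr rfl fun ψ _ => h1 ψ, Finset.sum_comm]
    simp only [AddChar.sum_apply_eq_ite, sub_eq_zero]
    rw [← Finset.sum_filter, Finset.sum_const, nsmul_eq_mul, coincidences]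
    push_cast
    ring
  exact_mod_cast h2

lemma charSum_product {ι κ V : Type*} [AddCommGroup V] (T : Finset ι) (U : Finset κ)
    (w : ι → V) (u : κ → V) (ψ : AddChar V ℂ) :
    charSum (T ×ˢ U) (fun x => w x.1 + u x.2) ψ = charSum T w ψ * charSum U u ψ := by
  simp only [charSum, Finset.sum_mul_sum, Finset.sum_product, AddChar.map_add_eq_mul]

lemma charSum_piFinset {α V : Type*} [AddCommGroup V] (m : ℕ)
    (A : Fin m → Finset α) (v : α → V) (ψ : AddChar V ℂ) :
    charSum (Fintype.piFinset A) (fun t => ∑ i, v (t i)) ψ = ∏ i, charSum (A i) v ψ := by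
  simp only [charSum, Finset.prod_univ_sum]
  refine Finset.sum_congr rfl fun t _ => ?_
  exact map_sum (AddChar.toAddMonoidHomEquiv ψ) (fun i => v (t i)) Finset.univ

/-- If coincidences only occur inside the fibres of `π`, they can be counted fibre by fibre. -/
lemma coincidences_eq_sum_fiber {ι V γ : Type*} (T : Finset ι) (w : ι → V) (π : ι → γ)
    (h : ∀ t ∈ T, ∀ t' ∈ T, w t = w t' → π t = π t') :
    coincidences T w = ∑ c ∈ T.image π, coincidences (T.filter fun t => π t = c) w := by
  unfold coincidences
  rw [Finset.card_eq_sum_card_fiberwise (f := fun x : ι × ι => π x.1) (t := T.image π)]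
  · refine Finset.sum_congr rfl fun c _ => ?_
    congr 1
    ext ⟨x, y⟩
    simp only [Finset.mem_filter, Finset.mem_product]
    constructor
    · rintro ⟨⟨⟨hx, hy⟩, hw⟩, hc⟩
      exact ⟨⟨⟨hx, hc⟩, hy, (h x hx y hy hw) ▸ hc⟩, hw⟩
    · rintro ⟨⟨⟨hx, hc⟩, hy, _⟩, hw⟩
      exact ⟨⟨⟨hx, hy⟩, hw⟩, hc⟩
  · intro x hx
    simp only [Finset.coe_filter, Finset.mem_product, Set.mem_ofPred_eq] at hx
    exact Finset.mem_coe.2 (Finset.mem_image_of_mem _ hx.1.1)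

/-- The Cauchy-Schwarz inequality for coincidences. -/
lemma coincidences_le_card_mul_sum {ι V γ : Type*} [AddCommGroup V] [Fintype V]
    (T : Finset ι) (w : ι → V) (π : ι → γ) (C : Finset γ) (hπ : ∀ t ∈ T, π t ∈ C) :
    coincidences T w ≤ C.card * ∑ c ∈ C, coincidences (T.filter fun t => π t = c) w := by
  have hV : (0 : ℝ) < Fintype.card V := by exact_mod_cast Fintype.card_pos
  have h : (Fintype.card V : ℝ) * coincidences T w
      ≤ Fintype.card V * (C.card * ∑ c ∈ C, coincidences (T.filter fun t => π t = c) w : ℕ) := by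
    rw [← sum_norm_charSum_sq]
    calc ∑ ψ : AddChar V ℂ, ‖charSum T w ψ‖ ^ 2
        ≤ ∑ ψ : AddChar V ℂ, C.card * ∑ c ∈ C, ‖charSum (T.filter fun t => π t = c) w ψ‖ ^ 2 := by
          refine Finset.sum_le_sum fun ψ _ => ?_
          have h1 : charSum T w ψ = ∑ c ∈ C, charSum (T.filter fun t => π t = c) w ψ := by
            simp only [charSum]
            exact (Finset.sum_fiberwise_of_maps_to hπ _).symm
          rw [h1]
          calc ‖∑ c ∈ C, charSum (T.filter fun t => π t = c) w ψ‖ ^ 2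
              ≤ (∑ c ∈ C, ‖charSum (T.filter fun t => π t = c) w ψ‖) ^ 2 := by
                gcongr; exact norm_sum_le _ _
            _ ≤ _ := sq_sum_le_card_mul_sum_sq
      _ = _ := by
          rw [← Finset.mul_sum, Finset.sum_comm]
          simp only [sum_norm_charSum_sq]
          push_cast
          rw [← Finset.mul_sum]; ring
  exact_mod_cast le_of_mul_le_mul_left h hV

lemma prod_le_sum_pow {m : ℕ} (hm : 0 < m) (y : Fin m → ℝ) (hy : ∀ i, 0 ≤ y i) :
    ∏ i, y i ≤ ∑ i, y i ^ m := by
  have : Nonempty (Fin m) := ⟨⟨0, hm⟩⟩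
  obtain ⟨j, -, hj⟩ := Finset.exists_max_image Finset.univ y Finset.univ_nonempty
  calc ∏ i, y i ≤ ∏ _i : Fin m, y j := Finset.prod_le_prod (fun i _ => hy i) fun i _ => hj i
        (Finset.mem_univ i)
    _ = y j ^ m := by simp
    _ ≤ _ := Finset.single_le_sum (f := fun i => y i ^ m) (fun i _ => pow_nonneg (hy i) m)
        (Finset.mem_univ j)

/-- Decomposing the first block of variables according to a pattern of constraints. -/
lemma coincidences_product_le_of_pattern {α κ V γ : Type*} [AddCommGroup V] [Fintype V] {m : ℕ}
    (hm : 0 < m) (T : Finset (Fin m → α)) (v : α → V) (U : Finset κ) (u : κ → V)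
    (ρ : α → γ) (A : γ → Finset α) (hA : ∀ t ∈ T, ∀ i, t i ∈ A (ρ (t i)))
    (C : Finset (Fin m → γ)) (hC : ∀ t ∈ T, (fun i => ρ (t i)) ∈ C) (R : ℝ)
    (hR : ∀ c ∈ C, ∀ i, ∑ ψ : AddChar V ℂ, ‖charSum (A (c i)) v ψ‖ ^ (2 * m) *
      ‖charSum U u ψ‖ ^ 2 ≤ Fintype.card V * R) :
    (coincidences (T ×ˢ U) (fun x => (∑ i, v (x.1 i)) + u x.2) : ℝ) ≤ C.card ^ 2 * m * R := by
  have hV : (0 : ℝ) < Fintype.card V := by exact_mod_cast Fintype.card_pos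
  have h0 := coincidences_le_card_mul_sum (T ×ˢ U)
    (fun x : (Fin m → α) × κ => (∑ i, v (x.1 i)) + u x.2)
    (fun x => fun i => ρ (x.1 i)) C (fun x hx => hC _ (Finset.mem_product.1 hx).1)
  have h1 : ∀ c ∈ C, (coincidences ((T ×ˢ U).filter fun x => (fun i => ρ (x.1 i)) = c)
      (fun x => (∑ i, v (x.1 i)) + u x.2) : ℝ) ≤ m * R := by
    intro c hc
    have hsub : ((T ×ˢ U).filter fun x => (fun i => ρ (x.1 i)) = c)
        ⊆ Fintype.piFinset (fun i => A (c i)) ×ˢ U := by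
      intro x hx
      simp only [Finset.mem_filter, Finset.mem_product] at hx
      refine Finset.mem_product.2 ⟨Fintype.mem_piFinset.2 fun i => ?_, hx.1.2⟩
      rw [← hx.2]; exact hA _ hx.1.1 i
    refine le_trans (Nat.cast_le.2 (coincidences_mono hsub _)) ?_
    refine le_of_mul_le_mul_left ?_ hV
    rw [← sum_norm_charSum_sq]
    calc ∑ ψ : AddChar V ℂ, ‖charSum (Fintype.piFinset (fun i => A (c i)) ×ˢ U)
          (fun x => (∑ i, v (x.1 i)) + u x.2) ψ‖ ^ 2
        ≤ ∑ ψ : AddChar V ℂ, ∑ i, ‖charSum (A (c i)) v ψ‖ ^ (2 * m) * ‖charSum U u ψ‖ ^ 2 := by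
          refine Finset.sum_le_sum fun ψ _ => ?_
          rw [charSum_product _ _ (fun t : Fin m → α => ∑ i, v (t i)), charSum_piFinset, norm_mul,
            mul_pow, norm_prod, ← Finset.prod_pow, ← Finset.sum_mul]
          gcongr
          simpa only [pow_mul] using
            prod_le_sum_pow hm (fun i => ‖charSum (A (c i)) v ψ‖ ^ 2) (fun i => by positivity)
      _ ≤ ∑ _i : Fin m, Fintype.card V * R := by
          rw [Finset.sum_comm]; exact Finset.sum_le_sum fun i _ => hR c hc i
      _ = _ := by simp; ring
  refine (Nat.cast_le.2 h0).trans ?_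
  push_cast
  calc _ ≤ (C.card : ℝ) * ∑ _c ∈ C, m * R := by
        gcongr with c hc
        exact le_of_eq_of_le (by congr!) (h1 c hc)
    _ = _ := by rw [Finset.sum_const, nsmul_eq_mul]; ring

lemma aeval_esymm_eq_of_psum_eq {R : Type*} [CommRing R] {k : ℕ} (hk : ∀ j : ℕ, 0 < j → j ≤ k →
    IsUnit (j : R)) (u u' : Fin k → R) (h : ∀ j, 0 < j → j ≤ k → ∑ i, u i ^ j = ∑ i, u' i ^ j)
    (n : ℕ) (hn : n ≤ k) :
    MvPolynomial.aeval u (MvPolynomial.esymm (Fin k) R n)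
      = MvPolynomial.aeval u' (MvPolynomial.esymm (Fin k) R n) := by
  induction n using Nat.strong_induction_on with
  | _ n ih =>
    rcases Nat.eq_zero_or_pos n with rfl | hpos
    · simp
    · have key := fun w : Fin k → R =>
        congrArg (MvPolynomial.aeval w) (MvPolynomial.mul_esymm_eq_sum (Fin k) R n)
      have h1 := key u
      have h2 := key u'
      simp only [map_mul, map_natCast, map_sum, map_pow, map_neg, map_one] at h1 h2
      refine (hk n hpos hn).mul_left_cancel ?_
      rw [h1, h2]
      congr 1
      refine Finset.sum_congr rfl fun a ha => ?_
      obtain ⟨ha1, ha2⟩ := Finset.mem_filter.1 ha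
      have ha3 := Finset.HasAntidiagonal.mem_antidiagonal.1 ha1
      rw [ih a.1 ha2 (by omega)]
      congr 1
      simp only [MvPolynomial.psum, map_sum, map_pow, MvPolynomial.aeval_X]
      exact h a.2 (by omega) (by omega)

lemma prod_sub_eq_zero_of_psum_eq {R : Type*} [CommRing R] {k : ℕ} (hk : ∀ j : ℕ, 0 < j → j ≤ k →
    IsUnit (j : R)) (u u' : Fin k → R) (h : ∀ j, 0 < j → j ≤ k → ∑ i, u i ^ j = ∑ i, u' i ^ j)
    (i : Fin k) : ∏ l, (u' i - u l) = 0 := by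
  have key : ∀ w : Fin k → R, ∏ l, (Polynomial.X - Polynomial.C (w l)) =
      ∑ j ∈ Finset.range (k + 1), (-1) ^ j * (Polynomial.C
        (MvPolynomial.aeval w (MvPolynomial.esymm (Fin k) R j)) * Polynomial.X ^ (k - j)) := by
    intro w
    have := Multiset.prod_X_sub_X_eq_sum_esymm (Finset.univ.val.map w)
    simp only [Multiset.map_map, Multiset.card_map, Finset.card_val, Finset.card_univ,
      Fintype.card_fin] at this
    simp only [MvPolynomial.aeval_esymm_eq_multiset_esymm]
    exact this
  have h1 : ∏ l, (Polynomial.X - Polynomial.C (u l)) = ∏ l, (Polynomial.X - Polynomial.C (u' l)) := by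
    rw [key, key]
    refine Finset.sum_congr rfl fun j hj => ?_
    rw [aeval_esymm_eq_of_psum_eq hk u u' h j (by simp at hj; omega)]
  have h2 := congrArg (Polynomial.eval (u' i)) h1
  simp only [Polynomial.eval_prod, Polynomial.eval_sub, Polynomial.eval_X, Polynomial.eval_C] at h2
  rw [h2]
  exact Finset.prod_eq_zero (Finset.mem_univ i) (sub_self _)

/-- Tuples with congruent power sums agree up to rearrangement, if one of them has entries that
are distinct modulo `p`. -/
lemma exists_modEq_of_powerSum {k p c : ℕ} (hp : p.Prime) (hkp : k < p) (u u' : Fin k → ℤ)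
    (hu : ∀ i j, i ≠ j → ¬ u i ≡ u j [ZMOD p])
    (h : ∀ j, 0 < j → j ≤ k → ∑ i, u i ^ j ≡ ∑ i, u' i ^ j [ZMOD (p ^ c : ℕ)]) (i : Fin k) :
    ∃ l, u' i ≡ u l [ZMOD (p ^ c : ℕ)] := by
  have hunit : ∀ j : ℕ, 0 < j → j ≤ k → IsUnit (j : ZMod (p ^ c)) := by
    intro j hj hjk
    rw [ZMod.isUnit_iff_coprime]
    exact Nat.Coprime.pow_right _ (Nat.coprime_of_lt_prime hj.ne' (by omega) hp).symm
  have h1 := prod_sub_eq_zero_of_psum_eq hunit (fun i => (u i : ZMod (p ^ c)))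
    (fun i => (u' i : ZMod (p ^ c))) (fun j hj hjk => by
      have := (ZMod.intCast_eq_intCast_iff _ _ _).2 (h j hj hjk)
      push_cast at this
      exact this) i
  have h2 : ((p ^ c : ℕ) : ℤ) ∣ ∏ l, (u' i - u l) := by
    rw [← ZMod.intCast_zmod_eq_zero_iff_dvd]
    push_cast
    exact h1
  rcases Nat.eq_zero_or_pos c with rfl | hc
  · exact ⟨i, by simp [Int.modEq_one]⟩
  have hpp : Prime (p : ℤ) := Nat.prime_iff_prime_int.1 hp
  obtain ⟨l, -, hl⟩ := hpp.exists_mem_finset_dvd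
    ((dvd_pow_self (p : ℤ) hc.ne').trans (by exact_mod_cast h2))
  refine ⟨l, (Int.modEq_iff_dvd.2 ?_).symm⟩
  rw [← Finset.mul_prod_erase _ _ (Finset.mem_univ l)] at h2
  refine IsCoprime.dvd_of_dvd_mul_right ?_ h2
  refine IsCoprime.prod_right fun m hm => ?_
  push_cast
  refine IsCoprime.pow_left ((Prime.coprime_iff_not_dvd hpp).2 fun hd => ?_)
  refine hu l m (Finset.ne_of_mem_erase hm).symm (Int.modEq_iff_dvd.2 ?_)
  have := dvd_sub hl hd
  have h3 : u' i - u l - (u' i - u m) = u m - u l := by ring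
  rwa [h3] at this

lemma card_Ico_filter_modEq_pow {p e E : ℕ} (hp : 0 < p) (he : e ≤ E) (v : ℤ) :
    ((Finset.Ico (0 : ℤ) (p ^ E : ℕ)).filter fun x => x ≡ v [ZMOD (p ^ e : ℕ)]).card
      = p ^ (E - e) := by
  have hpe : (0 : ℤ) < (p ^ e : ℕ) := by positivity
  refine Nat.cast_injective (R := ℤ) ?_
  rw [Int.Ico_filter_modEq_card _ _ hpe]
  have h1 : (((p ^ E : ℕ) : ℤ) - v : ℚ) / ((p ^ e : ℕ) : ℤ)
      = ((0 : ℤ) - v : ℚ) / ((p ^ e : ℕ) : ℤ) + ((p ^ (E - e) : ℕ) : ℤ) := by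
    have : (p : ℚ) ^ E = p ^ e * p ^ (E - e) := by rw [← pow_add]; congr 1; omega
    have : (p : ℚ) ^ e ≠ 0 := by positivity
    push_cast
    field_simp
    linarith
  rw [h1, Int.ceil_add_intCast]
  simp

lemma sum_add_pow_modEq {ι : Type*} [Fintype ι] {n : ℕ} {M : ℤ} (w w' : ι → ℤ) (t : ℤ)
    (h : ∀ l, 0 < l → l ≤ n → ∑ i, w i ^ l ≡ ∑ i, w' i ^ l [ZMOD M]) :
    ∑ i, (w i + t) ^ n ≡ ∑ i, (w' i + t) ^ n [ZMOD M] := by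
  have key : ∀ v : ι → ℤ, ∑ i, (v i + t) ^ n
      = ∑ m ∈ Finset.range (n + 1), (∑ i, v i ^ m) * (t ^ (n - m) * (n.choose m : ℤ)) := by
    intro v
    simp only [add_pow, Finset.sum_mul]
    rw [Finset.sum_comm]
    simp only [mul_assoc]
  rw [key, key, Int.modEq_iff_dvd, ← Finset.sum_sub_distrib]
  refine Finset.dvd_sum fun m hm => ?_
  rw [← sub_mul]
  refine Dvd.dvd.mul_right ?_ _
  rcases Nat.eq_zero_or_pos m with rfl | hpos
  · simp
  · exact Int.modEq_iff_dvd.1 (h m hpos (by simp at hm; omega))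

/-- Refining congruence information multiplies the cardinality of a set at most by the number of
possible refinements. -/
lemma card_le_of_forall_fiber {ι : Type*} {k p E B : ℕ} (hp : 0 < p) (Z : Finset ι)
    (F : ι → Fin k → ℤ) (e : Fin k → ℕ) (he : ∀ j, e j ≤ E)
    (hF : ∀ z ∈ Z, ∀ z' ∈ Z, ∀ j, F z j ≡ F z' j [ZMOD (p ^ e j : ℕ)])
    (hB : ∀ Y ⊆ Z, (∀ z ∈ Y, ∀ z' ∈ Y, ∀ j, F z j ≡ F z' j [ZMOD (p ^ E : ℕ)]) → Y.card ≤ B) :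
    Z.card ≤ B * ∏ j, p ^ (E - e j) := by
  rcases Z.eq_empty_or_nonempty with rfl | ⟨z₀, hz₀⟩
  · simp
  have hpE : (0 : ℤ) < (p ^ E : ℕ) := by positivity
  let φ : ι → Fin k → ℤ := fun z j => F z j % (p ^ E : ℕ)
  have himg : (Z.image φ).card ≤ ∏ j, p ^ (E - e j) := by
    have hsub : Z.image φ ⊆ Fintype.piFinset fun j =>
        (Finset.Ico (0 : ℤ) (p ^ E : ℕ)).filter fun x => x ≡ F z₀ j [ZMOD (p ^ e j : ℕ)] := by
      intro c hc
      obtain ⟨z, hz, rfl⟩ := Finset.mem_image.1 hc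
      refine Fintype.mem_piFinset.2 fun j => Finset.mem_filter.2 ⟨Finset.mem_Ico.2
        ⟨Int.emod_nonneg _ hpE.ne', Int.emod_lt_of_pos _ hpE⟩, ?_⟩
      refine Int.ModEq.trans ?_ (hF z hz z₀ hz₀ j)
      refine Int.ModEq.of_dvd ?_ (Int.mod_modEq (F z j) (p ^ E : ℕ))
      exact Int.natCast_dvd_natCast.2 (pow_dvd_pow p (he j))
    refine (Finset.card_le_card hsub).trans ?_
    rw [Fintype.card_piFinset]
    exact (Finset.prod_congr rfl fun j _ => card_Ico_filter_modEq_pow hp (he j) _).le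
  refine (Finset.card_le_mul_card_image (f := φ) Z B fun c _ => ?_).trans
    (Nat.mul_le_mul_left _ himg)
  refine hB _ (Finset.filter_subset _ _) fun z hz z' hz' j => ?_
  have h1 := congrFun ((Finset.mem_filter.1 hz).2.trans (Finset.mem_filter.1 hz').2.symm) j
  exact h1

lemma card_le_of_modEq_powerSum {k p a E : ℕ} (hp : p.Prime) (hkp : k < p) (haE : a ≤ E)
    (Y : Finset (Fin k → ℤ)) (u : (Fin k → ℤ) → Fin k → ℤ) (ξ : ℤ)
    (hz : ∀ z ∈ Y, ∀ i, z i ∈ Finset.Ico (0 : ℤ) (p ^ E : ℕ))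
    (hu : ∀ z ∈ Y, ∀ i, z i = ξ + (p ^ a : ℕ) * u z i)
    (hd : ∀ z ∈ Y, ∀ i j, i ≠ j → ¬ z i ≡ z j [ZMOD (p ^ (a + 1) : ℕ)])
    (hY : ∀ z ∈ Y, ∀ z' ∈ Y, ∀ j : Fin k, ∑ i, u z i ^ (j.1 + 1) ≡ ∑ i, u z' i ^ (j.1 + 1)
      [ZMOD (p ^ (E - a) : ℕ)]) : Y.card ≤ k ^ k := by
  rcases Y.eq_empty_or_nonempty with rfl | ⟨z₀, hz₀⟩
  · simp
  have hsub : Y ⊆ Finset.univ.image fun l : Fin k → Fin k => fun i => z₀ (l i) := by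
    intro z hzY
    have hex : ∀ i, ∃ l, u z i ≡ u z₀ l [ZMOD (p ^ (E - a) : ℕ)] := by
      refine exists_modEq_of_powerSum hp hkp (u z₀) (u z) (fun i j hij hmod => ?_)
        (fun j hj hjk => ?_)
      · refine hd z₀ hz₀ i j hij ?_
        rw [hu z₀ hz₀ i, hu z₀ hz₀ j, pow_succ]
        push_cast
        exact (Int.ModEq.mul_left' hmod).add_left _
      · have := hY z₀ hz₀ z hzY ⟨j - 1, by omega⟩
        simpa only [Nat.sub_add_cancel hj] using this
    choose l hl using hex
    refine Finset.mem_image.2 ⟨l, Finset.mem_univ _, ?_⟩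
    ext i
    have h1 : z i ≡ z₀ (l i) [ZMOD (p ^ E : ℕ)] := by
      rw [hu z hzY i, hu z₀ hz₀ (l i)]
      have h2 : (p ^ E : ℕ) = p ^ a * p ^ (E - a) := by rw [← pow_add]; congr 1; omega
      rw [h2]
      push_cast
      have h3 := hl i
      push_cast at h3
      exact (Int.ModEq.mul_left' h3).add_left _
    have h2 := Finset.mem_Ico.1 (hz z hzY i)
    have h3 := Finset.mem_Ico.1 (hz z₀ hz₀ (l i))
    have h4 : z i % (p ^ E : ℕ) = z₀ (l i) % (p ^ E : ℕ) := h1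
    rw [Int.emod_eq_of_lt h2.1 h2.2, Int.emod_eq_of_lt h3.1 h3.2] at h4
    exact h4.symm
  refine (Finset.card_le_card hsub).trans (Finset.card_image_le.trans ?_)
  simp

/-- The number of residue patterns modulo `p ^ (k * b)` with prescribed power sums modulo powers of
`p ^ b`. -/
lemma card_pattern_le {k p a b : ℕ} (hp : p.Prime) (hkp : k < p) (hab : a ≤ b) (hk : 0 < k)
    (ξ η : ℤ) (Z : Finset (Fin k → ℤ))
    (hz : ∀ z ∈ Z, ∀ i, z i ∈ Finset.Ico (0 : ℤ) (p ^ (k * b) : ℕ))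
    (hξ : ∀ z ∈ Z, ∀ i, z i ≡ ξ [ZMOD (p ^ a : ℕ)])
    (hd : ∀ z ∈ Z, ∀ i j, i ≠ j → ¬ z i ≡ z j [ZMOD (p ^ (a + 1) : ℕ)])
    (hη : ∀ z ∈ Z, ∀ z' ∈ Z, ∀ j : Fin k, ∑ i, (z i - η) ^ (j.1 + 1) ≡
      ∑ i, (z' i - η) ^ (j.1 + 1) [ZMOD (p ^ ((j.1 + 1) * b) : ℕ)]) :
    Z.card ≤ k ^ k * p ^ ((a + b) * ∑ j ∈ Finset.range k, j) := by
  have hE : ∀ j : Fin k, (j.1 + 1) * b ≤ k * b := fun j => Nat.mul_le_mul_right _ j.2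
  have hEa : ∀ j : Fin k, (j.1 + 1) * a ≤ k * b := fun j => Nat.mul_le_mul j.2 hab
  have hakb : a ≤ k * b := hab.trans (Nat.le_mul_of_pos_left _ hk)
  have hpa : (0 : ℤ) < (p ^ a : ℕ) := by have := hp.pos; positivity
  have step1 : Z.card ≤ (k ^ k * ∏ j : Fin k, p ^ ((k * b - a) - (k * b - (j.1 + 1) * a))) *
      ∏ j : Fin k, p ^ (k * b - (j.1 + 1) * b) := by
    refine card_le_of_forall_fiber hp.pos Z (fun z j => ∑ i, (z i - η) ^ (j.1 + 1))
      (fun j => (j.1 + 1) * b) hE hη fun Y hYZ hY => ?_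
    have hu : ∀ z ∈ Y, ∀ i, z i = ξ + (p ^ a : ℕ) * ((z i - ξ) / (p ^ a : ℕ)) := by
      intro z hzY i
      rw [Int.mul_ediv_cancel' (Int.modEq_iff_dvd.1 (hξ z (hYZ hzY) i).symm)]
      ring
    refine card_le_of_forall_fiber hp.pos Y
      (fun z j => ∑ i, ((z i - ξ) / (p ^ a : ℕ)) ^ (j.1 + 1)) (fun j => k * b - (j.1 + 1) * a)
      (fun j => ?_) (fun z hzY z' hz'Y j => ?_) fun Y' hY' hY'' => ?_
    · have : a ≤ (j.1 + 1) * a := Nat.le_mul_of_pos_left _ (by omega)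
      omega
    · have h1 : ∑ i, (z i - ξ) ^ (j.1 + 1) ≡ ∑ i, (z' i - ξ) ^ (j.1 + 1)
          [ZMOD (p ^ (k * b) : ℕ)] := by
        have := sum_add_pow_modEq (n := j.1 + 1) (M := (p ^ (k * b) : ℕ))
          (fun i => z i - η) (fun i => z' i - η) (η - ξ) (fun l hl hlj => by
            have := hY z hzY z' hz'Y ⟨l - 1, by omega⟩
            simpa only [Nat.sub_add_cancel hl] using this)
        simpa using this
      have h2 : ∀ z ∈ Y, ∑ i, (z i - ξ) ^ (j.1 + 1) = (p ^ ((j.1 + 1) * a) : ℕ) *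
          ∑ i, ((z i - ξ) / (p ^ a : ℕ)) ^ (j.1 + 1) := by
        intro z hzY
        rw [Finset.mul_sum]
        refine Finset.sum_congr rfl fun i _ => ?_
        conv_lhs => rw [hu z hzY i]
        push_cast
        rw [add_sub_cancel_left, mul_pow, ← pow_mul, mul_comm a]
      rw [h2 z hzY, h2 z' hz'Y] at h1
      have h3 : (p ^ (k * b) : ℕ) = p ^ ((j.1 + 1) * a) * p ^ (k * b - (j.1 + 1) * a) := by
        rw [← pow_add]; congr 1; have := hEa j; omega
      rw [h3, Nat.cast_mul] at h1
      exact Int.ModEq.mul_left_cancel' (by have := hp.pos; positivity) h1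
    · exact card_le_of_modEq_powerSum hp hkp hakb Y' _ ξ
        (fun z h => hz z (hYZ (hY' h))) (fun z h => hu z (hY' h)) (fun z h => hd z (hYZ (hY' h)))
        hY''
  refine step1.trans (le_of_eq ?_)
  rw [mul_assoc]
  congr 1
  have h1 : ∏ j : Fin k, p ^ ((k * b - a) - (k * b - (j.1 + 1) * a))
      = p ^ (a * ∑ j ∈ Finset.range k, j) := by
    rw [Finset.prod_pow_eq_pow_sum, Finset.mul_sum,
      ← Fin.sum_univ_eq_sum_range (fun j => a * j)]
    congr 1
    refine Finset.sum_congr rfl fun j _ => ?_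
    have := hEa j
    have h2 : (j.1 + 1) * a = a * j + a := by ring
    omega
  have h2 : ∏ j : Fin k, p ^ (k * b - (j.1 + 1) * b) = p ^ (b * ∑ j ∈ Finset.range k, j) := by
    rw [Finset.prod_pow_eq_pow_sum, ← Finset.sum_range_reflect, Finset.mul_sum,
      ← Fin.sum_univ_eq_sum_range (fun j => b * (k - 1 - j))]
    congr 1
    refine Finset.sum_congr rfl fun j _ => ?_
    rw [← Nat.sub_mul, mul_comm]
    congr 1
    omega
  rw [h1, h2, ← pow_add, add_mul]

/-- The number of solutions of the Vinogradov system of degree `k` in `s` pairs of variables from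
`[0, N)`. -/
noncomputable def vinogradovCount (k s N : ℕ) : ℕ :=
  coincidences (Fintype.piFinset fun _ : Fin s => Finset.Ico (0 : ℤ) N)
    (fun t (j : Fin k) => ∑ i, t i ^ (j.1 + 1))

/-- The point `(x, x², …, x^k)` of the moment curve modulo `Q`. -/
def momentCurve (k Q : ℕ) (x : ℤ) : Fin k → ZMod Q := fun j => (x : ZMod Q) ^ (j.1 + 1)

/-- The members of `[0, N)` that are congruent to `ξ` modulo `p ^ a`. -/
noncomputable def progression (N p a : ℕ) (ξ : ℤ) : Finset ℤ :=
  (Finset.Ico (0 : ℤ) N).filter fun x => x ≡ ξ [ZMOD (p ^ a : ℕ)]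

/-- The `k`-tuples from `progression N p a ξ` with entries distinct modulo `p ^ (a + 1)`. -/
noncomputable def separatedTuples (k N p a : ℕ) (ξ : ℤ) : Finset (Fin k → ℤ) :=
  (Fintype.piFinset fun _ => progression N p a ξ).filter fun t =>
    ∀ i j, i ≠ j → ¬ t i ≡ t j [ZMOD (p ^ (a + 1) : ℕ)]

/-- The average over all characters. -/
noncomputable def charMean {V : Type*} [AddCommGroup V] [Fintype V] (g : AddChar V ℂ → ℝ) : ℝ :=
  (∑ ψ, g ψ) / Fintype.card V

/-- The exponential sum over `progression N p a ξ`. -/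
noncomputable def progSum (k Q N p a : ℕ) (ξ : ℤ) (ψ : AddChar (Fin k → ZMod Q) ℂ) : ℝ :=
  ‖charSum (progression N p a ξ) (momentCurve k Q) ψ‖

/-- The exponential sum over `separatedTuples k N p a ξ`. -/
noncomputable def sepSum (k Q N p a : ℕ) (ξ : ℤ) (ψ : AddChar (Fin k → ZMod Q) ℂ) : ℝ :=
  ‖charSum (separatedTuples k N p a ξ) (fun t => ∑ i, momentCurve k Q (t i)) ψ‖

lemma progSum_nonneg {k Q N p a : ℕ} {ξ : ℤ} {ψ} : 0 ≤ progSum k Q N p a ξ ψ := norm_nonneg _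

lemma sepSum_nonneg {k Q N p a : ℕ} {ξ : ℤ} {ψ} : 0 ≤ sepSum k Q N p a ξ ψ := norm_nonneg _

lemma coincidences_eq_charMean {ι V : Type*} [AddCommGroup V] [Fintype V] (T : Finset ι)
    (w : ι → V) : (coincidences T w : ℝ) = charMean fun ψ => ‖charSum T w ψ‖ ^ 2 := by
  have hV : (0 : ℝ) < Fintype.card V := by exact_mod_cast Fintype.card_pos
  rw [charMean, sum_norm_charSum_sq, mul_div_cancel_left₀ _ hV.ne']

lemma charMean_nonneg {V : Type*} [AddCommGroup V] [Fintype V] {f : AddChar V ℂ → ℝ}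
    (h : ∀ ψ, 0 ≤ f ψ) : 0 ≤ charMean f :=
  div_nonneg (Finset.sum_nonneg fun ψ _ => h ψ) (Nat.cast_nonneg _)

lemma sum_le_card_mul_of_charMean_le {V : Type*} [AddCommGroup V] [Fintype V]
    {f : AddChar V ℂ → ℝ} {R : ℝ} (h : charMean f ≤ R) : ∑ ψ, f ψ ≤ Fintype.card V * R := by
  have hV : (0 : ℝ) < Fintype.card V := by exact_mod_cast Fintype.card_pos
  rw [charMean, div_le_iff₀ hV] at h
  linarith

lemma norm_charSum_piFinset {α V : Type*} [AddCommGroup V] (m : ℕ)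
    (A : Finset α) (v : α → V) (ψ : AddChar V ℂ) :
    ‖charSum (Fintype.piFinset fun _ : Fin m => A) (fun t => ∑ i, v (t i)) ψ‖
      = ‖charSum A v ψ‖ ^ m := by
  rw [charSum_piFinset, norm_prod, Finset.prod_const, Finset.card_univ, Fintype.card_fin]

/-- Hölder's inequality for averages over characters. -/
lemma charMean_rpow_mul_le {V : Type*} [AddCommGroup V] [Fintype V] {f g : AddChar V ℂ → ℝ}
    (hf : ∀ ψ, 0 ≤ f ψ) (hg : ∀ ψ, 0 ≤ g ψ) {t : ℝ} (h0 : 0 < t) (h1 : t < 1) :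
    charMean (fun ψ => f ψ ^ t * g ψ ^ (1 - t)) ≤ charMean f ^ t * charMean g ^ (1 - t) := by
  have hV : (0 : ℝ) < Fintype.card V := by exact_mod_cast Fintype.card_pos
  have h1t : 0 < 1 - t := by linarith
  have hpq : (t⁻¹).HolderConjugate ((1 - t)⁻¹) :=
    (Real.holderConjugate_iff_eq_conjExponent ((one_lt_inv₀ h0).2 h1)).2 (by field_simp)
  have h := Real.inner_le_Lp_mul_Lq_of_nonneg Finset.univ hpq
    (f := fun ψ => f ψ ^ t) (g := fun ψ => g ψ ^ (1 - t))
    (fun ψ _ => Real.rpow_nonneg (hf ψ) _) (fun ψ _ => Real.rpow_nonneg (hg ψ) _)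
  have e1 : ∀ ψ, (f ψ ^ t) ^ t⁻¹ = f ψ := fun ψ => Real.rpow_rpow_inv (hf ψ) h0.ne'
  have e2 : ∀ ψ, (g ψ ^ (1 - t)) ^ (1 - t)⁻¹ = g ψ := fun ψ => Real.rpow_rpow_inv (hg ψ) h1t.ne'
  simp only [e1, e2, one_div, inv_inv] at h
  unfold charMean
  rw [Real.div_rpow (Finset.sum_nonneg fun ψ _ => hf ψ) hV.le,
    Real.div_rpow (Finset.sum_nonneg fun ψ _ => hg ψ) hV.le, div_mul_div_comm,
    ← Real.rpow_add hV, add_sub_cancel, Real.rpow_one]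
  gcongr

lemma momentCurve_sum_eq_iff {k Q N m : ℕ} (hQ : m * N ^ k < Q) (t t' : Fin m → ℤ)
    (ht : ∀ i, t i ∈ Finset.Ico (0 : ℤ) N) (ht' : ∀ i, t' i ∈ Finset.Ico (0 : ℤ) N) :
    ∑ i, momentCurve k Q (t i) = ∑ i, momentCurve k Q (t' i) ↔
      ∀ j : Fin k, ∑ i, t i ^ (j.1 + 1) = ∑ i, t' i ^ (j.1 + 1) := by
  have hb : ∀ t : Fin m → ℤ, (∀ i, t i ∈ Finset.Ico (0 : ℤ) N) → ∀ j : Fin k,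
      0 ≤ ∑ i, t i ^ (j.1 + 1) ∧ ∑ i, t i ^ (j.1 + 1) < Q := by
    intro t ht j
    have h0 : ∀ i, 0 ≤ t i := fun i => (Finset.mem_Ico.1 (ht i)).1
    refine ⟨Finset.sum_nonneg fun i _ => pow_nonneg (h0 i) _, ?_⟩
    calc ∑ i, t i ^ (j.1 + 1) ≤ ∑ _i : Fin m, (N : ℤ) ^ k := by
          refine Finset.sum_le_sum fun i _ => ?_
          have hlt := (Finset.mem_Ico.1 (ht i)).2
          calc t i ^ (j.1 + 1) ≤ (N : ℤ) ^ (j.1 + 1) := pow_le_pow_left₀ (h0 i) hlt.le _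
            _ ≤ (N : ℤ) ^ k := pow_le_pow_right₀ (by have := h0 i; omega) j.2
      _ = ((m * N ^ k : ℕ) : ℤ) := by simp
      _ < Q := by exact_mod_cast hQ
  rw [funext_iff]
  refine forall_congr' fun j => ?_
  simp only [Finset.sum_apply, momentCurve]
  obtain ⟨h1, h2⟩ := hb t ht j
  obtain ⟨h3, h4⟩ := hb t' ht' j
  constructor
  · intro h
    have h' : ((∑ i, t i ^ (j.1 + 1) : ℤ) : ZMod Q) = ((∑ i, t' i ^ (j.1 + 1) : ℤ) : ZMod Q) := by
      push_cast; exact h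
    have := (ZMod.intCast_eq_intCast_iff _ _ _).1 h'
    rwa [Int.ModEq, Int.emod_eq_of_lt h1 h2, Int.emod_eq_of_lt h3 h4] at this
  · intro h
    exact_mod_cast congrArg (fun x : ℤ => (x : ZMod Q)) h

lemma coincidences_eq_of_forall_iff {ι V W : Type*} {T : Finset ι} {w : ι → V} {w' : ι → W}
    (h : ∀ t ∈ T, ∀ t' ∈ T, (w t = w t' ↔ w' t = w' t')) :
    coincidences T w = coincidences T w' := by
  unfold coincidences
  congr 1
  refine Finset.filter_congr fun x hx => ?_
  exact h _ (Finset.mem_product.1 hx).1 _ (Finset.mem_product.1 hx).2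

/-- Translation-dilation invariance of the Vinogradov system. -/
lemma charMean_progSum_pow_le {k Q N p a S : ℕ} [NeZero Q] (hp : 0 < p) (hQ : S * N ^ k < Q)
    (ξ : ℤ) : charMean (fun ψ => progSum k Q N p a ξ ψ ^ (2 * S))
      ≤ vinogradovCount k S (N / p ^ a + 1) := by
  have hpa : (0 : ℤ) < (p ^ a : ℕ) := by positivity
  set P : ℤ := ((p ^ a : ℕ) : ℤ) with hP
  have hmem : ∀ x ∈ progression N p a ξ, x ∈ Finset.Ico (0 : ℤ) N :=
    fun x hx => (Finset.mem_filter.1 hx).1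
  have e1 : charMean (fun ψ => progSum k Q N p a ξ ψ ^ (2 * S))
      = (coincidences (Fintype.piFinset fun _ : Fin S => progression N p a ξ)
        (fun t => ∑ i, momentCurve k Q (t i)) : ℝ) := by
    rw [coincidences_eq_charMean]
    congr 1
    funext ψ
    rw [norm_charSum_piFinset, ← pow_mul, mul_comm S 2]
    rfl
  rw [e1, Nat.cast_le]
  set x₀ := ξ % P with hx₀
  have hrep : ∀ x ∈ progression N p a ξ, x = x₀ + P * (x / P) := by
    intro x hx
    have h := (Finset.mem_filter.1 hx).2
    rw [hx₀, ← h]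
    exact (Int.emod_add_mul_ediv x P).symm
  have hrange : ∀ x ∈ progression N p a ξ, x / P ∈ Finset.Ico (0 : ℤ) (N / p ^ a + 1 : ℕ) := by
    intro x hx
    have h := Finset.mem_Ico.1 (hmem x hx)
    refine Finset.mem_Ico.2 ⟨Int.ediv_nonneg h.1 hpa.le, ?_⟩
    push_cast
    refine Int.lt_add_one_of_le ?_
    have := Int.ediv_le_ediv hpa h.2.le
    simpa [hP] using this
  unfold vinogradovCount coincidences
  refine Finset.card_le_card_of_injOn (fun x => (fun i => x.1 i / P, fun i => x.2 i / P)) ?_ ?_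
  · intro x hx
    simp only [Finset.coe_filter, Finset.mem_product, Fintype.mem_piFinset, Set.mem_ofPred_eq] at hx
    obtain ⟨⟨h1, h2⟩, h3⟩ := hx
    simp only [Finset.coe_filter, Finset.mem_product, Fintype.mem_piFinset, Set.mem_ofPred_eq]
    refine ⟨⟨fun i => hrange _ (h1 i), fun i => hrange _ (h2 i)⟩, ?_⟩
    rw [momentCurve_sum_eq_iff hQ _ _ (fun i => hmem _ (h1 i)) (fun i => hmem _ (h2 i))] at h3
    funext j
    have h4 := sum_add_pow_modEq (M := 0) (n := j.1 + 1) x.1 x.2 (-x₀) (fun l hl hl' => by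
      rw [Int.modEq_zero_iff]
      have := h3 ⟨l - 1, by omega⟩
      simpa only [Nat.sub_add_cancel hl] using this)
    rw [Int.modEq_zero_iff] at h4
    have h5 : ∀ y ∈ progression N p a ξ, (y + -x₀) ^ (j.1 + 1) = P ^ (j.1 + 1) * (y / P) ^ (j.1 + 1) := by
      intro y hy
      rw [← mul_pow]
      congr 1
      have := hrep y hy
      linarith
    rw [Finset.sum_congr rfl fun i _ => h5 _ (h1 i), Finset.sum_congr rfl fun i _ => h5 _ (h2 i),
      ← Finset.mul_sum, ← Finset.mul_sum] at h4
    exact mul_left_cancel₀ (pow_ne_zero _ hpa.ne') h4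
  · intro x hx y hy hxy
    simp only [Finset.coe_filter, Finset.mem_product, Fintype.mem_piFinset, Set.mem_ofPred_eq] at hx hy
    simp only [Prod.mk.injEq] at hxy
    refine Prod.ext (funext fun i => ?_) (funext fun i => ?_)
    · rw [hrep _ (hx.1.1 i), hrep _ (hy.1.1 i), congrFun hxy.1 i]
    · rw [hrep _ (hx.1.2 i), hrep _ (hy.1.2 i), congrFun hxy.2 i]

/-- Replacing the separated tuples by all tuples. -/
lemma charMean_sepSum_le {k Q N p a : ℕ} [NeZero Q] (ξ : ℤ) (A : Finset ℤ) (m : ℕ) :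
    charMean (fun ψ => sepSum k Q N p a ξ ψ ^ 2 * ‖charSum A (momentCurve k Q) ψ‖ ^ (2 * m))
      ≤ charMean (fun ψ => progSum k Q N p a ξ ψ ^ (2 * k) *
        ‖charSum A (momentCurve k Q) ψ‖ ^ (2 * m)) := by
  have h := coincidences_mono (Finset.product_subset_product_left
    (t := Fintype.piFinset fun _ : Fin m => A)
    (Finset.filter_subset (fun t => ∀ i j, i ≠ j → ¬ t i ≡ t j [ZMOD (p ^ (a + 1) : ℕ)])
      (Fintype.piFinset fun _ : Fin k => progression N p a ξ)))
    (fun x => (∑ i, momentCurve k Q (x.1 i)) + ∑ i, momentCurve k Q (x.2 i))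
  have h' : ((_ : ℕ) : ℝ) ≤ _ := Nat.cast_le.2 h
  rw [coincidences_eq_charMean, coincidences_eq_charMean] at h'
  refine le_of_eq_of_le ?_ (h'.trans_eq ?_) <;> congr 1 <;> funext ψ <;>
    rw [charSum_product _ _ (fun t : Fin k → ℤ => ∑ i, momentCurve k Q (t i))
      (fun t : Fin m → ℤ => ∑ i, momentCurve k Q (t i)), norm_mul, mul_pow]
  · rw [norm_charSum_piFinset, ← pow_mul, mul_comm m 2]
    rfl
  · rw [norm_charSum_piFinset, norm_charSum_piFinset, ← pow_mul, ← pow_mul, mul_comm k 2,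
      mul_comm m 2]
    rfl

lemma progSum_def {k Q N p a : ℕ} {ξ : ℤ} {ψ : AddChar (Fin k → ZMod Q) ℂ} :
    ‖charSum (progression N p a ξ) (momentCurve k Q) ψ‖ = progSum k Q N p a ξ ψ := rfl

lemma mem_progression {N p a : ℕ} {ξ x : ℤ} : x ∈ progression N p a ξ ↔
    x ∈ Finset.Ico (0 : ℤ) N ∧ x ≡ ξ [ZMOD (p ^ a : ℕ)] := Finset.mem_filter

/-- A coincidence forces the power sums of the first variables to agree to high `p`-adic order. -/
lemma powerSum_modEq_of_coincidence {k Q N p a b s : ℕ} (hQ : (k + s) * N ^ k < Q) (ξ η : ℤ)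
    (x y : (Fin k → ℤ) × (Fin s → ℤ))
    (hx1 : ∀ i, x.1 i ∈ progression N p a ξ) (hx2 : ∀ i, x.2 i ∈ progression N p b η)
    (hy1 : ∀ i, y.1 i ∈ progression N p a ξ) (hy2 : ∀ i, y.2 i ∈ progression N p b η)
    (h : (∑ i, momentCurve k Q (x.1 i)) + ∑ i, momentCurve k Q (x.2 i)
      = (∑ i, momentCurve k Q (y.1 i)) + ∑ i, momentCurve k Q (y.2 i)) (j : Fin k) :
    ∑ i, (x.1 i - η) ^ (j.1 + 1) ≡ ∑ i, (y.1 i - η) ^ (j.1 + 1)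
      [ZMOD (p ^ ((j.1 + 1) * b) : ℕ)] := by
  have hmem : ∀ x : (Fin k → ℤ) × (Fin s → ℤ), (∀ i, x.1 i ∈ progression N p a ξ) →
      (∀ i, x.2 i ∈ progression N p b η) → ∀ i, Fin.append x.1 x.2 i ∈ Finset.Ico (0 : ℤ) N := by
    intro x h1 h2 i
    refine Fin.addCases (fun i => ?_) (fun i => ?_) i
    · rw [Fin.append_left]; exact (mem_progression.1 (h1 i)).1
    · rw [Fin.append_right]; exact (mem_progression.1 (h2 i)).1
  have h1 := (momentCurve_sum_eq_iff hQ (Fin.append x.1 x.2) (Fin.append y.1 y.2)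
    (hmem x hx1 hx2) (hmem y hy1 hy2)).1 (by
      simpa only [Fin.sum_univ_add, Fin.append_left, Fin.append_right] using h)
  have h2 := sum_add_pow_modEq (M := 0) (n := j.1 + 1) (Fin.append x.1 x.2)
    (Fin.append y.1 y.2) (-η) (fun l hl hl' => by
      rw [Int.modEq_zero_iff]
      have := h1 ⟨l - 1, by omega⟩
      simpa only [Nat.sub_add_cancel hl] using this)
  rw [Int.modEq_zero_iff] at h2
  simp only [Fin.sum_univ_add, Fin.append_left, Fin.append_right, ← sub_eq_add_neg] at h2
  have h3 : ∀ u : Fin s → ℤ, (∀ i, u i ∈ progression N p b η) →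
      ((p ^ ((j.1 + 1) * b) : ℕ) : ℤ) ∣ ∑ i, (u i - η) ^ (j.1 + 1) := by
    intro u hu
    refine Finset.dvd_sum fun i _ => ?_
    have := ((mem_progression.1 (hu i)).2).symm.dvd
    have h4 := pow_dvd_pow_of_dvd this (j.1 + 1)
    rwa [← Nat.cast_pow, ← pow_mul, mul_comm b] at h4
  refine Int.modEq_iff_dvd.2 ?_
  have : ∑ i, (y.1 i - η) ^ (j.1 + 1) - ∑ i, (x.1 i - η) ^ (j.1 + 1)
      = ∑ i, (x.2 i - η) ^ (j.1 + 1) - ∑ i, (y.2 i - η) ^ (j.1 + 1) := by linarith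
  rw [this]
  exact dvd_sub (h3 _ hx2) (h3 _ hy2)

/-- The efficient congruencing step. -/
lemma charMean_sepSum_le_congruencing {k Q N p a b s : ℕ} [NeZero Q] (hp : p.Prime) (hk : 0 < k)
    (hkp : k < p) (hab : a ≤ b) (hakb : a + 1 ≤ k * b) (hQ : (k + s) * N ^ k < Q) (ξ η : ℤ)
    (R : ℝ) (hR : ∀ ξ', charMean (fun ψ => progSum k Q N p (k * b) ξ' ψ ^ (2 * k) *
      progSum k Q N p b η ψ ^ (2 * s)) ≤ R) :
    charMean (fun ψ => sepSum k Q N p a ξ ψ ^ 2 * progSum k Q N p b η ψ ^ (2 * s))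
      ≤ (k ^ k * p ^ ((a + b) * ∑ j ∈ Finset.range k, j) * p ^ (k * (k * b - a)) : ℕ) * k * R := by
  set T := separatedTuples k N p a ξ with hT
  set U := Fintype.piFinset fun _ : Fin s => progression N p b η with hU
  have hR0 : 0 ≤ R := (charMean_nonneg fun ψ => mul_nonneg (pow_nonneg progSum_nonneg _)
    (pow_nonneg progSum_nonneg _)).trans (hR 0)
  let v := momentCurve k Q
  let w : (Fin k → ℤ) × (Fin s → ℤ) → Fin k → ZMod Q := fun x =>
    (∑ i, v (x.1 i)) + ∑ i, v (x.2 i)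
  let π : (Fin k → ℤ) → (Fin k → ℤ) :=
    fun t j => (∑ i, (t i - η) ^ (j.1 + 1)) % (p ^ ((j.1 + 1) * b) : ℕ)
  let M : ℤ := ((p ^ (k * b) : ℕ) : ℤ)
  have hM : 0 < M := by have := hp.pos; positivity
  let Z := T.image fun t i => t i % M
  have hTmem : ∀ t ∈ T, ∀ i, t i ∈ progression N p a ξ := fun t ht =>
    Fintype.mem_piFinset.1 (Finset.mem_filter.1 ht).1
  have hdvd : ∀ {e : ℕ}, e ≤ k * b → ((p ^ e : ℕ) : ℤ) ∣ M := fun {e} he =>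
    Int.natCast_dvd_natCast.2 (pow_dvd_pow p he)
  have hmod : ∀ {e : ℕ}, e ≤ k * b → ∀ x : ℤ, x % M ≡ x [ZMOD (p ^ e : ℕ)] := fun {e} he x =>
    (Int.mod_modEq x M).of_dvd (hdvd he)
  have hje : ∀ j : Fin k, (j.1 + 1) * b ≤ k * b := fun j => Nat.mul_le_mul_right _ j.2
  have hπmod : ∀ t : Fin k → ℤ, π (fun i => t i % M) = π t := by
    intro t
    funext j
    have : ∑ i, (t i % M - η) ^ (j.1 + 1) ≡ ∑ i, (t i - η) ^ (j.1 + 1)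
        [ZMOD (p ^ ((j.1 + 1) * b) : ℕ)] := Int.ModEq.sum fun i _ =>
      ((hmod (hje j) (t i)).sub_right η).pow _
    exact this
  have hZ : ∀ z ∈ Z, (∀ i, z i ∈ Finset.Ico (0 : ℤ) M) ∧ (∀ i, z i ≡ ξ [ZMOD (p ^ a : ℕ)]) ∧
      ∀ i j, i ≠ j → ¬ z i ≡ z j [ZMOD (p ^ (a + 1) : ℕ)] := by
    intro z hz
    obtain ⟨t, ht, rfl⟩ := Finset.mem_image.1 hz
    refine ⟨fun i => Finset.mem_Ico.2 ⟨Int.emod_nonneg _ hM.ne', Int.emod_lt_of_pos _ hM⟩,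
      fun i => (hmod (by omega) _).trans (mem_progression.1 (hTmem t ht i)).2, fun i j hij h => ?_⟩
    exact (Finset.mem_filter.1 ht).2 i j hij
      (((hmod hakb _).symm.trans h).trans (hmod hakb _))
  have hB : ∀ c, (Z.filter fun z => π z = c).card
      ≤ k ^ k * p ^ ((a + b) * ∑ j ∈ Finset.range k, j) := by
    intro c
    refine card_pattern_le hp hkp hab hk ξ η _ (fun z hz => (hZ z (Finset.mem_filter.1 hz).1).1)
      (fun z hz => (hZ z (Finset.mem_filter.1 hz).1).2.1)
      (fun z hz => (hZ z (Finset.mem_filter.1 hz).1).2.2) fun z hz z' hz' j => ?_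
    exact congrFun ((Finset.mem_filter.1 hz).2.trans (Finset.mem_filter.1 hz').2.symm) j
  have hZcard : Z.card ≤ p ^ (k * (k * b - a)) := by
    have hsub : Z ⊆ Fintype.piFinset fun _ : Fin k =>
        (Finset.Ico (0 : ℤ) (p ^ (k * b) : ℕ)).filter fun x => x ≡ ξ [ZMOD (p ^ a : ℕ)] :=
      fun z hz => Fintype.mem_piFinset.2 fun i =>
        Finset.mem_filter.2 ⟨(hZ z hz).1 i, (hZ z hz).2.1 i⟩
    refine (Finset.card_le_card hsub).trans_eq ?_
    rw [Fintype.card_piFinset, Finset.prod_const,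
      card_Ico_filter_modEq_pow hp.pos (by omega : a ≤ k * b), Finset.card_univ, Fintype.card_fin,
      ← pow_mul, mul_comm]
  have hE : charMean (fun ψ => sepSum k Q N p a ξ ψ ^ 2 * progSum k Q N p b η ψ ^ (2 * s))
      = (coincidences (T ×ˢ U) w : ℝ) := by
    rw [coincidences_eq_charMean]
    congr 1
    funext ψ
    rw [charSum_product _ _ (fun t : Fin k → ℤ => ∑ i, v (t i))
      (fun t : Fin s → ℤ => ∑ i, v (t i)), norm_mul, mul_pow, norm_charSum_piFinset, ← pow_mul,
      mul_comm s 2]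
    rfl
  have hfib : coincidences (T ×ˢ U) w = ∑ c ∈ (T ×ˢ U).image (fun x => π x.1),
      coincidences ((T.filter fun t => π t = c) ×ˢ U) w := by
    rw [coincidences_eq_sum_fiber (T ×ˢ U) w (fun x => π x.1)]
    · refine Finset.sum_congr (by congr!) fun c _ => ?_
      congr 1
      ext x
      simp only [Finset.mem_filter, Finset.mem_product]
      tauto
    · intro x hx y hy hxy
      obtain ⟨hx1, hx2⟩ := Finset.mem_product.1 hx
      obtain ⟨hy1, hy2⟩ := Finset.mem_product.1 hy
      funext j
      exact powerSum_modEq_of_coincidence hQ ξ η x y (hTmem _ hx1) (Fintype.mem_piFinset.1 hx2)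
        (hTmem _ hy1) (Fintype.mem_piFinset.1 hy2) hxy j
  have hclass : ∀ c, (coincidences ((T.filter fun t => π t = c) ×ˢ U) w : ℝ)
      ≤ ((Z.filter fun z => π z = c).card : ℝ) ^ 2 * k * R := by
    intro c
    refine coincidences_product_le_of_pattern hk (T.filter fun t => π t = c) v U
      (fun u => ∑ i, v (u i)) (fun x => x % M) (fun z => progression N p (k * b) z)
      (fun t ht i => ?_) _ (fun t ht => ?_) R (fun z _ i => ?_)
    · have := hTmem t (Finset.mem_filter.1 ht).1 i
      exact mem_progression.2 ⟨(mem_progression.1 this).1, (hmod le_rfl _).symm⟩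
    · refine Finset.mem_filter.2 ⟨Finset.mem_image_of_mem _ (Finset.mem_filter.1 ht).1, ?_⟩
      exact (hπmod t).trans (Finset.mem_filter.1 ht).2
    · refine sum_le_card_mul_of_charMean_le (le_of_eq_of_le ?_ (hR (z i)))
      congr 1
      funext ψ
      rw [norm_charSum_piFinset, ← pow_mul, mul_comm s 2]
      rfl
  set B := k ^ k * p ^ ((a + b) * ∑ j ∈ Finset.range k, j) with hBdef
  rw [hE, hfib, Nat.cast_sum]
  calc _ ≤ ∑ c ∈ (T ×ˢ U).image (fun x => π x.1),
        ((Z.filter fun z => π z = c).card : ℝ) * (B * k * R) := by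
        refine Finset.sum_le_sum fun c _ => (hclass c).trans ?_
        have hBc : ((Z.filter fun z => π z = c).card : ℝ) ≤ B := by exact_mod_cast hB c
        rw [pow_two, mul_assoc, mul_assoc, mul_assoc (B : ℝ)]
        gcongr
    _ = ((∑ c ∈ (T ×ˢ U).image (fun x => π x.1), (Z.filter fun z => π z = c).card : ℕ) : ℝ)
        * (B * k * R) := by rw [← Finset.sum_mul]; push_cast; rfl
    _ ≤ ((p ^ (k * (k * b - a)) : ℕ) : ℝ) * (B * k * R) := by
        gcongr
        refine le_trans ?_ hZcard
        rw [Finset.sum_card_fiberwise_eq_card_filter]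
        exact Finset.card_filter_le _ _
    _ = _ := by push_cast; ring

lemma exists_sum_equiv_of_injective {k r s : ℕ} (hs : k + r = s) (ι : Fin k → Fin s)
    (hι : Function.Injective ι) : ∃ σ : Fin k ⊕ Fin r ≃ Fin s, ∀ i, σ (Sum.inl i) = ι i := by
  have hcard : Fintype.card (Fin r) = Fintype.card ((Set.range ι)ᶜ : Set (Fin s)) := by
    rw [Fintype.card_compl_set, Set.card_range_of_injective hι]
    simp
    omega
  refine ⟨((Equiv.ofInjective ι hι).sumCongr (Fintype.equivOfCardEq hcard)).trans
    (Equiv.Set.sumCompl (Set.range ι)), fun i => ?_⟩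
  simp [Equiv.Set.sumCompl_apply_inl]

/-- Tuples with few distinct entries form a small set. -/
lemma exists_small_pattern_set {s m : ℕ} (hs : 0 < s) (D : Finset ℤ) :
    ∃ C : Finset (Fin s → ℤ), C.card ≤ m ^ s * D.card ^ m ∧
      ∀ c : Fin s → ℤ, (∀ i, c i ∈ D) → (Finset.univ.image c).card ≤ m → c ∈ C := by
  refine ⟨((Finset.univ : Finset (Fin s → Fin m)) ×ˢ Fintype.piFinset fun _ : Fin m => D).image
    fun x i => x.2 (x.1 i), ?_, fun c hc hcard => ?_⟩
  · refine Finset.card_image_le.trans_eq ?_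
    rw [Finset.card_product, Fintype.card_piFinset]
    simp
  · set I := Finset.univ.image c with hI
    have hmem : ∀ i, c i ∈ I := fun i => Finset.mem_image_of_mem _ (Finset.mem_univ i)
    let eq := I.equivFin
    refine Finset.mem_image.2 ⟨(fun i => Fin.castLE hcard (eq ⟨c i, hmem i⟩),
      fun n => if h : n.1 < I.card then (eq.symm ⟨n.1, h⟩ : ℤ) else c ⟨0, hs⟩), ?_, ?_⟩
    · refine Finset.mem_product.2 ⟨Finset.mem_univ _, Fintype.mem_piFinset.2 fun n => ?_⟩
      dsimp only
      split_ifs with h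
      · obtain ⟨i, -, hi⟩ := Finset.mem_image.1 (eq.symm ⟨n.1, h⟩).2
        rw [← hi]; exact hc i
      · exact hc _
    · funext i
      have h : (Fin.castLE hcard (eq ⟨c i, hmem i⟩)).1 < I.card := (eq ⟨c i, hmem i⟩).2
      dsimp only
      rw [dif_pos h]
      simp

lemma charSum_separated_eq {k r s Q N p a : ℕ} (ξ : ℤ) (σ : Fin k ⊕ Fin r ≃ Fin s)
    (ψ : AddChar (Fin k → ZMod Q) ℂ) :
    ‖charSum ((Fintype.piFinset fun _ : Fin s => progression N p a ξ).filter fun t =>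
      ∀ i j, i ≠ j → ¬ t (σ (Sum.inl i)) ≡ t (σ (Sum.inl j)) [ZMOD (p ^ (a + 1) : ℕ)])
      (fun t => ∑ i, momentCurve k Q (t i)) ψ‖
      = sepSum k Q N p a ξ ψ * progSum k Q N p a ξ ψ ^ r := by
  rw [← progSum_def, ← norm_charSum_piFinset, sepSum, ← norm_mul,
    ← charSum_product _ _ (fun t : Fin k → ℤ => ∑ i, momentCurve k Q (t i))
      (fun t : Fin r → ℤ => ∑ i, momentCurve k Q (t i))]
  congr 1
  unfold charSum
  refine Finset.sum_bij' (fun t _ => (fun i => t (σ (Sum.inl i)), fun i => t (σ (Sum.inr i))))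
    (fun y _ i => Sum.elim y.1 y.2 (σ.symm i)) ?_ ?_ ?_ ?_ ?_
  · intro t ht
    obtain ⟨h1, h2⟩ := Finset.mem_filter.1 ht
    rw [Fintype.mem_piFinset] at h1
    exact Finset.mem_product.2 ⟨Finset.mem_filter.2 ⟨Fintype.mem_piFinset.2 fun i => h1 _, h2⟩,
      Fintype.mem_piFinset.2 fun i => h1 _⟩
  · intro y hy
    obtain ⟨h1, h2⟩ := Finset.mem_product.1 hy
    obtain ⟨h3, h4⟩ := Finset.mem_filter.1 h1
    rw [Fintype.mem_piFinset] at h2 h3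
    refine Finset.mem_filter.2 ⟨Fintype.mem_piFinset.2 fun i => ?_, ?_⟩
    · rcases σ.symm i with l | l
      · exact h3 l
      · exact h2 l
    · simpa using h4
  · intro t _
    funext i
    obtain ⟨l, rfl⟩ := σ.surjective i
    rcases l with l | l <;> simp
  · intro y _
    simp
  · intro t _
    congr 1
    change ∑ i, momentCurve k Q (t i) = _
    rw [← σ.sum_comp, Fintype.sum_sum_type]

/-- The conditioning step. -/
lemma charMean_progSum_le_conditioning {κ : Type*} {k r s Q N p a : ℕ} [NeZero Q] (hp : 0 < p)
    (hs : k + r = s) (hk : 0 < k) (ξ : ℤ) (U : Finset κ) (u : κ → Fin k → ZMod Q) (R : ℝ)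
    (hR : ∀ ξ', charMean (fun ψ => progSum k Q N p (a + 1) ξ' ψ ^ (2 * s) *
      ‖charSum U u ψ‖ ^ 2) ≤ R) :
    charMean (fun ψ => progSum k Q N p a ξ ψ ^ (2 * s) * ‖charSum U u ψ‖ ^ 2)
      ≤ Fintype.card (Option (Fin k ⊕ Fin r ≃ Fin s)) *
        (Fintype.card (Option (Fin k ⊕ Fin r ≃ Fin s)) *
          charMean (fun ψ => sepSum k Q N p a ξ ψ ^ 2 * progSum k Q N p a ξ ψ ^ (2 * r) *
            ‖charSum U u ψ‖ ^ 2) + (((k - 1) ^ s * p ^ (k - 1) : ℕ) : ℝ) ^ 2 * s * R) := by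
  set v := momentCurve k Q with hv
  set A := progression N p a ξ with hA
  set W := Fintype.piFinset fun _ : Fin s => A with hW
  set P : ℤ := ((p ^ (a + 1) : ℕ) : ℤ) with hP
  have hP0 : 0 < P := by positivity
  have hpa : ((p ^ a : ℕ) : ℤ) ∣ P := Int.natCast_dvd_natCast.2 (pow_dvd_pow p (Nat.le_succ a))
  let good : (Fin k ⊕ Fin r ≃ Fin s) → (Fin s → ℤ) → Prop := fun σ t =>
    ∀ i j, i ≠ j → ¬ t (σ (Sum.inl i)) ≡ t (σ (Sum.inl j)) [ZMOD P]
  let π : (Fin s → ℤ) → Option (Fin k ⊕ Fin r ≃ Fin s) := fun t =>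
    if h : ∃ σ, good σ t then some h.choose else none
  have hπsome : ∀ t σ, π t = some σ → good σ t := by
    intro t σ h
    by_cases hex : ∃ σ, good σ t
    · simp only [π, dif_pos hex, Option.some.injEq] at h
      exact h ▸ hex.choose_spec
    · simp [π, dif_neg hex] at h
  have hπnone : ∀ t, π t = none → ¬ ∃ σ, good σ t := by
    intro t h hex
    simp [π, dif_pos hex] at h
  let w : (Fin s → ℤ) × κ → Fin k → ZMod Q := fun x => (∑ i, v (x.1 i)) + u x.2
  have hnorm : ∀ (T : Finset (Fin s → ℤ)), (coincidences (T ×ˢ U) w : ℝ) =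
      charMean fun ψ => ‖charSum T (fun t => ∑ i, v (t i)) ψ‖ ^ 2 * ‖charSum U u ψ‖ ^ 2 := by
    intro T
    rw [coincidences_eq_charMean]
    congr 1
    funext ψ
    rw [charSum_product _ _ (fun t : Fin s → ℤ => ∑ i, v (t i)), norm_mul, mul_pow]
  have hE : charMean (fun ψ => progSum k Q N p a ξ ψ ^ (2 * s) * ‖charSum U u ψ‖ ^ 2)
      = (coincidences (W ×ˢ U) w : ℝ) := by
    rw [hnorm]
    congr 1
    funext ψ
    rw [norm_charSum_piFinset, ← pow_mul, mul_comm s 2]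
    rfl
  have hsome : ∀ σ, (coincidences ((W ×ˢ U).filter fun x => π x.1 = some σ) w : ℝ)
      ≤ charMean (fun ψ => sepSum k Q N p a ξ ψ ^ 2 * progSum k Q N p a ξ ψ ^ (2 * r) *
            ‖charSum U u ψ‖ ^ 2) := by
    intro σ
    have hsub : ((W ×ˢ U).filter fun x => π x.1 = some σ) ⊆ (W.filter fun t => good σ t) ×ˢ U := by
      intro x hx
      obtain ⟨h1, h2⟩ := Finset.mem_filter.1 hx
      obtain ⟨h3, h4⟩ := Finset.mem_product.1 h1
      exact Finset.mem_product.2 ⟨Finset.mem_filter.2 ⟨h3, hπsome _ _ h2⟩, h4⟩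
    refine (Nat.cast_le.2 (coincidences_mono hsub w)).trans_eq ?_
    rw [hnorm]
    congr 1
    funext ψ
    rw [charSum_separated_eq, mul_pow, ← pow_mul, mul_comm r 2]
  have hnone : (coincidences ((W ×ˢ U).filter fun x => π x.1 = none) w : ℝ)
      ≤ (((k - 1) ^ s * p ^ (k - 1) : ℕ) : ℝ) ^ 2 * s * R := by
    have hsub : ((W ×ˢ U).filter fun x => π x.1 = none) ⊆ (W.filter fun t => π t = none) ×ˢ U := by
      intro x hx
      obtain ⟨h1, h2⟩ := Finset.mem_filter.1 hx
      obtain ⟨h3, h4⟩ := Finset.mem_product.1 h1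
      exact Finset.mem_product.2 ⟨Finset.mem_filter.2 ⟨h3, h2⟩, h4⟩
    refine (Nat.cast_le.2 (coincidences_mono hsub w)).trans ?_
    have hs0 : 0 < s := by omega
    obtain ⟨C, hCcard, hC⟩ := exists_small_pattern_set (m := k - 1) hs0
      ((Finset.Ico (0 : ℤ) (p ^ (a + 1) : ℕ)).filter fun x => x ≡ ξ [ZMOD (p ^ a : ℕ)])
    rw [card_Ico_filter_modEq_pow hp (Nat.le_succ a), Nat.succ_sub (le_refl a), Nat.sub_self,
      pow_one] at hCcard
    have hR0 : 0 ≤ R := (charMean_nonneg fun ψ => mul_nonneg (pow_nonneg progSum_nonneg _)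
      (pow_nonneg (norm_nonneg _) _)).trans (hR 0)
    have hmain := coincidences_product_le_of_pattern hs0 (W.filter fun t => π t = none) v U u
      (fun x => x % P) (fun z => progression N p (a + 1) z) (fun t ht i => ?_) C (fun t ht => ?_) R
      (fun c _ i => sum_le_card_mul_of_charMean_le (hR (c i)))
    · refine hmain.trans ?_
      gcongr
    · have := Fintype.mem_piFinset.1 (Finset.mem_filter.1 ht).1 i
      exact mem_progression.2 ⟨(mem_progression.1 this).1, (Int.mod_modEq _ _).symm⟩
    · obtain ⟨htW, htn⟩ := Finset.mem_filter.1 ht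
      rw [hW, Fintype.mem_piFinset] at htW
      refine hC _ (fun i => Finset.mem_filter.2 ⟨Finset.mem_Ico.2
        ⟨Int.emod_nonneg _ hP0.ne', Int.emod_lt_of_pos _ hP0⟩, ?_⟩) ?_
      · exact ((Int.mod_modEq _ _).of_dvd hpa).trans (mem_progression.1 (htW i)).2
      · by_contra! hlt
        refine hπnone t htn ?_
        set I := Finset.univ.image fun i => t i % P with hI
        have hkI : k ≤ I.card := by omega
        have hpre : ∀ y : I, ∃ i, t i % P = y := fun y => by
          obtain ⟨i, -, hi⟩ := Finset.mem_image.1 y.2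
          exact ⟨i, hi⟩
        choose g hg using hpre
        let emb : Fin k → I := fun i => I.equivFin.symm (Fin.castLE hkI i)
        have hemb : Function.Injective emb :=
          I.equivFin.symm.injective.comp (Fin.castLE_injective hkI)
        have hval : ∀ i j, t (g (emb i)) ≡ t (g (emb j)) [ZMOD P] → i = j := by
          intro i j hij
          refine hemb (Subtype.ext ?_)
          rw [← hg, ← hg]
          exact hij
        obtain ⟨σ, hσ⟩ := exists_sum_equiv_of_injective hs (fun i => g (emb i))
          (fun i j hij => hval i j (by simp only at hij; rw [hij]))
        refine ⟨σ, fun i j hij h => hij (hval i j ?_)⟩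
        rwa [hσ, hσ] at h
  rw [hE]
  refine (Nat.cast_le.2 (coincidences_le_card_mul_sum (W ×ˢ U) w (fun x => π x.1) Finset.univ
    fun x _ => Finset.mem_univ _)).trans ?_
  rw [Fintype.sum_option]
  push_cast
  rw [Finset.card_univ]
  refine mul_le_mul_of_nonneg_left ?_ (Nat.cast_nonneg _)
  rw [add_comm]
  refine add_le_add ?_ (by refine le_of_eq_of_le (by congr!) (le_of_le_of_eq hnone (by push_cast; rfl)))
  refine (Finset.sum_le_card_nsmul _ _ _ fun σ _ => le_of_eq_of_le (by congr!) (hsome σ)).trans ?_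
  rw [nsmul_eq_mul]
  refine mul_le_mul_of_nonneg_right ?_ (charMean_nonneg fun ψ => mul_nonneg (mul_nonneg
    (pow_nonneg sepSum_nonneg _) (pow_nonneg progSum_nonneg _)) (pow_nonneg (norm_nonneg _) _))
  rw [Finset.card_univ, Nat.cast_le, Fintype.card_option]
  exact Nat.le_succ _

lemma charMean_pow_mul_pow_le {V : Type*} [AddCommGroup V] [Fintype V] {f g : AddChar V ℂ → ℝ}
    (hf : ∀ ψ, 0 ≤ f ψ) (hg : ∀ ψ, 0 ≤ g ψ) {m n : ℕ} (hm : 0 < m) (hn : 0 < n) :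
    charMean (fun ψ => f ψ ^ m * g ψ ^ n)
      ≤ charMean (fun ψ => f ψ ^ (m + n)) ^ ((m : ℝ) / (m + n : ℕ)) *
        charMean (fun ψ => g ψ ^ (m + n)) ^ ((n : ℝ) / (m + n : ℕ)) := by
  have hmn : (0 : ℝ) < ((m + n : ℕ) : ℝ) := by positivity
  have hm' : (0 : ℝ) < m := by exact_mod_cast hm
  have hn' : (0 : ℝ) < n := by exact_mod_cast hn
  have ht : 1 - (m : ℝ) / (m + n : ℕ) = (n : ℝ) / (m + n : ℕ) := by
    field_simp; push_cast; ring
  have h := charMean_rpow_mul_le (f := fun ψ => f ψ ^ (m + n)) (g := fun ψ => g ψ ^ (m + n))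
    (fun ψ => pow_nonneg (hf ψ) _) (fun ψ => pow_nonneg (hg ψ) _) (t := (m : ℝ) / (m + n : ℕ))
    (by positivity) (by rw [div_lt_one hmn]; push_cast; linarith)
  rw [ht] at h
  refine le_of_eq_of_le ?_ h
  congr 1
  funext ψ
  have key : ∀ {x : ℝ} (l : ℕ), 0 ≤ x → (x ^ (m + n)) ^ ((l : ℝ) / (m + n : ℕ)) = x ^ l := by
    intro x l hx
    rw [← Real.rpow_natCast, ← Real.rpow_mul hx, mul_div_cancel₀ _ hmn.ne', Real.rpow_natCast]
  rw [key _ (hf ψ), key _ (hg ψ)]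

lemma charMean_sepSum_holder {k Q N p a b : ℕ} [NeZero Q] (hk : 2 ≤ k) (ξ η : ℤ) :
    charMean (fun ψ => sepSum k Q N p a ξ ψ ^ 2 * progSum k Q N p a ξ ψ ^ (2 * (k * (k - 1))) *
      progSum k Q N p b η ψ ^ (2 * k))
    ≤ charMean (fun ψ => sepSum k Q N p a ξ ψ ^ 2 * progSum k Q N p b η ψ ^ (2 * (k * k)))
        ^ (1 / (k : ℝ)) *
      charMean (fun ψ => progSum k Q N p a ξ ψ ^ (2 * (k + k * k))) ^ (1 - 1 / (k : ℝ)) := by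
  have hk0 : (0 : ℝ) < k := by positivity
  have hk1 : (1 : ℝ) < k := by exact_mod_cast hk
  have ht : 1 / (k : ℝ) < 1 := by rw [div_lt_one hk0]; exact hk1
  have h := charMean_rpow_mul_le
    (f := fun ψ => sepSum k Q N p a ξ ψ ^ 2 * progSum k Q N p b η ψ ^ (2 * (k * k)))
    (g := fun ψ => sepSum k Q N p a ξ ψ ^ 2 * progSum k Q N p a ξ ψ ^ (2 * (k * k)))
    (fun ψ => mul_nonneg (pow_nonneg sepSum_nonneg _) (pow_nonneg progSum_nonneg _))
    (fun ψ => mul_nonneg (pow_nonneg sepSum_nonneg _) (pow_nonneg progSum_nonneg _))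
    (by positivity : 0 < 1 / (k : ℝ)) ht
  have hsep : charMean (fun ψ => sepSum k Q N p a ξ ψ ^ 2 * progSum k Q N p a ξ ψ ^ (2 * (k * k)))
      ≤ charMean (fun ψ => progSum k Q N p a ξ ψ ^ (2 * (k + k * k))) := by
    refine (charMean_sepSum_le ξ (progression N p a ξ) (k * k)).trans_eq ?_
    congr 1
    funext ψ
    rw [progSum_def, ← pow_add, mul_add]
  have h2 := h.trans (mul_le_mul_of_nonneg_left (Real.rpow_le_rpow (charMean_nonneg fun ψ =>
    mul_nonneg (pow_nonneg sepSum_nonneg _) (pow_nonneg progSum_nonneg _)) hsep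
      (by linarith : 0 ≤ 1 - 1 / (k : ℝ))) (Real.rpow_nonneg (charMean_nonneg fun ψ =>
    mul_nonneg (pow_nonneg sepSum_nonneg _) (pow_nonneg progSum_nonneg _)) _))
  refine le_of_eq_of_le ?_ h2
  congr 1
  funext ψ
  have hF : 0 ≤ sepSum k Q N p a ξ ψ := sepSum_nonneg
  have hfa : 0 ≤ progSum k Q N p a ξ ψ := progSum_nonneg
  have hfb : 0 ≤ progSum k Q N p b η ψ := progSum_nonneg
  rw [Real.mul_rpow (by positivity) (by positivity), Real.mul_rpow (by positivity) (by positivity)]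
  have e1 : (sepSum k Q N p a ξ ψ ^ 2) ^ (1 / (k : ℝ)) * (sepSum k Q N p a ξ ψ ^ 2) ^ (1 - 1 / (k : ℝ))
      = sepSum k Q N p a ξ ψ ^ 2 := by
    rw [← Real.rpow_add_of_nonneg (by positivity) (by positivity) (by linarith), add_sub_cancel,
      Real.rpow_one]
  have e2 : (progSum k Q N p b η ψ ^ (2 * (k * k))) ^ (1 / (k : ℝ))
      = progSum k Q N p b η ψ ^ (2 * k) := by
    rw [← Real.rpow_natCast, ← Real.rpow_mul hfb, ← Real.rpow_natCast]
    congr 1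
    push_cast
    field_simp
  have e3 : (progSum k Q N p a ξ ψ ^ (2 * (k * k))) ^ (1 - 1 / (k : ℝ))
      = progSum k Q N p a ξ ψ ^ (2 * (k * (k - 1))) := by
    rw [← Real.rpow_natCast, ← Real.rpow_mul hfa, ← Real.rpow_natCast]
    congr 1
    rw [Nat.cast_mul, Nat.cast_mul, Nat.cast_mul, Nat.cast_mul, Nat.cast_sub (by omega)]
    push_cast
    field_simp
  rw [e2, e3]
  linear_combination -progSum k Q N p b η ψ ^ (2 * k) *
    progSum k Q N p a ξ ψ ^ (2 * (k * (k - 1))) * e1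

/-- Iterated conditioning, starting from bounds for the separated mean values. -/
lemma exists_mixed_bound {k : ℕ} (hk : 2 ≤ k) {c : ℝ} (hc : 0 ≤ c) (n : ℕ) :
    ∃ C : ℝ, 0 ≤ C ∧ ∀ (N p Q a b : ℕ) [NeZero Q] (Z l u v : ℝ), a + n = b → p.Prime → 0 ≤ Z →
      2 * ((k : ℝ) - 1) - v / k - l * (1 - 1 / k) ≤ 0 →
      -l * b ≤ (u - v * b) / k - l * b * (1 - 1 / k) →
      (∀ a', a ≤ a' → a' ≤ b → ∀ ξ η, charMean (fun ψ => sepSum k Q N p a' ξ ψ ^ 2 *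
        progSum k Q N p b η ψ ^ (2 * (k * k))) ≤ c * Z * (p : ℝ) ^ (u - v * a')) →
      (∀ a', a ≤ a' → a' ≤ b → ∀ ξ, charMean (fun ψ => progSum k Q N p a' ξ ψ ^ (2 * (k + k * k)))
        ≤ Z * (p : ℝ) ^ (-l * a')) →
      ∀ ξ η, charMean (fun ψ => progSum k Q N p a ξ ψ ^ (2 * (k * k)) *
        progSum k Q N p b η ψ ^ (2 * k)) ≤ C * Z * (p : ℝ) ^ ((u - v * a) / k - l * a * (1 - 1 / k)) := by
  have hk0 : (0 : ℝ) < k := by positivity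
  have hk1 : (1 : ℝ) < k := by exact_mod_cast hk
  have ht : 1 / (k : ℝ) < 1 := by rw [div_lt_one hk0]; exact hk1
  induction n with
  | zero =>
    refine ⟨1, zero_le_one, ?_⟩
    intro N p Q a b _ Z l u v hab hp hZ hslope hbase hK hJ ξ η
    obtain rfl : a = b := by simpa using hab
    have hp1 : (1 : ℝ) ≤ p := by exact_mod_cast hp.one_le
    have h := charMean_pow_mul_pow_le (f := progSum k Q N p a ξ) (g := progSum k Q N p a η)
      (fun _ => progSum_nonneg) (fun _ => progSum_nonneg) (m := 2 * (k * k)) (n := 2 * k)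
      (by positivity) (by positivity)
    have hsum : 2 * (k * k) + 2 * k = 2 * (k + k * k) := by ring
    rw [hsum] at h
    have hX : 0 ≤ Z * (p : ℝ) ^ (-l * a) := by positivity
    have hnn : ∀ ξ, 0 ≤ charMean (fun ψ => progSum k Q N p a ξ ψ ^ (2 * (k + k * k))) := fun ξ =>
      charMean_nonneg fun ψ => pow_nonneg progSum_nonneg _
    calc _ ≤ _ := h
      _ ≤ (Z * (p : ℝ) ^ (-l * a)) ^ (((2 * (k * k) : ℕ) : ℝ) / (2 * (k + k * k) : ℕ)) *
          (Z * (p : ℝ) ^ (-l * a)) ^ (((2 * k : ℕ) : ℝ) / (2 * (k + k * k) : ℕ)) := by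
          refine mul_le_mul (Real.rpow_le_rpow (hnn _) (hJ a le_rfl le_rfl ξ) (by positivity))
            (Real.rpow_le_rpow (hnn _) (hJ a le_rfl le_rfl η) (by positivity))
            (Real.rpow_nonneg (hnn _) _) (by positivity)
      _ = Z * (p : ℝ) ^ (-l * a) := by
          rw [← Real.rpow_add_of_nonneg hX (by positivity) (by positivity), ← add_div,
            ← Nat.cast_add, hsum, div_self (by positivity), Real.rpow_one]
      _ ≤ _ := by
          rw [one_mul]
          gcongr
  | succ n ih =>
    obtain ⟨C, hC, ih⟩ := ih
    set M : ℝ := (Fintype.card (Option (Fin k ⊕ Fin (k * (k - 1)) ≃ Fin (k * k))) : ℝ) with hM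
    refine ⟨M * (M * c ^ (1 / (k : ℝ)) + ((k - 1 : ℕ) ^ (k * k) : ℝ) ^ 2 * (k * k : ℕ) * C),
      by positivity, ?_⟩
    intro N p Q a b _ Z l u v hab hp hZ hslope hbase hK hJ ξ η
    have hp1 : (1 : ℝ) ≤ p := by exact_mod_cast hp.one_le
    have hp0 : (0 : ℝ) < p := by linarith
    have hI := ih N p Q (a + 1) b Z l u v (by omega) hp hZ hslope hbase
      (fun a' h => hK a' (by omega)) (fun a' h => hJ a' (by omega))
    set R := C * Z * (p : ℝ) ^ ((u - v * (a + 1 : ℕ)) / k - l * (a + 1 : ℕ) * (1 - 1 / k)) with hR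
    have hUe : ∀ ψ, ‖charSum (Fintype.piFinset fun _ : Fin k => progression N p b η)
        (fun t => ∑ i, momentCurve k Q (t i)) ψ‖ ^ 2 = progSum k Q N p b η ψ ^ (2 * k) := by
      intro ψ
      rw [norm_charSum_piFinset, ← pow_mul, mul_comm k 2]
      rfl
    have hcond := charMean_progSum_le_conditioning (k := k) (r := k * (k - 1)) (s := k * k)
      (N := N) (a := a) hp.pos
      (by obtain ⟨m, rfl⟩ : ∃ m, k = m + 1 := ⟨k - 1, by omega⟩
          simp; ring) (by omega) ξ
      (Fintype.piFinset fun _ : Fin k => progression N p b η)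
      (fun t => ∑ i, momentCurve k Q (t i)) R (by
        intro ξ'
        simp only [hUe]
        exact hI ξ' η)
    simp only [hUe] at hcond
    refine hcond.trans ?_
    rw [← hM]
    have hKa := hK a le_rfl (by omega) ξ η
    have hJa := hJ a le_rfl (by omega) ξ
    have h1 : charMean (fun ψ => sepSum k Q N p a ξ ψ ^ 2 *
        progSum k Q N p a ξ ψ ^ (2 * (k * (k - 1))) * progSum k Q N p b η ψ ^ (2 * k))
        ≤ c ^ (1 / (k : ℝ)) * Z * (p : ℝ) ^ ((u - v * a) / k - l * a * (1 - 1 / k)) := by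
      calc _ ≤ _ := charMean_sepSum_holder hk ξ η
        _ ≤ (c * Z * (p : ℝ) ^ (u - v * a)) ^ (1 / (k : ℝ)) *
            (Z * (p : ℝ) ^ (-l * a)) ^ (1 - 1 / (k : ℝ)) := by
            refine mul_le_mul (Real.rpow_le_rpow (charMean_nonneg fun ψ => mul_nonneg
              (pow_nonneg sepSum_nonneg _) (pow_nonneg progSum_nonneg _)) hKa (by positivity))
              (Real.rpow_le_rpow (charMean_nonneg fun ψ => pow_nonneg progSum_nonneg _) hJa
                (by linarith)) (Real.rpow_nonneg (charMean_nonneg fun ψ =>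
                  pow_nonneg progSum_nonneg _) _) (by positivity)
        _ = c ^ (1 / (k : ℝ)) * (Z ^ (1 / (k : ℝ)) * Z ^ (1 - 1 / (k : ℝ))) *
            ((p : ℝ) ^ ((u - v * a) * (1 / k)) * (p : ℝ) ^ (-l * a * (1 - 1 / k))) := by
            rw [Real.mul_rpow (by positivity) (by positivity), Real.mul_rpow hc hZ,
              Real.mul_rpow hZ (by positivity), ← Real.rpow_mul hp0.le, ← Real.rpow_mul hp0.le]
            ring
        _ = _ := by
            rw [← Real.rpow_add_of_nonneg hZ (by positivity) (by linarith), add_sub_cancel,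
              Real.rpow_one, ← Real.rpow_add hp0]
            congr 2
            ring
    have h2 : (((k - 1) ^ (k * k) * p ^ (k - 1) : ℕ) : ℝ) ^ 2 * (k * k : ℕ) * R
        ≤ ((k - 1 : ℕ) ^ (k * k) : ℝ) ^ 2 * (k * k : ℕ) * C * Z *
          (p : ℝ) ^ ((u - v * a) / k - l * a * (1 - 1 / k)) := by
      have h3 : ((p : ℝ) ^ (k - 1)) ^ 2 *
          (p : ℝ) ^ ((u - v * (a + 1 : ℕ)) / k - l * (a + 1 : ℕ) * (1 - 1 / k))
          ≤ (p : ℝ) ^ ((u - v * a) / k - l * a * (1 - 1 / k)) := by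
        rw [← pow_mul, ← Real.rpow_natCast, ← Real.rpow_add hp0]
        refine Real.rpow_le_rpow_of_exponent_le hp1 ?_
        rw [Nat.cast_mul, Nat.cast_sub (by omega)]
        push_cast
        have : (u - v * (a + 1)) / k = (u - v * a) / k - v / k := by ring
        rw [this]
        linarith
      rw [hR]
      push_cast
      calc _ = ((k - 1 : ℕ) ^ (k * k) : ℝ) ^ 2 * (k * k) * C * Z * (((p : ℝ) ^ (k - 1)) ^ 2 *
          (p : ℝ) ^ ((u - v * (a + 1 : ℕ)) / k - l * (a + 1 : ℕ) * (1 - 1 / k))) := by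
            push_cast; ring
        _ ≤ _ := by gcongr
    calc _ ≤ M * (M * (c ^ (1 / (k : ℝ)) * Z * (p : ℝ) ^ ((u - v * a) / k - l * a * (1 - 1 / k)))
        + ((k - 1 : ℕ) ^ (k * k) : ℝ) ^ 2 * (k * k : ℕ) * C * Z *
          (p : ℝ) ^ ((u - v * a) / k - l * a * (1 - 1 / k))) := by
          gcongr
      _ = _ := by ring

/-- Hölder's inequality for the separated mean value. -/
lemma charMean_sepSum_le_of_moment {k Q N p a b : ℕ} [NeZero Q] (hk : 2 ≤ k) (hp : p.Prime)
    {Z l : ℝ} (hZ : 0 ≤ Z) (hl : 3 / 2 * (k * (k + 1)) ≤ l)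
    (hJa : ∀ ξ, charMean (fun ψ => progSum k Q N p a ξ ψ ^ (2 * (k + k * k)))
        ≤ Z * (p : ℝ) ^ (-l * a))
    (hJb : ∀ ξ, charMean (fun ψ => progSum k Q N p b ξ ψ ^ (2 * (k + k * k)))
        ≤ Z * (p : ℝ) ^ (-l * b)) (ξ η : ℤ) :
    charMean (fun ψ => sepSum k Q N p a ξ ψ ^ 2 * progSum k Q N p b η ψ ^ (2 * (k * k)))
      ≤ Z * (p : ℝ) ^ (-(3 / 2 * k ^ 2 * b) - (2 * k - k * (k + 1) / 2 : ℝ) * a) := by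
  have hp1 : (1 : ℝ) ≤ p := by exact_mod_cast hp.one_le
  have hp0 : (0 : ℝ) < p := by linarith
  have hk0 : (0 : ℝ) < k := by positivity
  have h := charMean_pow_mul_pow_le (f := progSum k Q N p a ξ) (g := progSum k Q N p b η)
    (fun _ => progSum_nonneg) (fun _ => progSum_nonneg) (m := 2 * k) (n := 2 * (k * k))
    (by positivity) (by positivity)
  have hsum : 2 * k + 2 * (k * k) = 2 * (k + k * k) := by ring
  rw [hsum] at h
  have hnn : ∀ a ξ, 0 ≤ charMean (fun ψ => progSum k Q N p a ξ ψ ^ (2 * (k + k * k))) :=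
    fun a ξ => charMean_nonneg fun ψ => pow_nonneg progSum_nonneg _
  have e1 : ((2 * k : ℕ) : ℝ) / (2 * (k + k * k) : ℕ) = 1 / (k + 1) := by
    push_cast; field_simp; ring
  have e2 : ((2 * (k * k) : ℕ) : ℝ) / (2 * (k + k * k) : ℕ) = k / (k + 1) := by
    push_cast; field_simp; ring
  rw [e1, e2] at h
  calc _ ≤ _ := charMean_sepSum_le ξ (progression N p b η) (k * k)
    _ ≤ _ := h
    _ ≤ (Z * (p : ℝ) ^ (-l * a)) ^ (1 / ((k : ℝ) + 1)) *
        (Z * (p : ℝ) ^ (-l * b)) ^ ((k : ℝ) / (k + 1)) :=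
        mul_le_mul (Real.rpow_le_rpow (hnn _ _) (hJa ξ) (by positivity))
          (Real.rpow_le_rpow (hnn _ _) (hJb η) (by positivity))
          (Real.rpow_nonneg (hnn _ _) _) (by positivity)
    _ = Z * (p : ℝ) ^ (-(l * ((a + k * b) / (k + 1)))) := by
        rw [Real.mul_rpow hZ (by positivity), Real.mul_rpow hZ (by positivity), mul_mul_mul_comm,
          ← Real.rpow_add_of_nonneg hZ (by positivity) (by positivity), ← Real.rpow_mul hp0.le,
          ← Real.rpow_mul hp0.le, ← Real.rpow_add hp0]
        congr 1
        · have : 1 / ((k : ℝ) + 1) + k / (k + 1) = 1 := by field_simp; ring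
          rw [this, Real.rpow_one]
        · congr 1
          field_simp
          ring
    _ ≤ _ := by
        refine mul_le_mul_of_nonneg_left (Real.rpow_le_rpow_of_exponent_le hp1 ?_) hZ
        have h1 : 3 / 2 * (k * (k + 1)) * (((a : ℝ) + k * b) / (k + 1))
            ≤ l * ((a + k * b) / (k + 1)) := by gcongr
        have h2 : 3 / 2 * (k * (k + 1)) * (((a : ℝ) + k * b) / (k + 1))
            = 3 / 2 * k * (a + k * b) := by field_simp
        have h3 : (0 : ℝ) ≤ k ^ 2 / 2 * a := by positivity
        nlinarith

/-- Bounds for the separated mean values, improved by repeated efficient congruencing. -/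
lemma exists_separated_bound {k : ℕ} (hk : 2 ≤ k) {D : ℝ} (hD : 0 < D) (m n : ℕ)
    (hn : (n : ℝ) * (D / 2) ≤ k ^ 2 / 2 + D) :
    ∃ c : ℝ, 0 ≤ c ∧ ∀ (N p Q : ℕ) [NeZero Q] (Z L : ℝ), p.Prime → k < p →
      (k + k * k) * N ^ k < Q → 0 ≤ Z → D ≤ L →
      (∀ a, a ≤ m → ∀ ξ, charMean (fun ψ => progSum k Q N p a ξ ψ ^ (2 * (k + k * k)))
        ≤ Z * (p : ℝ) ^ (-(3 / 2 * (k * (k + 1)) + L) * a)) →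
      ∀ a b, a ≤ b → 1 ≤ b → b * k ^ n ≤ m → ∀ ξ η,
        charMean (fun ψ => sepSum k Q N p a ξ ψ ^ 2 * progSum k Q N p b η ψ ^ (2 * (k * k)))
        ≤ c * Z * (p : ℝ) ^ (-(3 / 2 * k ^ 2 + n * (D / 2)) * b
          - (2 * k - k * (k + 1) / 2 : ℝ) * a) := by
  have hk2 : (2 : ℝ) ≤ k := by exact_mod_cast hk
  have hk0 : (0 : ℝ) < k := by linarith
  induction n with
  | zero =>
    refine ⟨1, zero_le_one, ?_⟩
    intro N p Q _ Z L hp hkp hQ hZ hL hJ a b hab hb hbm ξ η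
    rw [pow_zero, mul_one] at hbm
    refine (charMean_sepSum_le_of_moment hk hp hZ (l := 3 / 2 * (k * (k + 1)) + L) (by linarith)
      (hJ a (by omega)) (hJ b hbm) ξ η).trans_eq ?_
    rw [one_mul]
    congr 2
    push_cast
    ring
  | succ n ih =>
    have hn' : (n : ℝ) * (D / 2) ≤ k ^ 2 / 2 + D := by
      push_cast at hn; linarith
    obtain ⟨c, hc, ih⟩ := ih hn'
    choose C hC0 hC using fun n' => exists_mixed_bound hk hc n'
    set C' := ∑ n' ∈ Finset.range (m + 1), C n' with hC'
    have hCC : ∀ n', n' ≤ m → C n' ≤ C' := fun n' h =>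
      Finset.single_le_sum (fun i _ => hC0 i) (Finset.mem_range.2 (by omega))
    have hC'0 : 0 ≤ C' := Finset.sum_nonneg fun i _ => hC0 i
    refine ⟨k ^ k * k * C', by positivity, ?_⟩
    intro N p Q _ Z L hp hkp hQ hZ hL hJ a b hab hb hbm ξ η
    have hp1 : (1 : ℝ) ≤ p := by exact_mod_cast hp.one_le
    have hp0 : (0 : ℝ) < p := by linarith
    have hkn : 1 ≤ k ^ n := Nat.one_le_pow _ _ (by omega)
    have hkbm : k * b * k ^ n ≤ m := by rw [pow_succ] at hbm; calc
      k * b * k ^ n = b * (k ^ n * k) := by ring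
      _ ≤ m := hbm
    have hkb : k * b ≤ m := le_trans (Nat.le_mul_of_pos_right _ hkn) hkbm
    have hbkb : b ≤ k * b := Nat.le_mul_of_pos_left _ (by omega)
    set l : ℝ := 3 / 2 * (k * (k + 1)) + L with hl
    set g : ℝ := n * (D / 2) with hg
    have hL0 : 0 ≤ L * (1 - 1 / k) := by
      have : 1 / (k : ℝ) ≤ 1 := by rw [div_le_one hk0]; linarith
      exact mul_nonneg (by linarith) (by linarith)
    have hlk : l * (1 - 1 / k) = 3 / 2 * (k + 1) * (k - 1) + L * (1 - 1 / k) := by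
      rw [hl]; field_simp
    have hvk : (2 * k - k * (k + 1) / 2 : ℝ) / k = 2 - (k + 1) / 2 := by field_simp
    have hmix : ∀ ξ', charMean (fun ψ => progSum k Q N p (k * b) ξ' ψ ^ (2 * k) *
        progSum k Q N p b η ψ ^ (2 * (k * k))) ≤ C' * Z *
        (p : ℝ) ^ ((-(3 / 2 * k ^ 2 + g) * (k * b : ℕ) - (2 * k - k * (k + 1) / 2 : ℝ) * b) / k
          - l * b * (1 - 1 / k)) := by
      intro ξ'
      have h := hC (k * b - b) N p Q b (k * b) Z l (-(3 / 2 * k ^ 2 + g) * (k * b : ℕ))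
        (2 * k - k * (k + 1) / 2 : ℝ) (by omega) hp hZ (by rw [hvk, hlk]; nlinarith) (by
          have e : (-(3 / 2 * k ^ 2 + g) * (k * b : ℕ) -
              (2 * k - k * (k + 1) / 2 : ℝ) * (k * b : ℕ)) / k - l * (k * b : ℕ) * (1 - 1 / k)
              + l * (k * b : ℕ) = b * (k ^ 2 / 2 - g + L) := by
            rw [hl]; push_cast; field_simp; ring
          have : 0 ≤ (b : ℝ) * (k ^ 2 / 2 - g + L) := by
            refine mul_nonneg (Nat.cast_nonneg _) ?_
            push_cast at hn; linarith
          linarith)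
        (fun a' _ ha' ξ η => ih N p Q Z L hp hkp hQ hZ hL hJ a' (k * b) ha' (by omega) hkbm ξ η)
        (fun a' _ ha' ξ => hJ a' (by omega) ξ) η ξ'
      refine le_trans (le_of_eq_of_le ?_ h) ?_
      · congr 1
        funext ψ
        ring
      · gcongr
        exact hCC _ (by omega)
    have h := charMean_sepSum_le_congruencing (N := N) hp (by omega) hkp hab
      (by nlinarith : a + 1 ≤ k * b) hQ ξ η _ hmix
    refine h.trans ?_
    have hsum : ((∑ j ∈ Finset.range k, j : ℕ) : ℝ) = k * (k - 1) / 2 := by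
      have := Finset.sum_range_id_mul_two k
      have h2 : ((∑ j ∈ Finset.range k, j : ℕ) : ℝ) * 2 = k * (k - 1 : ℕ) := by exact_mod_cast this
      rw [Nat.cast_sub (by omega)] at h2
      push_cast at h2 ⊢
      linarith
    have hpow : ((p : ℝ) ^ ((a + b) * ∑ j ∈ Finset.range k, j) * (p : ℝ) ^ (k * (k * b - a))) *
        (p : ℝ) ^ ((-(3 / 2 * k ^ 2 + g) * (k * b : ℕ) - (2 * k - k * (k + 1) / 2 : ℝ) * b) / k
          - l * b * (1 - 1 / k)) ≤ (p : ℝ) ^ (-(3 / 2 * k ^ 2 + (n + 1 : ℕ) * (D / 2)) * b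
          - (2 * k - k * (k + 1) / 2 : ℝ) * a) := by
      rw [← Real.rpow_natCast, ← Real.rpow_natCast, ← Real.rpow_add hp0, ← Real.rpow_add hp0]
      refine Real.rpow_le_rpow_of_exponent_le hp1 ?_
      rw [Nat.cast_mul, hsum, Nat.cast_mul, Nat.cast_sub (by omega)]
      have e : ((a + b : ℕ) : ℝ) * (k * (k - 1) / 2) + k * ((k * b : ℕ) - a) +
          ((-(3 / 2 * k ^ 2 + g) * (k * b : ℕ) - (2 * k - k * (k + 1) / 2 : ℝ) * b) / k
            - l * b * (1 - 1 / k)) = -(3 / 2 * k ^ 2 + g + L * (1 - 1 / k)) * b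
            - (2 * k - k * (k + 1) / 2 : ℝ) * a := by
        rw [hl]; push_cast; field_simp; ring
      rw [e]
      have hgain : D / 2 ≤ L * (1 - 1 / k) := by
        have : 1 / (k : ℝ) ≤ 1 / 2 := one_div_le_one_div_of_le (by norm_num) hk2
        nlinarith
      have : (3 / 2 * (k : ℝ) ^ 2 + (n + 1 : ℕ) * (D / 2)) * b
          ≤ (3 / 2 * k ^ 2 + g + L * (1 - 1 / k)) * b := by
        refine mul_le_mul_of_nonneg_right ?_ (Nat.cast_nonneg _)
        push_cast
        linarith
      linarith
    push_cast at hpow ⊢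
    calc _ = k ^ k * k * C' * Z * (((p : ℝ) ^ ((a + b) * ∑ j ∈ Finset.range k, j) *
          (p : ℝ) ^ (k * (k * b - a))) * (p : ℝ) ^ ((-(3 / 2 * k ^ 2 + g) * (k * b) -
          (2 * k - k * (k + 1) / 2 : ℝ) * b) / k - l * b * (1 - 1 / k))) := by ring
      _ ≤ _ := by gcongr

lemma progression_zero (N p : ℕ) (ξ : ℤ) : progression N p 0 ξ = Finset.Ico (0 : ℤ) N := by
  refine Finset.filter_true_of_mem fun x _ => ?_
  simpa using Int.modEq_one

lemma vinogradovCount_eq_charMean {k Q N p S : ℕ} [NeZero Q] (hQ : S * N ^ k < Q) (ξ : ℤ) :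
    (vinogradovCount k S N : ℝ) = charMean (fun ψ => progSum k Q N p 0 ξ ψ ^ (2 * S)) := by
  have : vinogradovCount k S N = coincidences (Fintype.piFinset fun _ : Fin S =>
      Finset.Ico (0 : ℤ) N) (fun t => ∑ i, momentCurve k Q (t i)) := by
    refine coincidences_eq_of_forall_iff fun t ht t' ht' => ?_
    rw [momentCurve_sum_eq_iff hQ t t' (Fintype.mem_piFinset.1 ht) (Fintype.mem_piFinset.1 ht'),
      funext_iff]
  rw [this, coincidences_eq_charMean]
  congr 1
  funext ψ
  rw [norm_charSum_piFinset, ← pow_mul, mul_comm S 2, ← progression_zero N p ξ]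
  rfl

lemma coincidences_le_card_mul_card {ι V : Type*} (T : Finset ι) (w : ι → V) :
    coincidences T w ≤ T.card * T.card :=
  (Finset.card_filter_le _ _).trans_eq (Finset.card_product _ _)

lemma vinogradovCount_le_pow (k S N : ℕ) : vinogradovCount k S N ≤ N ^ (2 * S) := by
  refine (coincidences_le_card_mul_card _ _).trans_eq ?_
  rw [Fintype.card_piFinset]
  simp
  rw [← pow_add]
  congr 1
  omega

lemma le_of_le_rpow_mul_rpow {J A X t : ℝ} (hJ : 0 ≤ J) (hA : 0 ≤ A) (hX : 0 ≤ X) (ht : 0 < t)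
    (h : J ≤ A * (X ^ t * J ^ (1 - t))) : J ≤ A ^ (1 / t) * X := by
  rcases hJ.eq_or_lt with rfl | hJ
  · positivity
  have h1 : J ^ t ≤ A * X ^ t := by
    have h2 : J = J ^ t * J ^ (1 - t) := by
      rw [← Real.rpow_add hJ, add_sub_cancel, Real.rpow_one]
    have h3 : J ^ t * J ^ (1 - t) ≤ (A * X ^ t) * J ^ (1 - t) := by
      rw [← h2, mul_assoc]; exact h
    exact le_of_mul_le_mul_right h3 (Real.rpow_pos_of_pos hJ _)
  have h4 := Real.rpow_le_rpow (by positivity) h1 (by positivity : 0 ≤ 1 / t)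
  rwa [Real.mul_rpow hA (by positivity), ← Real.rpow_mul hJ.le, ← Real.rpow_mul hX,
    mul_one_div_cancel ht.ne', Real.rpow_one, Real.rpow_one] at h4

/-- One round of efficient congruencing, bounding the Vinogradov count modulo separated mean
values. -/
lemma vinogradovCount_le_step {k : ℕ} (hk : 2 ≤ k) : ∃ A : ℝ, 0 ≤ A ∧
    ∀ (N p Q : ℕ) [NeZero Q] (K X : ℝ), p.Prime → (k + k * k) * N ^ k < Q → 0 ≤ K → 0 ≤ X →
      (∀ ξ, charMean (fun ψ => sepSum k Q N p 0 0 ψ ^ 2 * progSum k Q N p 1 ξ ψ ^ (2 * (k * k)))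
        ≤ K) →
      (∀ ξ, charMean (fun ψ => progSum k Q N p 1 ξ ψ ^ (2 * (k + k * k))) ≤ X) →
      (vinogradovCount k (k + k * k) N : ℝ)
        ≤ A * ((p : ℝ) ^ (2 * (k * k)) * K + (p : ℝ) ^ (2 * k) * X) := by
  have hk2 : (2 : ℝ) ≤ k := by exact_mod_cast hk
  have hk0 : (0 : ℝ) < k := by linarith
  set M : ℝ := (Fintype.card (Option (Fin k ⊕ Fin (k * (k - 1)) ≃ Fin (k * k))) : ℝ) with hM
  set B : ℝ := M * (((k - 1 : ℕ) ^ (k * k) : ℝ) ^ 2 * (k * k : ℕ)) with hB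
  refine ⟨(2 * (M * M)) ^ (1 / (1 / (k : ℝ))) * (k * k) + (2 * B) ^ (1 / ((k : ℝ) / (k + 1))),
    by positivity, ?_⟩
  intro N p Q _ K X hp hQ hK hX hKb hXb
  have hp1 : (1 : ℝ) ≤ p := by exact_mod_cast hp.one_le
  have hp0 : (0 : ℝ) < p := by linarith
  set J : ℝ := (vinogradovCount k (k + k * k) N : ℝ) with hJ
  have hJ0 : 0 ≤ J := Nat.cast_nonneg _
  have hJe : ∀ ξ, charMean (fun ψ => progSum k Q N p 0 ξ ψ ^ (2 * (k + k * k))) = J := fun ξ =>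
    (vinogradovCount_eq_charMean hQ ξ).symm
  set R : ℝ := X ^ ((k : ℝ) / (k + 1)) * J ^ (1 / ((k : ℝ) + 1)) with hR
  have hUe : ∀ ψ, ‖charSum (Fintype.piFinset fun _ : Fin k => progression N p 0 0)
      (fun t => ∑ i, momentCurve k Q (t i)) ψ‖ ^ 2 = progSum k Q N p 0 0 ψ ^ (2 * k) := by
    intro ψ
    rw [norm_charSum_piFinset, ← pow_mul, mul_comm k 2]
    rfl
  have hcond := charMean_progSum_le_conditioning (k := k) (r := k * (k - 1)) (s := k * k)
    (N := N) (a := 0) hp.pos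
    (by obtain ⟨m, rfl⟩ : ∃ m, k = m + 1 := ⟨k - 1, by omega⟩
        simp; ring) (by omega) 0
    (Fintype.piFinset fun _ : Fin k => progression N p 0 0)
    (fun t => ∑ i, momentCurve k Q (t i)) R (by
      intro ξ'
      simp only [hUe]
      have h := charMean_pow_mul_pow_le (f := progSum k Q N p 1 ξ') (g := progSum k Q N p 0 0)
        (fun _ => progSum_nonneg) (fun _ => progSum_nonneg) (m := 2 * (k * k)) (n := 2 * k)
        (by positivity) (by positivity)
      have hsum : 2 * (k * k) + 2 * k = 2 * (k + k * k) := by ring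
      rw [hsum, hJe] at h
      have e1 : ((2 * k : ℕ) : ℝ) / (2 * (k + k * k) : ℕ) = 1 / (k + 1) := by
        push_cast; field_simp; ring
      have e2 : ((2 * (k * k) : ℕ) : ℝ) / (2 * (k + k * k) : ℕ) = k / (k + 1) := by
        push_cast; field_simp; ring
      rw [e1, e2] at h
      refine h.trans ?_
      rw [hR]
      refine mul_le_mul_of_nonneg_right (Real.rpow_le_rpow ?_ (hXb ξ') (by positivity))
        (by positivity)
      exact charMean_nonneg fun ψ => pow_nonneg progSum_nonneg _)
  simp only [hUe] at hcond
  rw [← hM] at hcond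
  have hlhs : charMean (fun ψ => progSum k Q N p 0 0 ψ ^ (2 * (k * k)) *
      progSum k Q N p 0 0 ψ ^ (2 * k)) = J := by
    rw [← hJe 0]
    congr 1
    funext ψ
    rw [← pow_add]
    congr 1
    ring
  have hK0 : charMean (fun ψ => sepSum k Q N p 0 0 ψ ^ 2 * progSum k Q N p 0 0 ψ ^ (2 * (k * k)))
      ≤ (k * k) * ((p : ℝ) ^ (2 * (k * k)) * K) := by
    set P : ℤ := ((p ^ 1 : ℕ) : ℤ) with hP
    have hP0 : 0 < P := by have := hp.pos; positivity
    have h := coincidences_product_le_of_pattern (by positivity : 0 < k * k)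
      (Fintype.piFinset fun _ : Fin (k * k) => progression N p 0 0) (momentCurve k Q)
      (separatedTuples k N p 0 0) (fun t => ∑ i, momentCurve k Q (t i)) (fun x => x % P)
      (fun z => progression N p 1 z) (fun t ht i => by
        have := Fintype.mem_piFinset.1 ht i
        exact mem_progression.2 ⟨(mem_progression.1 this).1, (Int.mod_modEq _ _).symm⟩)
      (Fintype.piFinset fun _ : Fin (k * k) => Finset.Ico (0 : ℤ) P) (fun t _ =>
        Fintype.mem_piFinset.2 fun i => Finset.mem_Ico.2
          ⟨Int.emod_nonneg _ hP0.ne', Int.emod_lt_of_pos _ hP0⟩) K (fun c _ i => by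
        refine sum_le_card_mul_of_charMean_le (le_of_eq_of_le ?_ (hKb (c i)))
        congr 1
        funext ψ
        rw [progSum_def, mul_comm]
        rfl)
    rw [coincidences_eq_charMean] at h
    refine le_trans (le_of_eq ?_) (h.trans_eq ?_)
    · congr 1
      funext ψ
      rw [charSum_product _ _ (fun t : Fin (k * k) → ℤ => ∑ i, momentCurve k Q (t i))
        (fun t : Fin k → ℤ => ∑ i, momentCurve k Q (t i)), norm_mul, mul_pow, norm_charSum_piFinset, ← pow_mul, mul_comm (k * k) 2, mul_comm]
      rfl
    · rw [Fintype.card_piFinset, Finset.prod_const, Finset.card_univ, Fintype.card_fin,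
        Int.card_Ico]
      simp [hP]
      ring
  set K' : ℝ := (k * k) * ((p : ℝ) ^ (2 * (k * k)) * K) with hK'
  have hK'0 : 0 ≤ K' := by positivity
  have h1 := charMean_sepSum_holder (N := N) (p := p) (a := 0) (b := 0) (Q := Q) hk 0 0
  rw [hJe] at h1
  have h1' := h1.trans (mul_le_mul_of_nonneg_right (Real.rpow_le_rpow (charMean_nonneg fun ψ =>
    mul_nonneg (pow_nonneg sepSum_nonneg _) (pow_nonneg progSum_nonneg _)) hK0
    (by positivity : 0 ≤ 1 / (k : ℝ))) (Real.rpow_nonneg hJ0 _))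
  rw [hlhs] at hcond
  set P2 : ℝ := ((p : ℝ) ^ (k - 1)) ^ 2 with hP2
  have hmain : J ≤ M * M * (K' ^ (1 / (k : ℝ)) * J ^ (1 - 1 / (k : ℝ))) + B * P2 * R := by
    calc J ≤ _ := hcond
      _ ≤ M * (M * (K' ^ (1 / (k : ℝ)) * J ^ (1 - 1 / (k : ℝ))) +
          (((k - 1) ^ (k * k) * p ^ (k - 1) : ℕ) : ℝ) ^ 2 * (k * k : ℕ) * R) := by gcongr
      _ = _ := by rw [hB, hP2]; push_cast; ring
  have hkk : 1 - (k : ℝ) / (k + 1) = 1 / (k + 1) := by field_simp; ring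
  rcases le_total (B * P2 * R) (M * M * (K' ^ (1 / (k : ℝ)) * J ^ (1 - 1 / (k : ℝ)))) with hle | hle
  · have h2 := le_of_le_rpow_mul_rpow (A := 2 * (M * M)) hJ0 (by positivity) hK'0
      (by positivity : 0 < 1 / (k : ℝ)) (by linarith)
    refine h2.trans ?_
    have : 0 ≤ (p : ℝ) ^ (2 * k) * X := by positivity
    have h3 : (2 * (M * M)) ^ (1 / (1 / (k : ℝ))) * K' = (2 * (M * M)) ^ (1 / (1 / (k : ℝ))) *
      (k * k) * ((p : ℝ) ^ (2 * (k * k)) * K) := by rw [hK']; ring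
    rw [h3]
    refine mul_le_mul (le_add_of_nonneg_right (by positivity)) (le_add_of_nonneg_right this)
      (by positivity) (by positivity)
  · have h2 := le_of_le_rpow_mul_rpow (A := 2 * (B * P2)) hJ0 (by positivity) hX
      (by positivity : 0 < (k : ℝ) / (k + 1)) (by rw [hkk, ← hR]; linarith)
    refine h2.trans ?_
    have h3 : (2 * (B * P2)) ^ (1 / ((k : ℝ) / (k + 1))) ≤ (2 * B) ^ (1 / ((k : ℝ) / (k + 1))) *
        (p : ℝ) ^ (2 * k) := by
      rw [← mul_assoc, Real.mul_rpow (by positivity) (by positivity)]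
      refine mul_le_mul_of_nonneg_left ?_ (by positivity)
      rw [hP2, ← pow_mul, ← Real.rpow_natCast, ← Real.rpow_mul hp0.le, ← Real.rpow_natCast]
      refine Real.rpow_le_rpow_of_exponent_le hp1 ?_
      rw [Nat.cast_mul, Nat.cast_sub (by omega)]
      push_cast
      field_simp
      nlinarith
    calc _ ≤ (2 * B) ^ (1 / ((k : ℝ) / (k + 1))) * (p : ℝ) ^ (2 * k) * X := by gcongr
      _ = (2 * B) ^ (1 / ((k : ℝ) / (k + 1))) * ((p : ℝ) ^ (2 * k) * X) := by ring
      _ ≤ _ := by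
        refine mul_le_mul (le_add_of_nonneg_left (by positivity)) (le_add_of_nonneg_left
          (by positivity)) (by positivity) (by positivity)

lemma exists_prime_pow_le {k m N : ℕ} (hm : 1 ≤ m)
    (hN : (2 * (k + 3)) ^ m ≤ N) :
    ∃ p : ℕ, p.Prime ∧ k < p ∧ p ^ m ≤ N ∧ N ≤ (4 * p) ^ m := by
  obtain ⟨z, hz1, hz2⟩ : ∃ z : ℕ, z ^ m ≤ N ∧ N < (z + 1) ^ m := by
    have hex : ∃ z : ℕ, N < (z + 1) ^ m := ⟨N, lt_of_lt_of_le (Nat.lt_succ_self N)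
      (Nat.le_self_pow (by omega) _)⟩
    refine ⟨Nat.find hex, ?_, Nat.find_spec hex⟩
    by_contra! h
    rcases Nat.eq_zero_or_pos (Nat.find hex) with h0 | h0
    · rw [h0, zero_pow (by omega)] at h
      omega
    · exact Nat.find_min hex (Nat.sub_lt h0 one_pos) (by
        rwa [show Nat.find hex - 1 + 1 = Nat.find hex by omega])
  have hzk : 2 * (k + 3) ≤ z := by
    by_contra! h
    have : (z + 1) ^ m ≤ (2 * (k + 3)) ^ m := Nat.pow_le_pow_left (by omega) m
    omega
  obtain ⟨p, hp, hyp, hpy⟩ := Nat.exists_prime_lt_and_le_two_mul (z / 2) (by omega)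
  refine ⟨p, hp, by omega, ?_, ?_⟩
  · exact (Nat.pow_le_pow_left (by omega) m).trans hz1
  · exact hz2.le.trans (Nat.pow_le_pow_left (by omega) m)

lemma vinogradovCount_exponent_descent {k : ℕ} (hk : 2 ≤ k) {D : ℝ} (hD : 0 < D) :
    ∃ τ : ℝ, 0 < τ ∧ ∀ L, D ≤ L →
      (∃ C : ℝ, 0 ≤ C ∧ ∀ N : ℕ, 1 ≤ N →
        (vinogradovCount k (k + k * k) N : ℝ) ≤ C * (N : ℝ) ^ (3 / 2 * (k * (k + 1)) + L)) →
      ∃ C : ℝ, 0 ≤ C ∧ ∀ N : ℕ, 1 ≤ N →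
        (vinogradovCount k (k + k * k) N : ℝ) ≤
          C * (N : ℝ) ^ (3 / 2 * (k * (k + 1)) + (L - τ)) := by
  have hk2 : (2 : ℝ) ≤ k := by exact_mod_cast hk
  have hk0 : (0 : ℝ) < k := by linarith
  set n : ℕ := ⌈((k : ℝ) ^ 2 / 2 + D / 2) / (D / 2)⌉₊ with hn
  have hn1 : (k : ℝ) ^ 2 / 2 + D / 2 ≤ n * (D / 2) := by
    have := Nat.le_ceil (((k : ℝ) ^ 2 / 2 + D / 2) / (D / 2))
    rwa [← hn, div_le_iff₀ (by positivity)] at this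
  have hn2 : (n : ℝ) * (D / 2) ≤ k ^ 2 / 2 + D := by
    have := Nat.ceil_lt_add_one (a := ((k : ℝ) ^ 2 / 2 + D / 2) / (D / 2)) (by positivity)
    rw [← hn] at this
    have h2 := mul_le_mul_of_nonneg_right this.le (by positivity : 0 ≤ D / 2)
    rw [add_mul, div_mul_cancel₀ _ (by positivity)] at h2
    linarith
  set m : ℕ := k ^ n with hm
  have hm1 : 1 ≤ m := Nat.one_le_pow _ _ (by omega)
  have hm0 : (0 : ℝ) < m := by exact_mod_cast hm1
  obtain ⟨c, hc, hmain⟩ := exists_separated_bound hk hD m n hn2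
  obtain ⟨A, hA, hstep⟩ := vinogradovCount_le_step hk
  have hτD : D / (2 * m) ≤ D := by
    have hm1' : (1 : ℝ) ≤ m := by exact_mod_cast hm1
    apply div_le_self hD.le
    linarith
  refine ⟨D / (2 * m), by positivity, ?_⟩
  rintro L hL ⟨C, hC, hP⟩
  set l : ℝ := 3 / 2 * (k * (k + 1)) + L with hl
  have hl0 : 0 ≤ l := by
    have : (0 : ℝ) ≤ k * (k + 1) := by positivity
    linarith
  have hl0' : 0 ≤ 3 / 2 * (k * (k + 1)) + (L - D / (2 * m)) := by
    have : (0 : ℝ) ≤ k * (k + 1) := by positivity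
    linarith
  set W : ℕ := (2 * (k + 3)) ^ m with hW
  refine ⟨(W : ℝ) ^ (2 * (k + k * k)) + A * ((c + 1) * (C * 2 ^ l)) * 4 ^ (D / 2), by positivity,
    fun N hN => ?_⟩
  have hN1 : (1 : ℝ) ≤ N := by exact_mod_cast hN
  have hN0 : (0 : ℝ) < N := by linarith
  rcases lt_or_ge N W with hNW | hNW
  · have h1 : (vinogradovCount k (k + k * k) N : ℝ) ≤ (W : ℝ) ^ (2 * (k + k * k)) := by
      have := (vinogradovCount_le_pow k (k + k * k) N).trans (Nat.pow_le_pow_left hNW.le _)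
      exact_mod_cast this
    have h2 : 1 ≤ (N : ℝ) ^ (3 / 2 * (k * (k + 1)) + (L - D / (2 * m))) :=
      Real.one_le_rpow hN1 hl0'
    have h3 : 0 ≤ A * ((c + 1) * (C * 2 ^ l)) * 4 ^ (D / 2) := by positivity
    have h4 : 0 ≤ (W : ℝ) ^ (2 * (k + k * k)) := by positivity
    nlinarith
  · obtain ⟨p, hp, hkp, hpN, hNp⟩ := exists_prime_pow_le hm1 hNW
    have hp0 : (0 : ℝ) < p := by exact_mod_cast hp.pos
    have hp1 : (1 : ℝ) ≤ p := by exact_mod_cast hp.one_le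
    set Q : ℕ := (k + k * k) * N ^ k + 1 with hQ
    have : NeZero Q := ⟨by omega⟩
    set Z : ℝ := C * 2 ^ l * (N : ℝ) ^ l with hZ
    have hZ0 : 0 ≤ Z := by positivity
    have hJ : ∀ a, a ≤ m → ∀ ξ,
        charMean (fun ψ => progSum k Q N p a ξ ψ ^ (2 * (k + k * k)))
          ≤ Z * (p : ℝ) ^ (-(3 / 2 * (k * (k + 1)) + L) * a) := by
      intro a ha ξ
      have hpa : p ^ a ≤ N := (Nat.pow_le_pow_right hp.pos ha).trans hpN
      have h1 := charMean_progSum_pow_le (k := k) (Q := Q) (N := N) (a := a) (S := k + k * k)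
        hp.pos (by omega) ξ
      refine h1.trans ((hP _ (Nat.succ_pos _)).trans ?_)
      have h2 : ((N / p ^ a + 1 : ℕ) : ℝ) ≤ 2 * (N : ℝ) * (p : ℝ) ^ (-(a : ℝ)) := by
        have hpa' : (0 : ℝ) < (p : ℝ) ^ a := by positivity
        have h3 : ((N / p ^ a : ℕ) : ℝ) ≤ N / (p : ℝ) ^ a := by
          simpa using (Nat.cast_div_le (α := ℝ) (m := N) (n := p ^ a))
        have h4 : (1 : ℝ) ≤ N / (p : ℝ) ^ a := by
          rw [le_div_iff₀ hpa']
          exact_mod_cast (by omega : 1 * p ^ a ≤ N)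
        rw [Real.rpow_neg hp0.le, Real.rpow_natCast, ← div_eq_mul_inv, mul_div_assoc]
        push_cast
        linarith
      calc C * ((N / p ^ a + 1 : ℕ) : ℝ) ^ l
          ≤ C * (2 * (N : ℝ) * (p : ℝ) ^ (-(a : ℝ))) ^ l := by gcongr
        _ = Z * (p : ℝ) ^ (-l * a) := by
            rw [Real.mul_rpow (by positivity) (by positivity), Real.mul_rpow (by positivity)
              (by positivity), ← Real.rpow_mul hp0.le, hZ]
            ring_nf
    have hK := fun ξ => hmain N p Q Z L hp hkp (by omega) hZ0 hL hJ 0 1 (by omega) le_rfl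
      (by rw [one_mul]) 0 ξ
    have hX := hJ 1 hm1
    have h1 := hstep N p Q _ _ hp (by omega) (by positivity) (by positivity) hK hX
    refine h1.trans ?_
    have e1 : (p : ℝ) ^ (2 * (k * k)) * (c * Z * (p : ℝ) ^ (-(3 / 2 * (k : ℝ) ^ 2 + n * (D / 2)) *
        ((1 : ℕ) : ℝ) - (2 * k - k * (k + 1) / 2 : ℝ) * ((0 : ℕ) : ℝ)))
        ≤ c * Z * (p : ℝ) ^ (-(D / 2)) := by
      rw [mul_left_comm, ← Real.rpow_natCast, ← Real.rpow_add hp0]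
      gcongr
      push_cast
      nlinarith
    have e2 : (p : ℝ) ^ (2 * k) * (Z * (p : ℝ) ^ (-(3 / 2 * (k * (k + 1)) + L) * ((1 : ℕ) : ℝ)))
        ≤ Z * (p : ℝ) ^ (-(D / 2)) := by
      rw [mul_left_comm, ← Real.rpow_natCast, ← Real.rpow_add hp0]
      gcongr
      push_cast
      nlinarith
    have e3 : (p : ℝ) ^ (-(D / 2)) ≤ 4 ^ (D / 2) * (N : ℝ) ^ (-(D / (2 * m))) := by
      have h2 : (N : ℝ) ^ (D / (2 * m)) ≤ (4 * (p : ℝ)) ^ (D / 2) := by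
        have h3 : (N : ℝ) ≤ (4 * (p : ℝ)) ^ (m : ℝ) := by
          rw [Real.rpow_natCast]
          exact_mod_cast hNp
        calc (N : ℝ) ^ (D / (2 * m)) ≤ ((4 * (p : ℝ)) ^ (m : ℝ)) ^ (D / (2 * m)) := by gcongr
          _ = _ := by
            rw [← Real.rpow_mul (by positivity)]
            congr 1
            field_simp
      rw [Real.mul_rpow (by norm_num) hp0.le] at h2
      rw [Real.rpow_neg hp0.le, Real.rpow_neg hN0.le, ← div_eq_mul_inv, inv_eq_one_div,
        div_le_div_iff₀ (by positivity) (by positivity)]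
      linarith
    calc A * _ ≤ A * (c * Z * (p : ℝ) ^ (-(D / 2)) + Z * (p : ℝ) ^ (-(D / 2))) := by
          gcongr
      _ = A * ((c + 1) * Z) * (p : ℝ) ^ (-(D / 2)) := by ring
      _ ≤ A * ((c + 1) * Z) * (4 ^ (D / 2) * (N : ℝ) ^ (-(D / (2 * m)))) := by gcongr
      _ = (A * ((c + 1) * (C * 2 ^ l)) * 4 ^ (D / 2)) *
          (N : ℝ) ^ (3 / 2 * (k * (k + 1)) + (L - D / (2 * m))) := by
          have : (N : ℝ) ^ (3 / 2 * (k * (k + 1)) + (L - D / (2 * m)))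
            = (N : ℝ) ^ l * (N : ℝ) ^ (-(D / (2 * m))) := by
            rw [← Real.rpow_add hN0, hl]
            ring_nf
          rw [this, hZ]
          ring
      _ ≤ _ := by
          gcongr
          have : (0 : ℝ) ≤ (W : ℝ) ^ (2 * (k + k * k)) := by positivity
          linarith

/-- Vinogradov's mean value theorem with the optimal exponent up to `Δ`. -/
theorem exists_vinogradovCount_le {k : ℕ} (hk : 2 ≤ k) {Δ : ℝ} (hΔ : 0 < Δ) :
    ∃ C : ℝ, 0 ≤ C ∧ ∀ N : ℕ, 1 ≤ N →
      (vinogradovCount k (k + k * k) N : ℝ) ≤ C * (N : ℝ) ^ (3 / 2 * (k * (k + 1)) + Δ) := by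
  obtain ⟨τ, hτ, hdesc⟩ := vinogradovCount_exponent_descent hk hΔ
  set L₀ : ℝ := k * (k + 1) / 2 with hL₀
  have key : ∀ n : ℕ, ∃ C : ℝ, 0 ≤ C ∧ ∀ N : ℕ, 1 ≤ N →
      (vinogradovCount k (k + k * k) N : ℝ) ≤
        C * (N : ℝ) ^ (3 / 2 * (k * (k + 1)) + max Δ (L₀ - n * τ)) := by
    intro n
    induction n with
    | zero =>
      refine ⟨1, zero_le_one, fun N hN => ?_⟩
      have hN1 : (1 : ℝ) ≤ N := by exact_mod_cast hN
      have h1 : (vinogradovCount k (k + k * k) N : ℝ) ≤ (N : ℝ) ^ (2 * (k + k * k)) := by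
        exact_mod_cast vinogradovCount_le_pow k (k + k * k) N
      rw [one_mul]
      refine h1.trans ?_
      rw [← Real.rpow_natCast]
      apply Real.rpow_le_rpow_of_exponent_le hN1
      push_cast
      have := le_max_right Δ (L₀ - 0 * τ)
      rw [hL₀] at this ⊢
      linarith
    | succ n ih =>
      obtain ⟨C, hC, h⟩ := hdesc _ (le_max_left _ _) ih
      refine ⟨C, hC, fun N hN => (h N hN).trans ?_⟩
      have hN1 : (1 : ℝ) ≤ N := by exact_mod_cast hN
      gcongr
      rw [← max_sub_sub_right]
      apply max_le_max
      · linarith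
      · push_cast
        linarith
  obtain ⟨n, hn⟩ := exists_nat_ge (L₀ / τ)
  obtain ⟨C, hC, h⟩ := key n
  refine ⟨C, hC, fun N hN => ?_⟩
  have : max Δ (L₀ - n * τ) = Δ := by
    apply max_eq_left
    rw [div_le_iff₀ hτ] at hn
    linarith
  rw [← this]
  exact h N hN

lemma e_add (x y : ℝ) : e (x + y) = e x * e y := by
  simp only [e]
  rw [← Complex.exp_add]
  push_cast
  ring_nf

lemma norm_e (x : ℝ) : ‖e x‖ = 1 := by
  have : e x = Complex.exp ((2 * Real.pi * x : ℝ) * Complex.I) := by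
    simp only [e]
    push_cast
    ring_nf
  rw [this, Complex.norm_exp_ofReal_mul_I]

lemma conj_e (x : ℝ) : starRingEnd ℂ (e x) = e (-x) := by
  simp only [e]
  rw [← Complex.exp_conj]
  simp [Complex.conj_ofNat]

lemma e_sum {ι : Type*} (s : Finset ι) (f : ι → ℝ) : e (∑ i ∈ s, f i) = ∏ i ∈ s, e (f i) := by
  simp only [e]
  rw [← Complex.exp_sum]
  push_cast
  rw [Finset.mul_sum]

lemma e_nat_mul (x : ℝ) (n : ℕ) : e (x * n) = e x ^ n := by
  simp only [e]
  rw [← Complex.exp_nat_mul]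
  push_cast
  ring_nf

lemma norm_e_sub_one (x : ℝ) : ‖e x - 1‖ = 2 * |Real.sin (Real.pi * x)| := by
  have : e x = Complex.exp (Complex.I * (2 * Real.pi * x : ℝ)) := by
    simp only [e]
    push_cast
    ring_nf
  rw [this, Complex.norm_exp_I_mul_ofReal_sub_one]
  rw [norm_mul, Real.norm_eq_abs, Real.norm_eq_abs, abs_two]
  congr 3
  ring

lemma norm_e_sub_e_le (x y : ℝ) : ‖e x - e y‖ ≤ 2 * Real.pi * |x - y| := by
  have h1 : e x - e y = e y * (e (x - y) - 1) := by
    rw [mul_sub, ← e_add]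
    ring_nf
  rw [h1, norm_mul, norm_e, one_mul, norm_e_sub_one]
  have := Real.abs_sin_le_abs (x := Real.pi * (x - y))
  rw [abs_mul, abs_of_pos Real.pi_pos] at this
  linarith

lemma norm_sum_e_le (L : ℕ) {x : ℝ} (hx : |x| ≤ 1 / 2) (hx0 : x ≠ 0) :
    ‖∑ n ∈ Finset.range L, e (x * n)‖ ≤ 1 / (2 * |x|) := by
  have h1 : 4 * |x| ≤ ‖e x - 1‖ := by
    rw [norm_e_sub_one]
    have h2 := Real.mul_le_sin (x := Real.pi * |x|) (by positivity)
      (by nlinarith [Real.pi_pos])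
    have h3 : 2 / Real.pi * (Real.pi * |x|) = 2 * |x| := by
      field_simp
    rw [h3] at h2
    have h4 : |Real.sin (Real.pi * x)| = |Real.sin (Real.pi * |x|)| := by
      rcases abs_cases x with h | h
      · rw [h.1]
      · rw [h.1, mul_neg, Real.sin_neg, abs_neg]
    rw [h4]
    linarith [le_abs_self (Real.sin (Real.pi * |x|))]
  have hxpos : 0 < |x| := abs_pos.mpr hx0
  have hne : e x ≠ 1 := by
    intro h
    rw [h, sub_self, norm_zero] at h1
    linarith
  simp_rw [e_nat_mul]
  rw [geom_sum_eq hne, norm_div, ← e_nat_mul]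
  have h5 : ‖e (x * L) - 1‖ ≤ 2 := by
    refine (norm_sub_le _ _).trans ?_
    rw [norm_e, norm_one]
    norm_num
  rw [div_le_div_iff₀ (by linarith) (by positivity)]
  nlinarith

lemma norm_sum_e_le_card (L : ℕ) (x : ℝ) : ‖∑ n ∈ Finset.range L, e (x * n)‖ ≤ L := by
  refine (norm_sum_le _ _).trans ?_
  simp [norm_e]

/-- The dual large sieve inequality. -/
lemma sum_norm_sq_le_of_gram {ι κ : Type*} (T : Finset ι) (V : Finset κ) (φ : ι → κ → ℂ)
    (R : κ → ℂ) {G : ℝ} (hG0 : 0 ≤ G)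
    (hG : ∀ t ∈ T, ∑ t' ∈ T, ‖∑ ν ∈ V, φ t ν * starRingEnd ℂ (φ t' ν)‖ ≤ G) :
    ∑ t ∈ T, ‖∑ ν ∈ V, R ν * φ t ν‖ ^ 2 ≤ (∑ ν ∈ V, ‖R ν‖ ^ 2) * G := by
  set F : ι → ℂ := fun t => ∑ ν ∈ V, R ν * φ t ν with hF
  set K : ι → ι → ℝ := fun t t' => ‖∑ ν ∈ V, φ t ν * starRingEnd ℂ (φ t' ν)‖ with hK
  have hKsymm : ∀ t t', K t t' = K t' t := by
    intro t t'
    simp only [hK]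
    rw [← RCLike.norm_conj, map_sum]
    congr 1
    refine Finset.sum_congr rfl fun ν _ => ?_
    rw [map_mul, Complex.conj_conj, mul_comm]
  set M : ℝ := ∑ t ∈ T, ‖F t‖ ^ 2 with hM
  set w : κ → ℂ := fun ν => ∑ t ∈ T, starRingEnd ℂ (F t) * φ t ν with hw
  have hM0 : 0 ≤ M := by positivity
  have h1 : (M : ℂ) = ∑ ν ∈ V, R ν * w ν := by
    have : ∀ t, ((‖F t‖ ^ 2 : ℝ) : ℂ) = ∑ ν ∈ V, starRingEnd ℂ (F t) * (R ν * φ t ν) := by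
      intro t
      rw [← Finset.mul_sum]
      push_cast
      rw [← Complex.conj_mul']
    rw [hM, Complex.ofReal_sum, Finset.sum_congr rfl fun t _ => this t, Finset.sum_comm]
    refine Finset.sum_congr rfl fun ν _ => ?_
    rw [hw, Finset.mul_sum]
    refine Finset.sum_congr rfl fun t _ => ?_
    ring
  have h2 : M ≤ ∑ ν ∈ V, ‖R ν‖ * ‖w ν‖ := by
    calc M = ‖(M : ℂ)‖ := by rw [Complex.norm_real, Real.norm_of_nonneg hM0]
      _ ≤ ∑ ν ∈ V, ‖R ν * w ν‖ := by rw [h1]; exact norm_sum_le _ _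
      _ = _ := by simp_rw [norm_mul]
  have h3 : M ^ 2 ≤ (∑ ν ∈ V, ‖R ν‖ ^ 2) * ∑ ν ∈ V, ‖w ν‖ ^ 2 :=
    (pow_le_pow_left₀ hM0 h2 2).trans (Finset.sum_mul_sq_le_sq_mul_sq _ _ _)
  have h4 : ∑ ν ∈ V, ‖w ν‖ ^ 2 ≤ G * M := by
    have e1 : ((∑ ν ∈ V, ‖w ν‖ ^ 2 : ℝ) : ℂ) = ∑ t ∈ T, ∑ t' ∈ T,
        starRingEnd ℂ (F t) * F t' * ∑ ν ∈ V, φ t ν * starRingEnd ℂ (φ t' ν) := by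
      have : ∀ ν, ((‖w ν‖ ^ 2 : ℝ) : ℂ) = ∑ t ∈ T, ∑ t' ∈ T,
          starRingEnd ℂ (F t) * F t' * (φ t ν * starRingEnd ℂ (φ t' ν)) := by
        intro ν
        push_cast
        rw [← Complex.mul_conj', hw, map_sum, Finset.sum_mul_sum]
        refine Finset.sum_congr rfl fun t _ => Finset.sum_congr rfl fun t' _ => ?_
        rw [map_mul, Complex.conj_conj]
        ring
      rw [Complex.ofReal_sum, Finset.sum_congr rfl fun ν _ => this ν, Finset.sum_comm]
      refine Finset.sum_congr rfl fun t _ => ?_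
      rw [Finset.sum_comm]
      refine Finset.sum_congr rfl fun t' _ => ?_
      exact (Finset.mul_sum _ _ _).symm
    have e2 : ∑ ν ∈ V, ‖w ν‖ ^ 2 ≤ ∑ t ∈ T, ∑ t' ∈ T, ‖F t‖ * ‖F t'‖ * K t t' := by
      calc ∑ ν ∈ V, ‖w ν‖ ^ 2 = ‖((∑ ν ∈ V, ‖w ν‖ ^ 2 : ℝ) : ℂ)‖ := by
            rw [Complex.norm_real, Real.norm_of_nonneg (by positivity)]
        _ ≤ _ := by
            rw [e1]
            refine (norm_sum_le _ _).trans (Finset.sum_le_sum fun t _ =>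
              (norm_sum_le _ _).trans (Finset.sum_le_sum fun t' _ => ?_))
            rw [norm_mul, norm_mul, RCLike.norm_conj]
    refine e2.trans ?_
    have e3 : ∀ t t', ‖F t‖ * ‖F t'‖ * K t t' ≤
        1 / 2 * (‖F t‖ ^ 2 * K t t') + 1 / 2 * (‖F t'‖ ^ 2 * K t' t) := by
      intro t t'
      rw [hKsymm t' t]
      have : 0 ≤ K t t' := norm_nonneg _
      nlinarith [mul_nonneg (sq_nonneg (‖F t‖ - ‖F t'‖)) this]
    have e4 : ∑ t ∈ T, ∑ t' ∈ T, ‖F t‖ ^ 2 * K t t' ≤ G * M := by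
      rw [hM, Finset.mul_sum]
      refine Finset.sum_le_sum fun t ht => ?_
      rw [← Finset.mul_sum, mul_comm]
      exact mul_le_mul_of_nonneg_right (hG t ht) (by positivity)
    have e5 : ∑ t ∈ T, ∑ t' ∈ T, ‖F t'‖ ^ 2 * K t' t ≤ G * M := by
      rw [Finset.sum_comm]
      exact e4
    calc _ ≤ ∑ t ∈ T, ∑ t' ∈ T,
          (1 / 2 * (‖F t‖ ^ 2 * K t t') + 1 / 2 * (‖F t'‖ ^ 2 * K t' t)) :=
          Finset.sum_le_sum fun t _ => Finset.sum_le_sum fun t' _ => e3 t t'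
      _ = 1 / 2 * (∑ t ∈ T, ∑ t' ∈ T, ‖F t‖ ^ 2 * K t t')
          + 1 / 2 * ∑ t ∈ T, ∑ t' ∈ T, ‖F t'‖ ^ 2 * K t' t := by
          simp_rw [Finset.sum_add_distrib, Finset.mul_sum]
      _ ≤ G * M := by linarith
  have hR0 : 0 ≤ ∑ ν ∈ V, ‖R ν‖ ^ 2 := by positivity
  rcases hM0.eq_or_lt with h0 | h0
  · rw [← h0]
    positivity
  · have h5 : M * M ≤ ((∑ ν ∈ V, ‖R ν‖ ^ 2) * G) * M := by
      nlinarith [mul_le_mul_of_nonneg_left h4 hR0]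
    exact le_of_mul_le_mul_right h5 h0

lemma sum_Ico_int_eq_sum_range {M : Type*} [AddCommMonoid M] (L : ℕ) (f : ℤ → M) :
    ∑ y ∈ Finset.Ico (0 : ℤ) L, f y = ∑ n ∈ Finset.range L, f n := by
  symm
  refine Finset.sum_bij' (fun n _ => (n : ℤ)) (fun y _ => y.toNat) ?_ ?_ ?_ ?_ ?_
  · intro n hn
    simp only [Finset.mem_range, Finset.mem_Ico] at *
    omega
  · intro n hn
    simp only [Finset.mem_range, Finset.mem_Ico] at *
    omega
  · intro n hn
    simp
  · intro n hn
    simp only [Finset.mem_Ico] at *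
    omega
  · intro n hn
    rfl

/-- Sums of squared fibre sums are controlled by the number of coincidences. -/
lemma sum_norm_fiber_sq_le {ι V : Type*} (T : Finset ι) (w : ι → V) (U : Finset V)
    (hw : ∀ t ∈ T, w t ∈ U) (g : ι → ℂ) {B : ℝ} (hB : ∀ t ∈ T, ‖g t‖ ≤ B) :
    ∑ ν ∈ U, ‖∑ t ∈ T with w t = ν, g t‖ ^ 2 ≤ B ^ 2 * coincidences T w := by
  have h1 : coincidences T w = ∑ ν ∈ U, (T.filter fun t => w t = ν).card ^ 2 := by
    unfold coincidences
    rw [Finset.card_eq_sum_card_fiberwise (f := fun x : ι × ι => w x.1) (t := U)]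
    · refine Finset.sum_congr rfl fun ν _ => ?_
      rw [sq, ← Finset.card_product]
      congr 1
      ext ⟨x, y⟩
      simp only [Finset.mem_filter, Finset.mem_product]
      constructor
      · rintro ⟨⟨⟨h1, h2⟩, h3⟩, h4⟩
        exact ⟨⟨h1, h4⟩, h2, h3 ▸ h4⟩
      · rintro ⟨⟨h1, h2⟩, h3, h4⟩
        exact ⟨⟨⟨h1, h3⟩, h2.trans h4.symm⟩, h2⟩
    · intro x hx
      simp only [Finset.coe_filter, Finset.mem_product] at hx
      exact hw _ hx.1.1
  rw [h1]
  push_cast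
  rw [Finset.mul_sum]
  refine Finset.sum_le_sum fun ν _ => ?_
  rw [← mul_pow]
  refine pow_le_pow_left₀ (norm_nonneg _) ?_ 2
  refine (norm_sum_le _ _).trans ?_
  refine (Finset.sum_le_card_nsmul _ _ B fun t ht => hB t (Finset.mem_filter.1 ht).1).trans ?_
  rw [nsmul_eq_mul, mul_comm]

lemma sum_e_box {k : ℕ} (L : Fin k → ℕ) (x : Fin k → ℝ) :
    ∑ ν ∈ Fintype.piFinset fun j => Finset.Ico (0 : ℤ) (L j), e (∑ j, x j * (ν j : ℝ))
      = ∏ j, ∑ n ∈ Finset.range (L j), e (x j * n) := by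
  have : ∀ j, ∑ n ∈ Finset.range (L j), e (x j * n)
      = ∑ n ∈ Finset.Ico (0 : ℤ) (L j), e (x j * (n : ℝ)) := by
    intro j
    rw [sum_Ico_int_eq_sum_range]
    simp
  simp_rw [this, Finset.prod_univ_sum, e_sum]

/-- A large sieve inequality for powers of Weyl sums: mean values over well separated coefficients
are controlled by Vinogradov's mean value. -/
lemma sum_norm_weyl_pow_le {ι : Type*} {k s H : ℕ} (hs : 1 ≤ s) (hH : 1 ≤ H) (T : Finset ι)
    (c : ι → Fin k → ℝ) (b : ℤ → ℂ) {B : ℝ} (hB : ∀ y, ‖b y‖ ≤ B) (j₀ : Fin k)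
    {G : ℝ} (hG0 : 0 ≤ G)
    (hG : ∀ t ∈ T, ∑ t' ∈ T,
      ‖∑ n ∈ Finset.range (s * H ^ (j₀.1 + 1)), e ((c t j₀ - c t' j₀) * n)‖
        ≤ (s * H ^ (j₀.1 + 1) : ℕ) * G) :
    ∑ t ∈ T, ‖∑ y ∈ Finset.Ico (0 : ℤ) H, b y * e (∑ j, c t j * (y : ℝ) ^ (j.1 + 1))‖ ^ (2 * s)
      ≤ B ^ (2 * s) * vinogradovCount k s H *
        ((∏ j : Fin k, ((s * H ^ (j.1 + 1) : ℕ) : ℝ)) * G) := by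
  set P : Finset (Fin s → ℤ) := Fintype.piFinset fun _ : Fin s => Finset.Ico (0 : ℤ) H with hP
  set w : (Fin s → ℤ) → Fin k → ℤ := fun v j => ∑ i, v i ^ (j.1 + 1) with hw
  set L : Fin k → ℕ := fun j => s * H ^ (j.1 + 1) with hL
  set U : Finset (Fin k → ℤ) := Fintype.piFinset fun j => Finset.Ico (0 : ℤ) (L j) with hU
  set g : (Fin s → ℤ) → ℂ := fun v => ∏ i, b (v i) with hg
  set R : (Fin k → ℤ) → ℂ := fun ν => ∑ v ∈ P with w v = ν, g v with hR
  set φ : ι → (Fin k → ℤ) → ℂ := fun t ν => e (∑ j, c t j * (ν j : ℝ)) with hφ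
  have hwU : ∀ v ∈ P, w v ∈ U := by
    intro v hv
    rw [hP, Fintype.mem_piFinset] at hv
    rw [hU, Fintype.mem_piFinset]
    intro j
    rw [Finset.mem_Ico]
    have hvi := fun i => Finset.mem_Ico.1 (hv i)
    refine ⟨Finset.sum_nonneg fun i _ => pow_nonneg (hvi i).1 _, ?_⟩
    have : NeZero s := ⟨by omega⟩
    calc w v j < ∑ i : Fin s, (H : ℤ) ^ (j.1 + 1) :=
          Finset.sum_lt_sum_of_nonempty Finset.univ_nonempty
            fun i _ => pow_lt_pow_left₀ (hvi i).2 (hvi i).1 (by omega)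
      _ = (L j : ℤ) := by simp [hL]
  have hexp : ∀ t, (∑ y ∈ Finset.Ico (0 : ℤ) H, b y * e (∑ j, c t j * (y : ℝ) ^ (j.1 + 1))) ^ s
      = ∑ ν ∈ U, R ν * φ t ν := by
    intro t
    have h1 : (∑ y ∈ Finset.Ico (0 : ℤ) H, b y * e (∑ j, c t j * (y : ℝ) ^ (j.1 + 1))) ^ s
        = ∑ v ∈ P, g v * φ t (w v) := by
      rw [← Fin.prod_const, Finset.prod_univ_sum]
      refine Finset.sum_congr rfl fun v _ => ?_
      rw [Finset.prod_mul_distrib, ← e_sum, Finset.sum_comm]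
      congr 2
      refine Finset.sum_congr rfl fun j _ => ?_
      rw [← Finset.mul_sum, hw]
      push_cast
      rfl
    rw [h1, ← Finset.sum_fiberwise_of_maps_to hwU]
    refine Finset.sum_congr rfl fun ν _ => ?_
    rw [hR, Finset.sum_mul]
    refine Finset.sum_congr rfl fun v hv => ?_
    rw [(Finset.mem_filter.1 hv).2]
  have hgram : ∀ t ∈ T, ∑ t' ∈ T, ‖∑ ν ∈ U, φ t ν * starRingEnd ℂ (φ t' ν)‖
      ≤ (∏ j, (L j : ℝ)) * G := by
    intro t ht
    have h1 : ∀ t', ‖∑ ν ∈ U, φ t ν * starRingEnd ℂ (φ t' ν)‖ ≤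
        (∏ j ∈ Finset.univ.erase j₀, (L j : ℝ)) *
          ‖∑ n ∈ Finset.range (L j₀), e ((c t j₀ - c t' j₀) * n)‖ := by
      intro t'
      have h2 : ∀ ν : Fin k → ℤ, φ t ν * starRingEnd ℂ (φ t' ν)
          = e (∑ j, (c t j - c t' j) * (ν j : ℝ)) := by
        intro ν
        simp only [hφ]
        rw [conj_e, ← e_add, ← sub_eq_add_neg, ← Finset.sum_sub_distrib]
        simp_rw [sub_mul]
      simp_rw [h2]
      rw [hU, sum_e_box, norm_prod, ← Finset.prod_erase_mul _ _ (Finset.mem_univ j₀)]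
      gcongr with j _
      exact norm_sum_e_le_card _ _
    calc _ ≤ ∑ t' ∈ T, (∏ j ∈ Finset.univ.erase j₀, (L j : ℝ)) *
          ‖∑ n ∈ Finset.range (L j₀), e ((c t j₀ - c t' j₀) * n)‖ :=
          Finset.sum_le_sum fun t' _ => h1 t'
      _ ≤ (∏ j ∈ Finset.univ.erase j₀, (L j : ℝ)) * ((L j₀ : ℕ) * G) := by
          rw [← Finset.mul_sum]
          gcongr
          exact hG t ht
      _ = _ := by
          rw [← Finset.prod_erase_mul _ _ (Finset.mem_univ j₀)]
          ring
  have hmain := sum_norm_sq_le_of_gram T U φ R (by positivity) hgram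
  have hR2 : ∑ ν ∈ U, ‖R ν‖ ^ 2 ≤ (B ^ s) ^ 2 * coincidences P w := by
    have hgB : ∀ v ∈ P, ‖g v‖ ≤ B ^ s := by
      intro v _
      rw [hg, norm_prod]
      refine (Finset.prod_le_prod (fun _ _ => norm_nonneg _) fun i _ => hB (v i)).trans ?_
      simp
    exact le_of_eq_of_le (by congr!) (sum_norm_fiber_sq_le P w U hwU g hgB)
  have hcoin : coincidences P w = vinogradovCount k s H := rfl
  rw [hcoin, ← pow_mul, mul_comm s 2] at hR2
  calc _ = ∑ t ∈ T, ‖∑ ν ∈ U, R ν * φ t ν‖ ^ 2 := by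
        refine Finset.sum_congr rfl fun t _ => ?_
        rw [← hexp, norm_pow, ← pow_mul, mul_comm s 2]
    _ ≤ _ := hmain
    _ ≤ _ := by gcongr

lemma sum_inv_Icc_le (M : ℕ) : ∑ d ∈ Finset.Icc 1 M, (1 / d : ℝ) ≤ 1 + Real.log M := by
  refine le_trans (le_of_eq ?_) (harmonic_le_one_add_log M)
  rw [harmonic_eq_sum_Icc]
  push_cast
  simp

lemma sum_inv_abs_sub_le (M t : ℕ) (T : Finset ℕ) (hT : ∀ t' ∈ T, t' ≤ M) (ht : t ∈ T) :
    ∑ t' ∈ T.erase t, 1 / |(t : ℝ) - t'| ≤ 2 * (1 + Real.log M) := by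
  have h1 : ∑ t' ∈ T.erase t with t' < t, 1 / |(t : ℝ) - t'| ≤ 1 + Real.log M := by
    refine le_trans ?_ (sum_inv_Icc_le M)
    have : ∑ t' ∈ T.erase t with t' < t, 1 / |(t : ℝ) - t'|
        = ∑ d ∈ ((T.erase t).filter (· < t)).image (t - ·), (1 / d : ℝ) := by
      rw [Finset.sum_image]
      · refine Finset.sum_congr rfl fun t' ht' => ?_
        have h := (Finset.mem_filter.1 ht').2
        rw [Nat.cast_sub h.le, abs_of_nonneg]
        rw [sub_nonneg]
        exact_mod_cast h.le
      · intro x hx y hy hxy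
        have h1 := (Finset.mem_filter.1 hx).2
        have h2 := (Finset.mem_filter.1 hy).2
        simp only at hxy
        omega
    rw [this]
    refine Finset.sum_le_sum_of_subset_of_nonneg ?_ fun _ _ _ => by positivity
    intro d hd
    obtain ⟨x, hx, rfl⟩ := Finset.mem_image.1 hd
    have h1 := (Finset.mem_filter.1 hx).2
    have := hT t ht
    rw [Finset.mem_Icc]
    omega
  have h2 : ∑ t' ∈ T.erase t with ¬ t' < t, 1 / |(t : ℝ) - t'| ≤ 1 + Real.log M := by
    refine le_trans ?_ (sum_inv_Icc_le M)
    have : ∑ t' ∈ T.erase t with ¬ t' < t, 1 / |(t : ℝ) - t'|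
        = ∑ d ∈ ((T.erase t).filter (¬ · < t)).image (· - t), (1 / d : ℝ) := by
      rw [Finset.sum_image]
      · refine Finset.sum_congr rfl fun t' ht' => ?_
        have h := not_lt.1 (Finset.mem_filter.1 ht').2
        rw [Nat.cast_sub h, abs_sub_comm, abs_of_nonneg]
        rw [sub_nonneg]
        exact_mod_cast h
      · intro x hx y hy hxy
        have h1 := (Finset.mem_filter.1 hx).2
        have h2 := (Finset.mem_filter.1 hy).2
        simp only at hxy
        omega
    rw [this]
    refine Finset.sum_le_sum_of_subset_of_nonneg ?_ fun _ _ _ => by positivity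
    intro d hd
    obtain ⟨x, hx, rfl⟩ := Finset.mem_image.1 hd
    have h1 := (Finset.mem_filter.1 hx)
    have h2 := Finset.mem_erase.1 h1.1
    have := hT x h2.2
    rw [Finset.mem_Icc]
    omega
  rw [← Finset.sum_filter_add_sum_filter_not (T.erase t) (· < t)]
  linarith

lemma sum_norm_gram_le {M L : ℕ} (hL : 1 ≤ L) (T : Finset ℕ) (hT : ∀ t ∈ T, t ≤ M)
    (c : ℕ → ℝ) {δ : ℝ} (hδ : 0 < δ) (hsep : ∀ t ∈ T, ∀ t' ∈ T, δ * |(t : ℝ) - t'| ≤ |c t - c t'|)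
    (hc : ∀ t ∈ T, ∀ t' ∈ T, |c t - c t'| ≤ 1 / 2) (t : ℕ) (ht : t ∈ T) :
    ∑ t' ∈ T, ‖∑ n ∈ Finset.range L, e ((c t - c t') * n)‖
      ≤ L * (1 + (1 + Real.log M) / (δ * L)) := by
  have hL0 : (0 : ℝ) < L := by exact_mod_cast hL
  rw [← Finset.add_sum_erase T _ ht]
  have h1 : ∑ t' ∈ T.erase t, ‖∑ n ∈ Finset.range L, e ((c t - c t') * n)‖
      ≤ ∑ t' ∈ T.erase t, 1 / (2 * δ) * (1 / |(t : ℝ) - t'|) := by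
    refine Finset.sum_le_sum fun t' ht' => ?_
    have h2 := Finset.mem_erase.1 ht'
    have h3 : 0 < |(t : ℝ) - t'| := by
      rw [abs_pos, sub_ne_zero]
      exact_mod_cast h2.1.symm
    have h4 := hsep t ht t' h2.2
    have h5 : 0 < |c t - c t'| := lt_of_lt_of_le (by positivity) h4
    refine (norm_sum_e_le L (hc t ht t' h2.2) (abs_pos.1 h5)).trans ?_
    rw [← one_div_mul_one_div, ← one_div_mul_one_div, mul_assoc, one_div_mul_one_div δ]
    gcongr
  have h2 := sum_inv_abs_sub_le M t T hT ht
  have h3 := norm_sum_e_le_card L (c t - c t)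
  calc _ ≤ (L : ℝ) + 1 / (2 * δ) * (2 * (1 + Real.log M)) := by
        refine add_le_add h3 (h1.trans ?_)
        rw [← Finset.mul_sum]
        gcongr
    _ = _ := by
        field_simp

lemma prod_box_eq (k s H : ℕ) :
    (∏ j : Fin k, ((s * H ^ (j.1 + 1) : ℕ) : ℝ)) = (s : ℝ) ^ k * (H : ℝ) ^ (k * (k + 1) / 2) := by
  push_cast
  rw [Finset.prod_mul_distrib, Fin.prod_const, Finset.prod_pow_eq_pow_sum,
    Fin.sum_univ_eq_sum_range (fun i => i + 1)]
  congr 2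
  have h := Finset.sum_range_succ' (fun i => i) k
  rw [Finset.sum_range_id] at h
  simp only [Nat.add_sub_cancel, add_zero] at h
  rw [← h, mul_comm]

/-- Mean values of Weyl sums of degree `k` over a family of polynomials in which one coefficient
is well spaced. -/
theorem exists_weyl_mean_le {k : ℕ} (hk : 2 ≤ k) (j₀ : Fin k) {Δ : ℝ} (hΔ : 0 < Δ) :
    ∃ C : ℝ, 0 ≤ C ∧ ∀ (H q M : ℕ) (T : Finset ℕ) (R B δ : ℝ) (c : ℕ → Fin k → ℝ)
      (b : ℕ → ℤ → ℂ), 1 ≤ H → 1 ≤ q → 1 ≤ M → (∀ t ∈ T, t ≤ M) → 0 < R → (T.card : ℝ) ≤ R →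
      0 ≤ B → (∀ r y, ‖b r y‖ ≤ B) → 0 < δ →
      (∀ t ∈ T, ∀ t' ∈ T, δ * |(t : ℝ) - t'| ≤ |c t j₀ - c t' j₀|) →
      (∀ t ∈ T, ∀ t' ∈ T, |c t j₀ - c t' j₀| ≤ 1 / 2) →
      (∑ t ∈ T, ‖∑ y ∈ Finset.Ico (0 : ℤ) H,
          b (t % q) y * e (∑ j, c t j * (y : ℝ) ^ (j.1 + 1))‖) ^ (2 * (k + k * k))
        ≤ C * q * (B * R * H) ^ (2 * (k + k * k)) * (H : ℝ) ^ Δ *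
          (1 / R * (1 + (1 + Real.log M) / (δ * (H : ℝ) ^ (j₀.1 + 1)))) := by
  obtain ⟨C, hC, hJ⟩ := exists_vinogradovCount_le hk hΔ
  set s : ℕ := k + k * k with hs
  have hs1 : 1 ≤ s := by omega
  refine ⟨C * (s : ℝ) ^ k, by positivity, ?_⟩
  intro H q M T R B δ c b hH hq hM hT hR hTR hB0 hB hδ hsep hc
  have hH1 : (1 : ℝ) ≤ H := by exact_mod_cast hH
  have hH0 : (0 : ℝ) < H := by linarith
  have hs0 : (1 : ℝ) ≤ s := by exact_mod_cast hs1
  have hlog : 0 ≤ Real.log M := Real.log_natCast_nonneg M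
  set G : ℝ := 1 + (1 + Real.log M) / (δ * (H : ℝ) ^ (j₀.1 + 1)) with hG
  have hG0 : 0 ≤ G := by positivity
  set F : ℕ → ℝ := fun t => ‖∑ y ∈ Finset.Ico (0 : ℤ) H,
          b (t % q) y * e (∑ j, c t j * (y : ℝ) ^ (j.1 + 1))‖ with hF
  have hclass : ∀ r, ∑ t ∈ T with t % q = r, F t ^ (2 * s)
      ≤ B ^ (2 * s) * (C * (s : ℝ) ^ k * ((H : ℝ) ^ (2 * s) * (H : ℝ) ^ Δ)) * G := by
    intro r
    have h1 := sum_norm_weyl_pow_le hs1 hH (T.filter fun t => t % q = r) c (b r) (hB r) j₀ hG0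
      (fun t ht => by
        have hL : 1 ≤ s * H ^ (j₀.1 + 1) := Nat.mul_pos hs1 (pow_pos hH _)
        have h2 := sum_norm_gram_le hL (T.filter fun t => t % q = r)
          (fun t ht => hT t (Finset.mem_filter.1 ht).1) (fun t => c t j₀) hδ
          (fun t ht t' ht' => hsep t (Finset.mem_filter.1 ht).1 t' (Finset.mem_filter.1 ht').1)
          (fun t ht t' ht' => hc t (Finset.mem_filter.1 ht).1 t' (Finset.mem_filter.1 ht').1)
          t ht
        refine h2.trans ?_
        rw [hG]
        gcongr
        push_cast
        exact le_mul_of_one_le_left (by positivity) hs0)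
    have h3 : ∑ t ∈ T with t % q = r, F t ^ (2 * s) = ∑ t ∈ T with t % q = r,
        ‖∑ y ∈ Finset.Ico (0 : ℤ) H,
          b r y * e (∑ j, c t j * (y : ℝ) ^ (j.1 + 1))‖ ^ (2 * s) := by
      refine Finset.sum_congr rfl fun t ht => ?_
      simp only [hF]
      rw [(Finset.mem_filter.1 ht).2]
    rw [h3]
    refine h1.trans ?_
    rw [prod_box_eq]
    have h4 : (H : ℝ) ^ (3 / 2 * ((k : ℝ) * (k + 1)) + Δ) * (H : ℝ) ^ (k * (k + 1) / 2)
        = (H : ℝ) ^ (2 * s) * (H : ℝ) ^ Δ := by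
      rw [← Real.rpow_natCast, ← Real.rpow_natCast, ← Real.rpow_add hH0, ← Real.rpow_add hH0]
      congr 1
      have : ((k * (k + 1) / 2 : ℕ) : ℝ) = k * (k + 1) / 2 := by
        rw [Nat.cast_div (Nat.even_mul_succ_self k).two_dvd (by norm_num)]
        push_cast
        ring
      rw [this, hs]
      push_cast
      ring
    calc _ ≤ B ^ (2 * s) * (C * (H : ℝ) ^ (3 / 2 * ((k : ℝ) * (k + 1)) + Δ)) *
          ((s : ℝ) ^ k * (H : ℝ) ^ (k * (k + 1) / 2) * G) := by
          gcongr
          exact hJ H hH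
      _ = B ^ (2 * s) * (C * (s : ℝ) ^ k * ((H : ℝ) ^ (3 / 2 * ((k : ℝ) * (k + 1)) + Δ)
            * (H : ℝ) ^ (k * (k + 1) / 2))) * G := by ring
      _ = _ := by rw [h4]
  have htot : ∑ t ∈ T, F t ^ (2 * s)
      ≤ q * (B ^ (2 * s) * (C * (s : ℝ) ^ k * ((H : ℝ) ^ (2 * s) * (H : ℝ) ^ Δ)) * G) := by
    rw [← Finset.sum_fiberwise_of_maps_to (t := Finset.range q) (g := fun t => t % q)
      (fun t _ => Finset.mem_range.2 (Nat.mod_lt _ hq))]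
    refine (Finset.sum_le_card_nsmul _ _ _ fun r _ => ?_).trans
      (by rw [Finset.card_range, nsmul_eq_mul])
    exact le_of_eq_of_le (by congr!) (hclass r)
  have hpow : (∑ t ∈ T, F t) ^ (2 * s) ≤ R ^ (2 * s - 1) * ∑ t ∈ T, F t ^ (2 * s) := by
    obtain ⟨n, hn⟩ : ∃ n, 2 * s = n + 1 := ⟨2 * s - 1, by omega⟩
    have h := pow_sum_div_card_le_sum_pow (s := T) (f := F) (fun _ _ => norm_nonneg _) n
    rw [hn, Nat.add_sub_cancel]
    rcases T.eq_empty_or_nonempty with rfl | hne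
    · simp
    · have hcard : (0 : ℝ) < T.card := by exact_mod_cast hne.card_pos
      rw [div_le_iff₀ (by positivity)] at h
      refine h.trans ?_
      rw [mul_comm]
      have : 0 ≤ ∑ t ∈ T, F t ^ (n + 1) := by positivity
      gcongr
  have hRpow : R ^ (2 * s - 1) = R ^ (2 * s) * (1 / R) := by
    obtain ⟨n, hn⟩ : ∃ n, 2 * s = n + 1 := ⟨2 * s - 1, by omega⟩
    rw [hn, Nat.add_sub_cancel, pow_succ]
    field_simp
  calc _ ≤ R ^ (2 * s - 1) * ∑ t ∈ T, F t ^ (2 * s) := hpow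
    _ ≤ R ^ (2 * s) * (1 / R) *
        (q * (B ^ (2 * s) * (C * (s : ℝ) ^ k * ((H : ℝ) ^ (2 * s) * (H : ℝ) ^ Δ)) * G)) := by
        rw [hRpow]
        gcongr
    _ = _ := by
        rw [mul_pow, mul_pow]
        ring

lemma ring_choose_ne_zero {α : ℝ} (hα : ∀ n : ℕ, α ≠ n) (j : ℕ) : Ring.choose α j ≠ 0 := by
  have h1 : ∀ n : ℕ, (descPochhammer ℤ n).smeval α ≠ 0 := by
    intro n
    induction n with
    | zero => simp
    | succ n ih =>
      rw [descPochhammer_succ_right, Polynomial.smeval_mul, Polynomial.smeval_sub,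
        Polynomial.smeval_X, Polynomial.smeval_natCast]
      refine mul_ne_zero ih ?_
      simp only [pow_one, pow_zero, nsmul_eq_mul, mul_one]
      exact sub_ne_zero.2 (hα n)
  intro h
  have := Ring.descPochhammer_eq_factorial_smul_choose α j
  rw [h, smul_zero] at this
  exact h1 j this

lemma exists_one_add_rpow_approx (α : ℝ) (k : ℕ) :
    ∃ C : ℝ, 0 ≤ C ∧ ∀ u : ℝ, 0 ≤ u → u ≤ 1 / 2 →
      |(1 + u) ^ α - ∑ j ∈ Finset.range k, Ring.choose α j * u ^ j| ≤ C * u ^ k := by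
  obtain ⟨a, ha, C, hC, h⟩ := (Complex.one_add_cpow_hasFPowerSeriesOnBall_zero
    (a := (α : ℂ))).uniform_geometric_approx' (r' := 3 / 4) (by
      rw [ENNReal.coe_lt_one_iff]
      rw [← NNReal.coe_lt_coe]
      norm_num)
  refine ⟨C * (a * (4 / 3)) ^ k, by have := ha.1; positivity, fun u hu hu2 => ?_⟩
  have h1 := h (u : ℂ) (by
    rw [Metric.mem_ball, dist_zero_right, Complex.norm_real, Real.norm_of_nonneg hu]
    push_cast
    linarith) k
  rw [Complex.norm_real, Real.norm_of_nonneg hu, zero_add] at h1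
  have h2 : ((1 + u : ℂ) ^ (α : ℂ) - (binomialSeries ℂ (α : ℂ)).partialSum k (u : ℂ))
      = (((1 + u) ^ α - ∑ j ∈ Finset.range k, Ring.choose α j * u ^ j : ℝ) : ℂ) := by
    push_cast
    rw [Complex.ofReal_cpow (by linarith), FormalMultilinearSeries.partialSum]
    congr 1
    · push_cast
      rfl
    · refine Finset.sum_congr rfl fun j _ => ?_
      rw [binomialSeries_apply]
      simp
  rw [h2, Complex.norm_real, Real.norm_eq_abs] at h1
  refine h1.trans (le_of_eq ?_)
  push_cast
  rw [mul_assoc, ← mul_pow]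
  congr 2
  ring

lemma rpow_le_of_mem {R t γ : ℝ} (hR : 0 < R) (h1 : R ≤ t) (h2 : t ≤ 8 * R) :
    t ^ γ ≤ 8 ^ |γ| * R ^ γ := by
  have ht : 0 < t := by linarith
  have h3 : (t / R) ^ γ ≤ 8 ^ |γ| := by
    have h4 : 1 ≤ t / R := by rwa [le_div_iff₀ hR, one_mul]
    calc (t / R) ^ γ ≤ (t / R) ^ |γ| := Real.rpow_le_rpow_of_exponent_le h4 (le_abs_self _)
      _ ≤ 8 ^ |γ| := Real.rpow_le_rpow (by positivity) (by rwa [div_le_iff₀ hR]) (abs_nonneg _)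
  rw [Real.div_rpow ht.le hR.le, div_le_iff₀ (by positivity)] at h3
  exact h3

lemma le_rpow_of_mem {R t γ : ℝ} (hR : 0 < R) (h1 : R ≤ t) (h2 : t ≤ 8 * R) :
    8 ^ (-|γ|) * R ^ γ ≤ t ^ γ := by
  have ht : 0 < t := by linarith
  have := rpow_le_of_mem (γ := -γ) hR h1 h2
  rw [abs_neg, Real.rpow_neg ht.le, Real.rpow_neg hR.le] at this
  rw [Real.rpow_neg (by norm_num)]
  have hR' : 0 < R ^ γ := by positivity
  have ht' : 0 < t ^ γ := by positivity
  have h8 : (0 : ℝ) < 8 ^ |γ| := by positivity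
  rw [inv_mul_le_iff₀ h8]
  rw [inv_le_iff_one_le_mul₀ ht', mul_assoc, ← div_eq_inv_mul, ← mul_div_assoc,
    le_div_iff₀ hR', one_mul] at this
  exact this

lemma rpow_spacing {β R t t' : ℝ} (hR : 0 < R) (h1 : R ≤ t) (h2 : t ≤ 8 * R)
    (h1' : R ≤ t') (h2' : t' ≤ 8 * R) :
    |β| * 8 ^ (-|β - 1|) * R ^ (β - 1) * |t - t'| ≤ |t ^ β - t' ^ β| := by
  wlog hlt : t < t' generalizing t t'
  · rcases (not_lt.1 hlt).eq_or_lt with rfl | h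
    · simp
    · have := this h1' h2' h1 h2 h
      rwa [abs_sub_comm t, abs_sub_comm (t ^ β)]
  obtain ⟨ξ, hξ, h⟩ := exists_hasDerivAt_eq_slope (fun x : ℝ => x ^ β)
    (fun x => β * x ^ (β - 1)) hlt
    (fun x hx => (Real.continuousAt_rpow_const _ _
      (Or.inl (by have := hx.1; linarith))).continuousWithinAt)
    (fun x hx => Real.hasDerivAt_rpow_const (Or.inl (by have := hx.1; linarith)))
  have h3 : t' ^ β - t ^ β = β * ξ ^ (β - 1) * (t' - t) := by
    rw [h, div_mul_cancel₀ _ (by linarith)]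
  have hξ0 : 0 < ξ := by linarith [hξ.1]
  rw [abs_sub_comm t, abs_sub_comm (t ^ β), h3, abs_mul, abs_mul,
    abs_of_nonneg (Real.rpow_nonneg hξ0.le _), mul_assoc |β|]
  gcongr
  exact le_rpow_of_mem hR (by linarith [hξ.1]) (by linarith [hξ.2])

/-- Mean values of Weyl sums over families of polynomials for which one coefficient is a power of
the parameter. -/
theorem exists_weyl_power_mean_le {k : ℕ} (hk : 2 ≤ k) (j₀ : Fin k) {Δ β : ℝ} (hΔ : 0 < Δ)
    (hβ : β ≠ 0) :
    ∃ C : ℝ, 0 ≤ C ∧ ∀ (H q : ℕ) (T : Finset ℕ) (R B A : ℝ) (c : ℕ → Fin k → ℝ)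
      (b : ℕ → ℤ → ℂ), 1 ≤ H → 1 ≤ q → 1 ≤ R → (∀ t ∈ T, R ≤ t ∧ (t : ℝ) ≤ 8 * R) →
      0 ≤ B → (∀ r y, ‖b r y‖ ≤ B) → A ≠ 0 → (∀ t ∈ T, c t j₀ = A * (t : ℝ) ^ β) →
      |A| * (8 ^ |β| * R ^ β) ≤ 1 / 4 →
      (∑ t ∈ T, ‖∑ y ∈ Finset.Ico (0 : ℤ) H,
          b (t % q) y * e (∑ j, c t j * (y : ℝ) ^ (j.1 + 1))‖) ^ (2 * (k + k * k))
        ≤ C * q * (B * R * H) ^ (2 * (k + k * k)) * (H : ℝ) ^ Δ *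
          (1 / R + (1 + Real.log (8 * R)) / (|A| * R ^ β * (H : ℝ) ^ (j₀.1 + 1))) := by
  obtain ⟨C, hC, hmain⟩ := exists_weyl_mean_le hk j₀ hΔ
  set s : ℕ := k + k * k with hs
  set c₀ : ℝ := |β| * 8 ^ (-|β - 1|) with hc₀
  have hc₀pos : 0 < c₀ := by
    have := abs_pos.2 hβ
    positivity
  refine ⟨C * 8 ^ (2 * s) * (1 + 1 / c₀), by positivity, ?_⟩
  intro H q T R B A c b hH hq hR hT hB0 hB hA hcA hbound
  have hR0 : 0 < R := by linarith
  have hH0 : (0 : ℝ) < H := by exact_mod_cast hH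
  have hA0 : 0 < |A| := abs_pos.2 hA
  set M : ℕ := ⌊8 * R⌋₊ with hM
  have hM1 : 1 ≤ M := Nat.le_floor (by push_cast; linarith)
  have hMR : (M : ℝ) ≤ 8 * R := Nat.floor_le (by positivity)
  have hTM : ∀ t ∈ T, t ≤ M := fun t ht => Nat.le_floor (hT t ht).2
  have hcard : (T.card : ℝ) ≤ 8 * R := by
    have h1 : T ⊆ Finset.Icc 1 M := by
      intro t ht
      rw [Finset.mem_Icc]
      refine ⟨?_, hTM t ht⟩
      have : (1 : ℝ) ≤ t := hR.trans (hT t ht).1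
      exact_mod_cast this
    have h2 := Finset.card_le_card h1
    rw [Nat.card_Icc, Nat.add_sub_cancel] at h2
    exact le_trans (by exact_mod_cast h2) hMR
  have hδ : 0 < |A| * (c₀ * R ^ (β - 1)) := by positivity
  have h := hmain H q M T (8 * R) B (|A| * (c₀ * R ^ (β - 1))) c b hH hq hM1 hTM (by positivity)
    hcard hB0 hB hδ
    (fun t ht t' ht' => by
      rw [hcA t ht, hcA t' ht', ← mul_sub, abs_mul, mul_assoc]
      gcongr
      exact rpow_spacing hR0 (hT t ht).1 (hT t ht).2 (hT t' ht').1 (hT t' ht').2)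
    (fun t ht t' ht' => by
      have h1 : ∀ t ∈ T, |A * (t : ℝ) ^ β| ≤ 1 / 4 := by
        intro t ht
        rw [abs_mul, abs_of_nonneg (Real.rpow_nonneg (Nat.cast_nonneg t) _)]
        refine le_trans ?_ hbound
        gcongr
        exact rpow_le_of_mem hR0 (hT t ht).1 (hT t ht).2
      rw [hcA t ht, hcA t' ht']
      have := abs_sub (A * (t : ℝ) ^ β) (A * (t' : ℝ) ^ β)
      linarith [h1 t ht, h1 t' ht'])
  refine h.trans ?_
  have hlog : Real.log M ≤ Real.log (8 * R) := Real.log_le_log (by exact_mod_cast hM1) hMR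
  have hlogM : 0 ≤ Real.log M := Real.log_natCast_nonneg M
  set E : ℝ := |A| * R ^ β * (H : ℝ) ^ (j₀.1 + 1) with hE
  have hE0 : 0 < E := by positivity
  have hE1 : |A| * (c₀ * R ^ (β - 1)) * (H : ℝ) ^ (j₀.1 + 1) = c₀ * E / R := by
    rw [Real.rpow_sub_one hR0.ne', hE]
    ring
  have hfac : 1 / (8 * R) * (1 + (1 + Real.log M) / (c₀ * E / R))
      ≤ (1 + 1 / c₀) * (1 / R + (1 + Real.log (8 * R)) / E) := by
    have e1 : 1 / (8 * R) * (1 + (1 + Real.log M) / (c₀ * E / R))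
        = 1 / 8 * (1 / R) + 1 / 8 * (1 / c₀) * ((1 + Real.log M) / E) := by
      field_simp
    have e2 : (1 + Real.log M) / E ≤ (1 + Real.log (8 * R)) / E := by gcongr
    rw [e1]
    have e3 : 0 ≤ 1 / R := by positivity
    have e4 : 0 ≤ (1 + Real.log M) / E := by positivity
    have e5 : 0 ≤ 1 / c₀ := by positivity
    nlinarith [mul_nonneg e5 e3, mul_nonneg e5 e4, mul_le_mul_of_nonneg_left e2 e5]
  rw [hE1]
  calc _ ≤ C * q * (B * (8 * R) * H) ^ (2 * s) * (H : ℝ) ^ Δ *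
        ((1 + 1 / c₀) * (1 / R + (1 + Real.log (8 * R)) / E)) := by gcongr
    _ = _ := by
      rw [show B * (8 * R) * (H : ℝ) = 8 * (B * R * H) by ring, mul_pow 8]
      ring

lemma le_mul_of_pow_le {n : ℕ} (hn : n ≠ 0) {a b C : ℝ} (hb : 0 ≤ b)
    (h : a ^ n ≤ C * b ^ n) : a ≤ max 1 C * b := by
  have h0 : 0 ≤ max 1 C := by positivity
  refine le_of_pow_le_pow_left₀ hn (by positivity) (h.trans ?_)
  rw [mul_pow]
  gcongr
  exact (le_max_right 1 C).trans (le_self_pow₀ (le_max_left 1 C) hn)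

/-- A power saving for families of Weyl sums in which one coefficient is a power of the
parameter. -/
lemma exists_weyl_family_le {k : ℕ} (hk : 2 ≤ k) (j₀ : Fin k) {β ω η ρ K : ℝ} (hβ : β ≠ 0)
    (hK : 0 ≤ K) (hρ : 0 < ω - η - (2 * (k + k * k) : ℕ) * ρ) :
    ∃ C : ℝ, 0 ≤ C ∧ ∀ (H q : ℕ) (T : Finset ℕ) (X R B A : ℝ) (c : ℕ → Fin k → ℝ)
      (b : ℕ → ℤ → ℂ), 1 ≤ X → 1 ≤ H → (H : ℝ) ≤ X → 1 ≤ q → (q : ℝ) ≤ X ^ η → 1 ≤ R → R ≤ X →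
      (∀ t ∈ T, R ≤ t ∧ (t : ℝ) ≤ 8 * R) →
      0 ≤ B → (∀ r y, ‖b r y‖ ≤ B) → A ≠ 0 → (∀ t ∈ T, c t j₀ = A * (t : ℝ) ^ β) →
      |A| * (8 ^ |β| * R ^ β) ≤ 1 / 4 → X ^ ω ≤ K * R →
      X ^ ω ≤ K * (|A| * R ^ β * (H : ℝ) ^ (j₀.1 + 1)) →
      (∑ t ∈ T, ‖∑ y ∈ Finset.Ico (0 : ℤ) H,
          b (t % q) y * e (∑ j, c t j * (y : ℝ) ^ (j.1 + 1))‖) ≤ C * (B * R * H * X ^ (-ρ)) := by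
  set s2 : ℕ := 2 * (k + k * k) with hs2
  have hs0 : s2 ≠ 0 := by
    have := hk
    simp only [hs2]
    omega
  set ξ : ℝ := ω - η - s2 * ρ with hξ
  obtain ⟨C, hC, hmain⟩ := exists_weyl_power_mean_le hk j₀ (Δ := ξ / 4) (β := β) (by linarith) hβ
  set D : ℝ := 1 + 8 ^ (ξ / 4) / (ξ / 4) with hD
  have hD1 : 1 ≤ D := by
    have : 0 ≤ (8 : ℝ) ^ (ξ / 4) / (ξ / 4) := by positivity
    linarith
  refine ⟨max 1 (C * (K + D * K)), by positivity, ?_⟩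
  intro H q T X R B A c b hX hH hHX hq hqX hR hRX hT hB0 hB hA hcA hbound hω1 hω2
  have h := hmain H q T R B A c b hH hq hR hT hB0 hB hA hcA hbound
  rw [← hs2] at h
  have hX0 : 0 < X := by linarith
  have hR0 : 0 < R := by linarith
  have hH0 : (0 : ℝ) < H := by exact_mod_cast hH
  have hA0 : 0 < |A| := abs_pos.2 hA
  apply le_mul_of_pow_le hs0 (by positivity)
  refine h.trans ?_
  set E : ℝ := |A| * R ^ β * (H : ℝ) ^ (j₀.1 + 1) with hE
  have hE0 : 0 < E := by positivity
  have hlog : 1 + Real.log (8 * R) ≤ D * X ^ (ξ / 4) := by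
    have h1 : Real.log (8 * R) ≤ Real.log (8 * X) := Real.log_le_log (by positivity) (by linarith)
    have h2 := Real.log_le_rpow_div (x := 8 * X) (by positivity) (ε := ξ / 4) (by linarith)
    rw [Real.mul_rpow (by norm_num) hX0.le] at h2
    have h3 : 1 ≤ X ^ (ξ / 4) := Real.one_le_rpow hX (by linarith)
    calc _ ≤ X ^ (ξ / 4) + 8 ^ (ξ / 4) * X ^ (ξ / 4) / (ξ / 4) := by linarith
      _ = _ := by rw [hD]; ring
  have h1 : 1 / R ≤ K * X ^ (-ω) := by
    rw [Real.rpow_neg hX0.le, ← div_eq_mul_inv, div_le_div_iff₀ hR0 (by positivity)]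
    linarith
  have h2 : 1 / E ≤ K * X ^ (-ω) := by
    rw [Real.rpow_neg hX0.le, ← div_eq_mul_inv, div_le_div_iff₀ hE0 (by positivity)]
    linarith
  have h3 : 1 / R + (1 + Real.log (8 * R)) / E ≤ (K + D * K) * X ^ (ξ / 4 - ω) := by
    have e1 : K * X ^ (-ω) ≤ K * X ^ (ξ / 4 - ω) := by
      gcongr
      linarith
    have e2 : (1 + Real.log (8 * R)) / E ≤ D * X ^ (ξ / 4) * (K * X ^ (-ω)) := by
      rw [div_eq_mul_one_div]
      gcongr
    have e3 : D * X ^ (ξ / 4) * (K * X ^ (-ω)) = D * K * X ^ (ξ / 4 - ω) := by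
      rw [sub_eq_add_neg, Real.rpow_add hX0]
      ring
    rw [add_mul]
    linarith
  calc C * q * (B * R * H) ^ s2 * (H : ℝ) ^ (ξ / 4) * (1 / R + (1 + Real.log (8 * R)) / E)
      ≤ C * X ^ η * (B * R * H) ^ s2 * X ^ (ξ / 4) * ((K + D * K) * X ^ (ξ / 4 - ω)) := by
        have : 0 ≤ 1 / R + (1 + Real.log (8 * R)) / E := by
          have : 0 ≤ Real.log (8 * R) := Real.log_nonneg (by linarith)
          positivity
        gcongr
    _ = C * (K + D * K) * (B * R * H) ^ s2 * (X ^ η * X ^ (ξ / 4) * X ^ (ξ / 4 - ω)) := by ring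
    _ ≤ C * (K + D * K) * (B * R * H) ^ s2 * X ^ (-ρ * s2) := by
        rw [← Real.rpow_add hX0, ← Real.rpow_add hX0]
        gcongr
        have : ξ = ω - η - s2 * ρ := hξ
        linarith
    _ = C * (K + D * K) * (B * R * H * X ^ (-ρ)) ^ s2 := by
        rw [mul_pow _ (X ^ (-ρ)), ← Real.rpow_mul_natCast hX0.le]
        ring

/-- The block of integers with quotient `i` by `H`. -/
lemma sum_filter_div_eq {M : Type*} [AddCommMonoid M] {H i : ℕ} (hH : 1 ≤ H) (S : Finset ℕ)
    (hS : ∀ y < H, i * H + y ∈ S) (F : ℕ → M) :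
    ∑ n ∈ S with n / H = i, F n = ∑ y ∈ Finset.range H, F (i * H + y) := by
  symm
  refine Finset.sum_bij (fun y _ => i * H + y) ?_ ?_ ?_ (fun _ _ => rfl)
  · intro y hy
    rw [Finset.mem_range] at hy
    rw [Finset.mem_filter]
    refine ⟨hS y hy, ?_⟩
    rw [mul_comm, Nat.mul_add_div hH, Nat.div_eq_of_lt hy, add_zero]
  · intro y _ z _ h
    simpa using h
  · intro n hn
    rw [Finset.mem_filter] at hn
    refine ⟨n % H, Finset.mem_range.2 (Nat.mod_lt _ hH), ?_⟩
    rw [← hn.2, mul_comm]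
    exact Nat.div_add_mod n H

lemma card_filter_div_eq_le {H i : ℕ} (hH : 1 ≤ H) (S : Finset ℕ) :
    (S.filter fun n => n / H = i).card ≤ H := by
  have : (S.filter fun n => n / H = i) ⊆ (Finset.range H).image (fun y => i * H + y) := by
    intro n hn
    rw [Finset.mem_filter] at hn
    rw [Finset.mem_image]
    refine ⟨n % H, Finset.mem_range.2 (Nat.mod_lt _ hH), ?_⟩
    rw [← hn.2, mul_comm]
    exact Nat.div_add_mod n H
  calc _ ≤ _ := Finset.card_le_card this
    _ ≤ _ := Finset.card_image_le
    _ = H := Finset.card_range H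

/-- A sum over an interval is bounded by the sums over the blocks of length `H` it contains, up to
two incomplete blocks. -/
lemma norm_sum_le_sum_blocks {N X Y m H : ℕ} (hm : 1 ≤ m) (hH : 1 ≤ H) (hY : Y ≤ N)
    (F : ℕ → ℂ) {B : ℝ} (hB : ∀ n < N, ‖F n‖ ≤ B) (hB0 : 0 ≤ B) :
    ‖∑ n ∈ Finset.range N with X ≤ m * n ∧ m * n < Y, F n‖ ≤ 2 * H * B +
      ∑ i ∈ Finset.range N with X ≤ m * (i * H) ∧ m * (i * H + (H - 1)) < Y,
        ‖∑ y ∈ Finset.range H, F (i * H + y)‖ := by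
  set S : Finset ℕ := (Finset.range N).filter fun n => X ≤ m * n ∧ m * n < Y with hS
  set I : Finset ℕ := (Finset.range N).filter
    fun i => X ≤ m * (i * H) ∧ m * (i * H + (H - 1)) < Y with hI
  have hsplit : ∑ n ∈ S, F n = ∑ n ∈ S with n / H ∈ I, F n + ∑ n ∈ S with ¬ n / H ∈ I, F n :=
    (Finset.sum_filter_add_sum_filter_not S _ F).symm
  have hgood : ∑ n ∈ S with n / H ∈ I, F n =
      ∑ i ∈ I, ∑ y ∈ Finset.range H, F (i * H + y) := by
    rw [← Finset.sum_fiberwise_of_maps_to (s := S.filter fun n => n / H ∈ I) (t := I)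
      (g := fun n => n / H) (fun n hn => (Finset.mem_filter.1 hn).2)]
    refine Finset.sum_congr rfl fun i hi => ?_
    refine sum_filter_div_eq hH _ (fun y hy => ?_) F
    rw [Finset.mem_filter, hS, Finset.mem_filter, Finset.mem_range]
    rw [hI, Finset.mem_filter, Finset.mem_range] at hi
    have h1 : m * (i * H) ≤ m * (i * H + y) := Nat.mul_le_mul_left _ (by omega)
    have h2 : m * (i * H + y) ≤ m * (i * H + (H - 1)) := Nat.mul_le_mul_left _ (by omega)
    have h3 : i * H + y ≤ m * (i * H + y) := Nat.le_mul_of_pos_left _ hm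
    refine ⟨⟨by omega, by omega, by omega⟩, ?_⟩
    rw [show (i * H + y) / H = i by
      rw [mul_comm, Nat.mul_add_div hH, Nat.div_eq_of_lt hy, add_zero]]
    rw [hI, Finset.mem_filter, Finset.mem_range]
    exact hi
  have hbad : ‖∑ n ∈ S with ¬ n / H ∈ I, F n‖ ≤ 2 * H * B := by
    set n1 := (X + m - 1) / m with hn1
    set n2 := (Y - 1) / m with hn2
    have hsub : (S.filter fun n => ¬ n / H ∈ I) ⊆
        (S.filter fun n => n / H = n1 / H) ∪ (S.filter fun n => n / H = n2 / H) := by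
      intro n hn
      rw [Finset.mem_filter] at hn
      obtain ⟨hnS, hnI⟩ := hn
      have hnS' := hnS
      rw [hS, Finset.mem_filter, Finset.mem_range] at hnS'
      rw [Finset.mem_union]
      rw [hI, Finset.mem_filter, Finset.mem_range] at hnI
      have hlt : n / H < N := lt_of_le_of_lt (Nat.div_le_self _ _) hnS'.1
      have hdm := Nat.div_add_mod n H
      have hml := Nat.mod_lt n hH
      rw [mul_comm] at hdm
      by_cases hc : X ≤ m * (n / H * H)
      · right
        refine Finset.mem_filter.2 ⟨hnS, ?_⟩
        have hc2 : Y ≤ m * (n / H * H + (H - 1)) := by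
          by_contra hcon
          exact hnI ⟨hlt, hc, by omega⟩
        have ha : n ≤ n2 := by
          rw [hn2, Nat.le_div_iff_mul_le hm, mul_comm]
          omega
        have hb : n2 < n / H * H + H := by
          rw [hn2, Nat.div_lt_iff_lt_mul hm, mul_comm]
          have : m * (n / H * H + (H - 1)) ≤ m * (n / H * H + H) :=
            Nat.mul_le_mul_left _ (by omega)
          omega
        symm
        rw [Nat.div_eq_iff hH]
        omega
      · left
        refine Finset.mem_filter.2 ⟨hnS, ?_⟩
        have ha : n1 ≤ n := by
          rw [hn1, ← Nat.lt_add_one_iff, Nat.div_lt_iff_lt_mul hm]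
          have := hnS'.2.1
          rw [add_mul, mul_comm n m]
          omega
        have hb : n / H * H < n1 := by
          rw [hn1, ← Nat.add_one_le_iff, Nat.le_div_iff_mul_le hm, add_mul, mul_comm _ m]
          omega
        symm
        rw [Nat.div_eq_iff hH]
        omega
    have hcard : ((S.filter fun n => ¬ n / H ∈ I).card : ℝ) ≤ 2 * H := by
      have h1 := (Finset.card_le_card hsub).trans (Finset.card_union_le _ _)
      have h2 := card_filter_div_eq_le (i := n1 / H) hH S
      have h3 := card_filter_div_eq_le (i := n2 / H) hH S
      have : (S.filter fun n => ¬ n / H ∈ I).card ≤ 2 * H := by omega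
      exact_mod_cast this
    calc _ ≤ ∑ n ∈ S with ¬ n / H ∈ I, ‖F n‖ := norm_sum_le _ _
      _ ≤ ∑ n ∈ S with ¬ n / H ∈ I, B := by
        refine Finset.sum_le_sum fun n hn => hB n ?_
        exact Finset.mem_range.1 (Finset.mem_filter.1 (Finset.mem_filter.1 hn).1).1
      _ = ((S.filter fun n => ¬ n / H ∈ I).card : ℝ) * B := by simp
      _ ≤ _ := by gcongr
  rw [hsplit, hgood, add_comm]
  exact (norm_add_le _ _).trans (add_le_add hbad (norm_sum_le _ _))

/-- Taylor approximation of the phase on a block. -/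
lemma exists_block_taylor (α : ℝ) (k : ℕ) : ∃ C : ℝ, 0 ≤ C ∧ ∀ (H i m : ℕ) (h B : ℝ) (b : ℕ → ℂ),
    1 ≤ H → 2 ≤ i → 1 ≤ m → 0 ≤ h → 0 ≤ B → (∀ y < H, ‖b y‖ ≤ B) →
    ‖∑ y ∈ Finset.range H, b y * e (h * ((m * (i * H + y) : ℕ) : ℝ) ^ α)‖ ≤
      ‖∑ y ∈ Finset.Ico (0 : ℤ) H, b y.toNat * e (∑ j : Fin k,
        h * ((m * (i * H) : ℕ) : ℝ) ^ α * Ring.choose α (j.1 + 1) / (i * H : ℝ) ^ (j.1 + 1) *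
          (y : ℝ) ^ (j.1 + 1))‖ +
      C * (H * B * (h * ((m * (i * H) : ℕ) : ℝ) ^ α) / (i : ℝ) ^ (k + 1)) := by
  obtain ⟨C, hC, happ⟩ := exists_one_add_rpow_approx α (k + 1)
  refine ⟨2 * Real.pi * C, by positivity, ?_⟩
  intro H i m h B b hH hi hm hh hB hb
  set Z : ℝ := ((m * (i * H) : ℕ) : ℝ) ^ α with hZ
  have hZ0 : 0 ≤ Z := by positivity
  have hi0 : (0 : ℝ) < i := by exact_mod_cast (by omega : 0 < i)
  have hi2 : (2 : ℝ) ≤ i := by exact_mod_cast hi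
  have hH0 : (0 : ℝ) < H := by exact_mod_cast hH
  set p : ℕ → ℝ := fun y => ∑ j : Fin k, h * Z * Ring.choose α (j.1 + 1) /
    (i * H : ℝ) ^ (j.1 + 1) * (y : ℝ) ^ (j.1 + 1) with hp
  have hint : ∑ y ∈ Finset.Ico (0 : ℤ) H, b y.toNat * e (∑ j : Fin k,
        h * Z * Ring.choose α (j.1 + 1) / (i * H : ℝ) ^ (j.1 + 1) * (y : ℝ) ^ (j.1 + 1)) =
      ∑ y ∈ Finset.range H, b y * e (p y) := by
    rw [sum_Ico_int_eq_sum_range]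
    simp [hp]
  rw [hint]
  have hpt : ∀ y ∈ Finset.range H, ‖b y * e (h * ((m * (i * H + y) : ℕ) : ℝ) ^ α) -
      e (h * Z) * (b y * e (p y))‖ ≤ B * (2 * Real.pi * (h * Z * (C / (i : ℝ) ^ (k + 1)))) := by
    intro y hy
    rw [Finset.mem_range] at hy
    have hyH : (y : ℝ) ≤ H := by exact_mod_cast hy.le
    set u : ℝ := y / (i * H) with hu
    have hu0 : 0 ≤ u := by positivity
    have hui : u ≤ 1 / i := by
      rw [hu, div_le_div_iff₀ (by positivity) hi0]
      nlinarith
    have hu2 : u ≤ 1 / 2 := hui.trans (one_div_le_one_div_of_le (by norm_num) hi2)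
    have h1 := happ u hu0 hu2
    have hfac : ((m * (i * H + y) : ℕ) : ℝ) ^ α = Z * (1 + u) ^ α := by
      rw [hZ, ← Real.mul_rpow (by positivity) (by positivity)]
      congr 1
      rw [hu]
      push_cast
      field_simp
    have hpol : h * Z * ∑ j ∈ Finset.range (k + 1), Ring.choose α j * u ^ j = h * Z + p y := by
      rw [Finset.sum_range_succ', hp, mul_add, add_comm]
      simp only [Ring.choose_zero_right, pow_zero, mul_one]
      congr 1
      rw [Finset.mul_sum, ← Fin.sum_univ_eq_sum_range
        (fun j => h * Z * (Ring.choose α (j + 1) * u ^ (j + 1)))]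
      refine Finset.sum_congr rfl fun j _ => ?_
      rw [hu, div_pow]
      ring
    have heq : b y * e (h * ((m * (i * H + y) : ℕ) : ℝ) ^ α) - e (h * Z) * (b y * e (p y)) =
        b y * (e (h * Z * (1 + u) ^ α) - e (h * Z + p y)) := by
      rw [e_add, hfac, mul_assoc h]
      ring
    rw [heq, norm_mul]
    refine mul_le_mul (hb y hy) ?_ (norm_nonneg _) hB
    refine (norm_e_sub_e_le _ _).trans ?_
    rw [← hpol, ← mul_sub, abs_mul, abs_of_nonneg (by positivity : 0 ≤ h * Z)]
    have h2 : u ^ (k + 1) ≤ 1 / (i : ℝ) ^ (k + 1) := by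
      rw [← one_div_pow]
      gcongr
    have h3 : C * u ^ (k + 1) ≤ C / (i : ℝ) ^ (k + 1) := by
      rw [div_eq_mul_one_div]
      gcongr
    have := h1.trans h3
    gcongr
  have hdiff : ‖∑ y ∈ Finset.range H, b y * e (h * ((m * (i * H + y) : ℕ) : ℝ) ^ α) -
      e (h * Z) * ∑ y ∈ Finset.range H, b y * e (p y)‖ ≤
      H * (B * (2 * Real.pi * (h * Z * (C / (i : ℝ) ^ (k + 1))))) := by
    rw [Finset.mul_sum, ← Finset.sum_sub_distrib]
    refine (norm_sum_le _ _).trans ?_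
    refine (Finset.sum_le_sum hpt).trans ?_
    simp
  have h4 := norm_sub_norm_le (∑ y ∈ Finset.range H, b y * e (h * ((m * (i * H + y) : ℕ) : ℝ) ^ α))
    (e (h * Z) * ∑ y ∈ Finset.range H, b y * e (p y))
  rw [norm_mul, norm_e, one_mul] at h4
  have h5 : (H : ℝ) * (B * (2 * Real.pi * (h * Z * (C / (i : ℝ) ^ (k + 1))))) =
      2 * Real.pi * C * (H * B * (h * Z) / (i : ℝ) ^ (k + 1)) := by ring
  linarith

/-- The restrictions on the exponents in the bilinear estimates. -/
structure AdmissibleExponents {k : ℕ} (j₀ : Fin k) (α γ ω η ρ τ : ℝ) : Prop where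
  two_le : 2 ≤ k
  pos : 0 < α
  ne_nat : ∀ n : ℕ, α ≠ n
  gamma_pos : 0 < γ
  gamma_lt : γ < 1 / 2
  saving : 0 < ω - η - (2 * (k + k * k) : ℕ) * ρ
  omega_le_gamma : ω ≤ γ
  omega_le : ω ≤ α - γ * (j₀.1 + 1)
  taylor : τ + α - γ * (k + 1) ≤ -ρ
  small : τ + α - (j₀.1 + 1) / 2 < 0
  rho_le : ρ ≤ γ

/-- The phase `e(h n^α)` restricted to a residue class. -/
noncomputable def apPhase (α : ℝ) (h q a n : ℕ) : ℂ :=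
  if n % q = a then e (h * (n : ℝ) ^ α) else 0

/-- The sum over the cofactors of `m` of the restricted phase with weight `g`. -/
noncomputable def rowSum (α : ℝ) (h q a X Y : ℕ) (g : ℕ → ℂ) (m : ℕ) : ℂ :=
  ∑ n ∈ Finset.range (2 * X) with X ≤ m * n ∧ m * n < Y, g n * apPhase α h q a (m * n)

/-- The indices of the blocks of length `H` whose `m`-multiples lie in `[X, Y)`. -/
def blockIndices (X Y H m : ℕ) : Finset ℕ :=
  (Finset.range (2 * X)).filter fun i => X ≤ m * (i * H) ∧ m * (i * H + (H - 1)) < Y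

/-- The Taylor coefficients of `y ↦ h (m (n + y)) ^ α`. -/
noncomputable def phaseCoeff (α : ℝ) (h m n j : ℕ) : ℝ :=
  h * ((m * n : ℕ) : ℝ) ^ α * Ring.choose α (j + 1) / (n : ℝ) ^ (j + 1)

lemma blockIndices_bounds {X Y H m P i : ℕ} {γ : ℝ} (hX : 1 ≤ X) (hY : Y ≤ 2 * X)
    (hPH1 : (P : ℝ) * H ≤ (X : ℝ) ^ (1 - γ)) (hPH2 : (X : ℝ) ^ (1 - γ) ≤ 2 * (P * H))
    (hm1 : P ≤ m) (hm2 : m < 2 * P) (hi : i ∈ blockIndices X Y H m) :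
    (X : ℝ) ^ γ / 2 ≤ i ∧ (i : ℝ) ≤ 4 * (X : ℝ) ^ γ ∧ X ≤ m * (i * H) ∧ m * (i * H) < 2 * X := by
  rw [blockIndices, Finset.mem_filter] at hi
  obtain ⟨-, h1, h2⟩ := hi
  have h3 : m * (i * H) < 2 * X :=
    lt_of_le_of_lt (Nat.mul_le_mul_left _ (by omega)) (lt_of_lt_of_le h2 hY)
  have hX0 : (0 : ℝ) < X := by exact_mod_cast hX
  have hXX : (X : ℝ) ^ γ * (X : ℝ) ^ (1 - γ) = X := by
    rw [← Real.rpow_add hX0]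
    simp
  have hp : (0 : ℝ) < (X : ℝ) ^ (1 - γ) := by positivity
  have h1' : (X : ℝ) ≤ m * (i * H) := by exact_mod_cast h1
  have h3' : (m : ℝ) * (i * H) ≤ 2 * X := by exact_mod_cast h3.le
  have hm1' : (P : ℝ) ≤ m := by exact_mod_cast hm1
  have hm2' : (m : ℝ) ≤ 2 * P := by exact_mod_cast hm2.le
  refine ⟨?_, ?_, h1, h3⟩
  · have : (X : ℝ) ≤ 2 * i * (X : ℝ) ^ (1 - γ) := by
      calc (X : ℝ) ≤ m * (i * H) := h1'
        _ ≤ 2 * P * (i * H) := by gcongr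
        _ = 2 * i * (P * H) := by ring
        _ ≤ _ := by gcongr
    nlinarith
  · have : i * (X : ℝ) ^ (1 - γ) ≤ 4 * X := by
      calc i * (X : ℝ) ^ (1 - γ) ≤ i * (2 * (P * H)) := by gcongr
        _ = 2 * (P * (i * H)) := by ring
        _ ≤ 2 * (m * (i * H)) := by gcongr
        _ ≤ _ := by linarith
    nlinarith

lemma card_le_of_pos_le {S : Finset ℕ} {Z : ℝ} (hZ : 0 ≤ Z)
    (h : ∀ i ∈ S, 1 ≤ i ∧ (i : ℝ) ≤ Z) : (S.card : ℝ) ≤ Z := by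
  have : S ⊆ Finset.Icc 1 ⌊Z⌋₊ := by
    intro i hi
    rw [Finset.mem_Icc]
    exact ⟨(h i hi).1, Nat.le_floor (h i hi).2⟩
  have := Finset.card_le_card this
  rw [Nat.card_Icc, Nat.add_sub_cancel] at this
  exact (Nat.cast_le.2 this).trans (Nat.floor_le hZ)

/-- Reduction of the rows to short polynomial exponential sums. -/
lemma exists_sum_norm_rowSum_le_blocks {k : ℕ} {j₀ : Fin k} {α γ ω η ρ τ : ℝ}
    (hadm : AdmissibleExponents j₀ α γ ω η ρ τ) :
    ∃ C : ℝ, 0 ≤ C ∧ ∀ (X Y h q a P H : ℕ) (g : ℕ → ℂ) (B : ℝ), 1 ≤ X → Y ≤ 2 * X →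
      (4 : ℝ) ≤ (X : ℝ) ^ γ → (h : ℝ) ≤ (X : ℝ) ^ τ → 1 ≤ P → 1 ≤ H →
      (P : ℝ) * H ≤ (X : ℝ) ^ (1 - γ) → (X : ℝ) ^ (1 - γ) ≤ 2 * (P * H) →
      0 ≤ B → (∀ n, ‖g n‖ ≤ B) →
      (∑ m ∈ Finset.Ico P (2 * P), ‖rowSum α h q a X Y g m‖) ≤ C * (B * (X : ℝ) ^ (1 - ρ)) +
        ∑ m ∈ Finset.Ico P (2 * P), ∑ i ∈ blockIndices X Y H m,
          ‖∑ y ∈ Finset.Ico (0 : ℤ) H,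
            (if m * (i * H + y.toNat) % q = a then g (i * H + y.toNat) else 0) *
              e (∑ j : Fin k, phaseCoeff α h m (i * H) j * (y : ℝ) ^ (j.1 + 1))‖ := by
  obtain ⟨C, hC, hT⟩ := exists_block_taylor α k
  refine ⟨2 + 4 * C * 2 ^ α * 2 ^ (k + 1), by positivity, ?_⟩
  intro X Y h q a P H g B hX hY hXγ hh hP hH hPH1 hPH2 hB hg
  have hX0 : (0 : ℝ) < X := by exact_mod_cast hX
  have hX1 : (1 : ℝ) ≤ X := by exact_mod_cast hX
  set Er : ℝ := C * (H * B * ((X : ℝ) ^ τ * (2 * X) ^ α) / ((X : ℝ) ^ γ / 2) ^ (k + 1)) with hEr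
  have hEr0 : 0 ≤ Er := by positivity
  have hrow : ∀ m ∈ Finset.Ico P (2 * P), ‖rowSum α h q a X Y g m‖ ≤
      (2 * H * B + 4 * (X : ℝ) ^ γ * Er) + ∑ i ∈ blockIndices X Y H m,
          ‖∑ y ∈ Finset.Ico (0 : ℤ) H,
            (if m * (i * H + y.toNat) % q = a then g (i * H + y.toNat) else 0) *
              e (∑ j : Fin k, phaseCoeff α h m (i * H) j * (y : ℝ) ^ (j.1 + 1))‖ := by
    intro m hm
    rw [Finset.mem_Ico] at hm
    have hm1 : 1 ≤ m := by omega
    have hbd := fun i => blockIndices_bounds (i := i) hX hY hPH1 hPH2 hm.1 hm.2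
    have h1 := norm_sum_le_sum_blocks (X := X) hm1 hH hY
      (fun n => g n * apPhase α h q a (m * n)) (B := B) (by
        intro n _
        rw [norm_mul]
        have : ‖apPhase α h q a (m * n)‖ ≤ 1 := by
          rw [apPhase]
          split_ifs
          · rw [norm_e]
          · simp
        calc _ ≤ B * 1 := mul_le_mul (hg n) this (norm_nonneg _) hB
          _ = B := mul_one B) hB
    have h2 : ∀ i ∈ blockIndices X Y H m,
        ‖∑ y ∈ Finset.range H, g (i * H + y) * apPhase α h q a (m * (i * H + y))‖ ≤
        ‖∑ y ∈ Finset.Ico (0 : ℤ) H,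
            (if m * (i * H + y.toNat) % q = a then g (i * H + y.toNat) else 0) *
              e (∑ j : Fin k, phaseCoeff α h m (i * H) j * (y : ℝ) ^ (j.1 + 1))‖ + Er := by
      intro i hi
      obtain ⟨b1, b2, b3, b4⟩ := hbd i hi
      have hi2 : 2 ≤ i := by
        have : (2 : ℝ) ≤ i := by linarith
        exact_mod_cast this
      have h3 := hT H i m h B
        (fun y => if m * (i * H + y) % q = a then g (i * H + y) else 0) hH hi2 hm1
        (by positivity) hB (by
          intro y _
          split_ifs
          · exact hg _
          · simpa using hB)
      have e1 : ∑ y ∈ Finset.range H, g (i * H + y) * apPhase α h q a (m * (i * H + y)) =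
          ∑ y ∈ Finset.range H, (if m * (i * H + y) % q = a then g (i * H + y) else 0) *
            e (h * ((m * (i * H + y) : ℕ) : ℝ) ^ α) := by
        refine Finset.sum_congr rfl fun y _ => ?_
        rw [apPhase]
        split_ifs <;> simp
      rw [e1]
      refine h3.trans (add_le_add (le_of_eq ?_) ?_)
      · simp only [phaseCoeff, Nat.cast_mul]
      · rw [hEr]
        have b4' : ((m * (i * H) : ℕ) : ℝ) ≤ 2 * X := by exact_mod_cast b4.le
        have hα := hadm.pos
        gcongr
    have hcard : ((blockIndices X Y H m).card : ℝ) ≤ 4 * (X : ℝ) ^ γ := by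
      refine card_le_of_pos_le (by positivity) fun i hi => ?_
      obtain ⟨b1, b2, -⟩ := hbd i hi
      refine ⟨?_, b2⟩
      have : (1 : ℝ) ≤ i := by linarith
      exact_mod_cast this
    calc ‖rowSum α h q a X Y g m‖ ≤ _ := h1
      _ ≤ 2 * H * B + ∑ i ∈ blockIndices X Y H m, (‖∑ y ∈ Finset.Ico (0 : ℤ) H,
            (if m * (i * H + y.toNat) % q = a then g (i * H + y.toNat) else 0) *
              e (∑ j : Fin k, phaseCoeff α h m (i * H) j * (y : ℝ) ^ (j.1 + 1))‖ + Er) := by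
        gcongr
        exact Finset.sum_le_sum h2
      _ ≤ _ := by
        rw [Finset.sum_add_distrib, Finset.sum_const, nsmul_eq_mul]
        have := mul_le_mul_of_nonneg_right hcard hEr0
        linarith
  refine (Finset.sum_le_sum hrow).trans ?_
  rw [Finset.sum_add_distrib]
  gcongr
  rw [Finset.sum_const, Nat.card_Ico, nsmul_eq_mul, show 2 * P - P = P by omega]
  have hρ := hadm.rho_le
  have ht := hadm.taylor
  have e1 : (P : ℝ) * (2 * H * B) ≤ 2 * (B * (X : ℝ) ^ (1 - ρ)) := by
    calc (P : ℝ) * (2 * H * B) = 2 * (B * (P * H)) := by ring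
      _ ≤ 2 * (B * (X : ℝ) ^ (1 - ρ)) := by
        gcongr
        refine hPH1.trans ?_
        gcongr
  have e2 : (P : ℝ) * (4 * (X : ℝ) ^ γ * Er) ≤
      4 * C * 2 ^ α * 2 ^ (k + 1) * (B * (X : ℝ) ^ (1 - ρ)) := by
    have e3 : ((X : ℝ) ^ γ / 2) ^ (k + 1) = (X : ℝ) ^ (γ * (k + 1)) / 2 ^ (k + 1) := by
      rw [div_pow, ← Real.rpow_mul_natCast hX0.le]
      push_cast
      rfl
    calc (P : ℝ) * (4 * (X : ℝ) ^ γ * Er)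
        = 4 * C * 2 ^ α * 2 ^ (k + 1) * (B * (P * H) * ((X : ℝ) ^ γ * (X : ℝ) ^ τ *
            (X : ℝ) ^ α * ((X : ℝ) ^ (γ * (k + 1)))⁻¹)) := by
          rw [hEr, e3, Real.mul_rpow (by norm_num) hX0.le]
          field_simp
      _ ≤ 4 * C * 2 ^ α * 2 ^ (k + 1) * (B * (X : ℝ) ^ (1 - γ) * ((X : ℝ) ^ γ * (X : ℝ) ^ τ *
            (X : ℝ) ^ α * ((X : ℝ) ^ (γ * (k + 1)))⁻¹)) := by gcongr
      _ = 4 * C * 2 ^ α * 2 ^ (k + 1) * (B * (X : ℝ) ^ (1 + (τ + α - γ * (k + 1)))) := by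
          rw [← Real.rpow_neg hX0.le, ← Real.rpow_add hX0, ← Real.rpow_add hX0,
            ← Real.rpow_add hX0, mul_assoc B, ← Real.rpow_add hX0]
          ring_nf
      _ ≤ _ := by
          gcongr
          linarith
  linarith

/-- The size conditions on `X` in the bilinear estimates hold for all large `X`. -/
lemma exists_large_conditions {k : ℕ} {j₀ : Fin k} {α γ ω η ρ τ : ℝ}
    (hadm : AdmissibleExponents j₀ α γ ω η ρ τ) (M : ℝ) :
    ∃ X₀ : ℝ, 1 ≤ X₀ ∧ ∀ X : ℝ, X₀ ≤ X → 4 ≤ X ^ γ ∧ 4 ≤ X ^ (1 / 2 - γ) ∧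
      M * X ^ (τ + α - (j₀.1 + 1) / 2) ≤ 1 / 4 := by
  have h1 := (tendsto_rpow_atTop hadm.gamma_pos).eventually_ge_atTop 4
  have h2 := (tendsto_rpow_atTop (sub_pos.2 hadm.gamma_lt)).eventually_ge_atTop 4
  have h3 := (tendsto_rpow_neg_atTop (y := -(τ + α - (j₀.1 + 1) / 2))
    (by linarith [hadm.small])).const_mul M
  rw [mul_zero, neg_neg] at h3
  have h4 := h3.eventually_le_const (show (0 : ℝ) < 1 / 4 by norm_num)
  obtain ⟨X₀, hX₀⟩ := Filter.eventually_atTop.1 (h1.and (h2.and h4))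
  exact ⟨max 1 X₀, le_max_left _ _, fun X hX => hX₀ X ((le_max_right _ _).trans hX)⟩

lemma exists_block_length {X P : ℕ} {γ : ℝ} (hX : 1 ≤ X) (hP : 1 ≤ P)
    (h4 : 4 ≤ (X : ℝ) ^ (1 / 2 - γ)) (hPX : (P : ℝ) ≤ 4 * (X : ℝ) ^ (1 / 2 : ℝ)) :
    ∃ H : ℕ, 1 ≤ H ∧ (P : ℝ) * H ≤ (X : ℝ) ^ (1 - γ) ∧ (X : ℝ) ^ (1 - γ) ≤ 2 * (P * H) := by
  have hX0 : (0 : ℝ) < X := by exact_mod_cast hX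
  have hP0 : (0 : ℝ) < P := by exact_mod_cast hP
  have h1 : (P : ℝ) ≤ (X : ℝ) ^ (1 - γ) := by
    calc (P : ℝ) ≤ 4 * (X : ℝ) ^ (1 / 2 : ℝ) := hPX
      _ ≤ (X : ℝ) ^ (1 / 2 - γ) * (X : ℝ) ^ (1 / 2 : ℝ) := by gcongr
      _ = _ := by
        rw [← Real.rpow_add hX0]
        ring_nf
  have h2 : 1 ≤ (X : ℝ) ^ (1 - γ) / P := by rwa [le_div_iff₀ hP0, one_mul]
  have h3 : 1 ≤ ⌊(X : ℝ) ^ (1 - γ) / P⌋₊ := Nat.le_floor (by simpa using h2)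
  refine ⟨⌊(X : ℝ) ^ (1 - γ) / P⌋₊, h3, ?_, ?_⟩
  · have := Nat.floor_le (show 0 ≤ (X : ℝ) ^ (1 - γ) / P by positivity)
    rw [le_div_iff₀ hP0] at this
    linarith
  · have h5 := Nat.lt_floor_add_one ((X : ℝ) ^ (1 - γ) / P)
    have h6 : (1 : ℝ) ≤ (⌊(X : ℝ) ^ (1 - γ) / P⌋₊ : ℝ) := by exact_mod_cast h3
    rw [div_lt_iff₀ hP0] at h5
    nlinarith

/-- The leading coefficient of the phase is small. -/
lemma phase_size_le {X h p : ℕ} {α τ c Z N : ℝ} (hα : 0 < α) (hX : 1 ≤ X)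
    (hh : (h : ℝ) ≤ (X : ℝ) ^ τ) (hZ0 : 0 ≤ Z) (hZ : Z ≤ 2 * X)
    (hN : (X : ℝ) ^ (1 / 2 : ℝ) ≤ 32 * N) (hc : 0 ≤ c) :
    h * c * Z ^ α / N ^ p ≤ c * 2 ^ α * 32 ^ p * (X : ℝ) ^ (τ + α - p / 2) := by
  have hX0 : (0 : ℝ) < X := by exact_mod_cast hX
  have hN0 : 0 < N := by
    have : 0 < (X : ℝ) ^ (1 / 2 : ℝ) := by positivity
    linarith
  have h1 : (X : ℝ) ^ ((p : ℝ) / 2) ≤ 32 ^ p * N ^ p := by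
    rw [← mul_pow, show (p : ℝ) / 2 = 1 / 2 * p by ring, Real.rpow_mul_natCast hX0.le]
    gcongr
  have h2 : (X : ℝ) ^ (τ + α - p / 2) = (X : ℝ) ^ τ * (X : ℝ) ^ α / (X : ℝ) ^ ((p : ℝ) / 2) := by
    rw [Real.rpow_sub hX0, Real.rpow_add hX0]
  rw [h2, div_le_iff₀ (by positivity)]
  have h3 : Z ^ α ≤ 2 ^ α * (X : ℝ) ^ α := by
    rw [← Real.mul_rpow (by norm_num) hX0.le]
    gcongr
  calc h * c * Z ^ α ≤ (X : ℝ) ^ τ * c * (2 ^ α * (X : ℝ) ^ α) := by gcongr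
    _ = c * 2 ^ α * ((X : ℝ) ^ τ * (X : ℝ) ^ α) * 1 := by ring
    _ ≤ c * 2 ^ α * ((X : ℝ) ^ τ * (X : ℝ) ^ α) *
        (32 ^ p * N ^ p / (X : ℝ) ^ ((p : ℝ) / 2)) := by
      gcongr
      rwa [le_div_iff₀ (by positivity), one_mul]
    _ = _ := by
      field_simp

/-- The leading coefficient of the phase is not too small. -/
lemma le_phase_size {X h p : ℕ} {α ω γ c Z i : ℝ} (hα : 0 < α) (hX : 1 ≤ X) (hh : 1 ≤ h)
    (hZ : (X : ℝ) ≤ 4 * Z) (hi0 : 0 < i) (hi : i ≤ 4 * (X : ℝ) ^ γ) (hc : 0 < c)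
    (hω : ω ≤ α - γ * p) :
    (X : ℝ) ^ ω ≤ c⁻¹ * 4 ^ α * 4 ^ p * (h * c * Z ^ α / i ^ p) := by
  have hX0 : (0 : ℝ) < X := by exact_mod_cast hX
  have hX1 : (1 : ℝ) ≤ X := by exact_mod_cast hX
  have hZ0 : 0 < Z := by linarith
  have hh1 : (1 : ℝ) ≤ h := by exact_mod_cast hh
  have h1 : (X : ℝ) ^ α ≤ 4 ^ α * Z ^ α := by
    rw [← Real.mul_rpow (by norm_num) hZ0.le]
    gcongr
  have h2 : i ^ p ≤ 4 ^ p * (X : ℝ) ^ (γ * p) := by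
    rw [Real.rpow_mul_natCast hX0.le, ← mul_pow]
    gcongr
  have h3 : (X : ℝ) ^ ω ≤ (X : ℝ) ^ α / (X : ℝ) ^ (γ * p) := by
    rw [← Real.rpow_sub hX0]
    gcongr
  refine h3.trans ?_
  rw [div_le_iff₀ (by positivity)]
  calc (X : ℝ) ^ α ≤ 4 ^ α * Z ^ α := h1
    _ = 1 * (4 ^ α * Z ^ α) * 1 := by ring
    _ ≤ h * (4 ^ α * Z ^ α) * (4 ^ p * (X : ℝ) ^ (γ * p) / i ^ p) := by
      gcongr
      rwa [le_div_iff₀ (by positivity), one_mul]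
    _ = _ := by field_simp

set_option maxHeartbeats 800000 in
/-- The bilinear estimate with no smoothness, for long sums over the outer variable. -/
theorem exists_sum_norm_rowSum_le_of_large {k : ℕ} {j₀ : Fin k} {α γ ω η ρ τ : ℝ}
    (hadm : AdmissibleExponents j₀ α γ ω η ρ τ) {K : ℝ} (hK : 0 ≤ K) :
    ∃ C X₀ : ℝ, 0 ≤ C ∧ 1 ≤ X₀ ∧ ∀ (X Y h q a P : ℕ) (g : ℕ → ℂ) (B : ℝ), X₀ ≤ X → Y ≤ 2 * X →
      1 ≤ h → (h : ℝ) ≤ (X : ℝ) ^ τ → 1 ≤ q → (q : ℝ) ≤ (X : ℝ) ^ η → 1 ≤ P →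
      (P : ℝ) ≤ 4 * (X : ℝ) ^ (1 / 2 : ℝ) → (X : ℝ) ^ ω ≤ K * P → 0 ≤ B → (∀ n, ‖g n‖ ≤ B) →
      (∑ m ∈ Finset.Ico P (2 * P), ‖rowSum α h q a X Y g m‖) ≤ C * (B * (X : ℝ) ^ (1 - ρ)) := by
  have hα := hadm.pos
  have hch : Ring.choose α (j₀.1 + 1) ≠ 0 := ring_choose_ne_zero hadm.ne_nat _
  set ch : ℝ := |Ring.choose α (j₀.1 + 1)| with hch_def
  have hch0 : 0 < ch := abs_pos.2 hch
  set K' : ℝ := max K (ch⁻¹ * 4 ^ α * 4 ^ (j₀.1 + 1)) with hK'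
  have hK'0 : 0 ≤ K' := hK.trans (le_max_left _ _)
  obtain ⟨C₁, hC₁, hred⟩ := exists_sum_norm_rowSum_le_blocks hadm
  obtain ⟨C₂, hC₂, hfam⟩ := exists_weyl_family_le (ω := ω) (η := η) (ρ := ρ) (β := α) hadm.two_le j₀
    hα.ne' hK'0 hadm.saving
  obtain ⟨X₀, hX₀, hlarge⟩ := exists_large_conditions hadm
    (8 ^ |α| * (ch * 2 ^ α * 32 ^ (j₀.1 + 1)))
  refine ⟨C₁ + 4 * C₂, X₀, by positivity, hX₀, ?_⟩
  intro X Y h q a P g B hX hY hh1 hh hq hqX hP hPX hPω hB hg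
  have hX1 : (1 : ℝ) ≤ X := hX₀.trans hX
  have hXn : 1 ≤ X := by exact_mod_cast hX1
  have hX0 : (0 : ℝ) < X := by linarith
  have hP0 : (0 : ℝ) < P := by exact_mod_cast hP
  have hP1 : (1 : ℝ) ≤ P := by exact_mod_cast hP
  have hh0 : (1 : ℝ) ≤ h := by exact_mod_cast hh1
  obtain ⟨l1, l2, l3⟩ := hlarge X hX
  obtain ⟨H, hH, hPH1, hPH2⟩ := exists_block_length hXn hP l2 hPX
  have hH1 : (1 : ℝ) ≤ H := by exact_mod_cast hH
  have hXX : (X : ℝ) ^ γ * (X : ℝ) ^ (1 - γ) = X := by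
    rw [← Real.rpow_add hX0]
    simp
  have hXγ : (X : ℝ) ^ (1 - γ) ≤ X := by nlinarith [Real.rpow_pos_of_pos hX0 (1 - γ)]
  have hPleX : (P : ℝ) ≤ X := by nlinarith
  have hHleX : (H : ℝ) ≤ X := by nlinarith
  refine (hred X Y h q a P H g B hXn hY l1 hh hP hH hPH1 hPH2 hB hg).trans ?_
  set J : Finset ℕ := (Finset.range (2 * X)).filter fun i => 1 ≤ i ∧ (i : ℝ) ≤ 4 * (X : ℝ) ^ γ ∧
    X ≤ 2 * (P * (i * H)) ∧ P * (i * H) ≤ 2 * X with hJ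
  rw [Finset.sum_comm' (s' := fun i => (Finset.Ico P (2 * P)).filter
    fun m => i ∈ blockIndices X Y H m) (t' := J)]
  swap
  · intro m i
    rw [Finset.mem_filter]
    constructor
    · rintro ⟨hm, hi⟩
      refine ⟨⟨hm, hi⟩, ?_⟩
      rw [Finset.mem_Ico] at hm
      obtain ⟨b1, b2, b3, b4⟩ := blockIndices_bounds hXn hY hPH1 hPH2 hm.1 hm.2 hi
      rw [hJ, Finset.mem_filter]
      rw [blockIndices, Finset.mem_filter] at hi
      have h5 : P * (i * H) ≤ m * (i * H) := Nat.mul_le_mul_right _ hm.1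
      have h6 : m * (i * H) ≤ 2 * P * (i * H) := Nat.mul_le_mul_right _ hm.2.le
      refine ⟨hi.1, ?_, b2, by rw [← mul_assoc]; omega, by omega⟩
      have : (1 : ℝ) ≤ i := by linarith
      exact_mod_cast this
    · rintro ⟨⟨hm, hi⟩, -⟩
      exact ⟨hm, hi⟩
  have hJcard : (J.card : ℝ) ≤ 4 * (X : ℝ) ^ γ := by
    refine card_le_of_pos_le (by positivity) fun i hi => ?_
    rw [hJ, Finset.mem_filter] at hi
    exact ⟨hi.2.1, hi.2.2.1⟩
  have hinner : ∀ i ∈ J, ∑ m ∈ Finset.Ico P (2 * P) with i ∈ blockIndices X Y H m,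
      ‖∑ y ∈ Finset.Ico (0 : ℤ) H,
        (if m * (i * H + y.toNat) % q = a then g (i * H + y.toNat) else 0) *
          e (∑ j : Fin k, phaseCoeff α h m (i * H) j * (y : ℝ) ^ (j.1 + 1))‖ ≤
      C₂ * (B * P * H * (X : ℝ) ^ (-ρ)) := by
    intro i hi
    rw [hJ, Finset.mem_filter] at hi
    obtain ⟨-, hi1, hi2, hi3, hi4⟩ := hi
    have hi0 : (1 : ℝ) ≤ i := by exact_mod_cast hi1
    have hi3' : (X : ℝ) ≤ 2 * (P * (i * H)) := by exact_mod_cast hi3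
    have hi4' : (P : ℝ) * (i * H) ≤ 2 * X := by exact_mod_cast hi4
    set A : ℝ := h * (i * H : ℝ) ^ α * Ring.choose α (j₀.1 + 1) / (i * H : ℝ) ^ (j₀.1 + 1) with hA
    have hAP : |A| * (P : ℝ) ^ α =
        h * ch * ((P : ℝ) * (i * H)) ^ α / ((i * H : ℕ) : ℝ) ^ (j₀.1 + 1) := by
      rw [Real.mul_rpow hP0.le (by positivity), hA, abs_div, abs_mul, abs_of_nonneg
        (show (0 : ℝ) ≤ h * (i * H : ℝ) ^ α by positivity), abs_of_nonneg
        (show (0 : ℝ) ≤ (i * H : ℝ) ^ (j₀.1 + 1) by positivity)]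
      push_cast
      ring
    have h := hfam H q ((Finset.Ico P (2 * P)).filter fun m => i ∈ blockIndices X Y H m) X P B A
      (fun m j => phaseCoeff α h m (i * H) j)
      (fun r y => if r * (i * H + y.toNat) % q = a then g (i * H + y.toNat) else 0)
      hX1 hH hHleX hq hqX hP1 hPleX (by
        intro t ht
        rw [Finset.mem_filter, Finset.mem_Ico] at ht
        have h5 : (P : ℝ) ≤ t := by exact_mod_cast ht.1.1
        have h6 : (t : ℝ) ≤ 2 * P := by exact_mod_cast ht.1.2.le
        exact ⟨h5, by linarith⟩) hB (by
        intro r y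
        split_ifs
        · exact hg _
        · simpa using hB) (by
        rw [hA]
        have : (0 : ℝ) < (i * H : ℝ) := by positivity
        positivity) (by
        intro t _
        simp only [phaseCoeff]
        rw [hA]
        push_cast
        rw [Real.mul_rpow (by positivity) (by positivity)]
        ring) (by
        rw [mul_left_comm, hAP]
        have h5 : (X : ℝ) ^ (1 / 2 : ℝ) ≤ 32 * ((i * H : ℕ) : ℝ) := by
          have h6 : (X : ℝ) ^ (1 / 2 : ℝ) * (X : ℝ) ^ (1 / 2 : ℝ) = X := by
            rw [← Real.rpow_add hX0]
            norm_num
          have h7 : 0 < (X : ℝ) ^ (1 / 2 : ℝ) := by positivity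
          have h8 : (P : ℝ) * (i * H) ≤ 4 * (X : ℝ) ^ (1 / 2 : ℝ) * (i * H) := by gcongr
          push_cast
          nlinarith
        have h9 := phase_size_le (p := j₀.1 + 1) hα hXn hh
          (show (0 : ℝ) ≤ (P : ℝ) * (i * H) by positivity) hi4' h5 hch0.le
        push_cast at h9 ⊢
        refine le_trans (mul_le_mul_of_nonneg_left h9 (by positivity)) ?_
        linarith) (hPω.trans (by gcongr; exact le_max_left _ _)) (by
        rw [hAP]
        have h9 := le_phase_size (p := j₀.1 + 1) (Z := (P : ℝ) * (i * H)) (i := i) hα hXn hh1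
          (by linarith) (by linarith) hi2 hch0 (by push_cast; exact hadm.omega_le)
        refine h9.trans ?_
        have h10 : h * ch * ((P : ℝ) * (i * H)) ^ α / ((i * H : ℕ) : ℝ) ^ (j₀.1 + 1) *
            (H : ℝ) ^ (j₀.1 + 1) = h * ch * ((P : ℝ) * (i * H)) ^ α / (i : ℝ) ^ (j₀.1 + 1) := by
          push_cast
          rw [mul_pow]
          field_simp
        rw [h10]
        gcongr
        exact le_max_right _ _)
    refine le_of_eq_of_le (Finset.sum_congr rfl fun m _ => ?_) h
    congr 1
    refine Finset.sum_congr rfl fun y _ => ?_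
    rw [show m % q * (i * H + y.toNat) % q = m * (i * H + y.toNat) % q by
      rw [Nat.mul_mod, Nat.mod_mod, ← Nat.mul_mod]]
  have hfin : ∑ i ∈ J, C₂ * (B * P * H * (X : ℝ) ^ (-ρ)) ≤ 4 * C₂ * (B * (X : ℝ) ^ (1 - ρ)) := by
    rw [Finset.sum_const, nsmul_eq_mul]
    calc (J.card : ℝ) * (C₂ * (B * P * H * (X : ℝ) ^ (-ρ)))
        ≤ 4 * (X : ℝ) ^ γ * (C₂ * (B * P * H * (X : ℝ) ^ (-ρ))) := by gcongr
      _ = 4 * C₂ * (B * ((X : ℝ) ^ γ * (P * H) * (X : ℝ) ^ (-ρ))) := by ring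
      _ ≤ 4 * C₂ * (B * ((X : ℝ) ^ γ * (X : ℝ) ^ (1 - γ) * (X : ℝ) ^ (-ρ))) := by gcongr
      _ = _ := by
        rw [hXX, sub_eq_add_neg, Real.rpow_add hX0, Real.rpow_one]
  have := (Finset.sum_le_sum hinner).trans hfin
  linarith

set_option maxHeartbeats 800000 in
/-- The bilinear estimate for slowly varying weights in the inner variable. -/
theorem exists_sum_norm_rowSum_le_of_smooth {k : ℕ} {j₀ : Fin k} {α γ ω η ρ τ : ℝ}
    (hadm : AdmissibleExponents j₀ α γ ω η ρ τ) :
    ∃ C X₀ : ℝ, 0 ≤ C ∧ 1 ≤ X₀ ∧ ∀ (X Y h q a P : ℕ) (g : ℕ → ℂ) (B : ℝ), X₀ ≤ X → Y ≤ 2 * X →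
      1 ≤ h → (h : ℝ) ≤ (X : ℝ) ^ τ → 1 ≤ q → (q : ℝ) ≤ (X : ℝ) ^ η → 1 ≤ P →
      (P : ℝ) ≤ 4 * (X : ℝ) ^ (1 / 2 : ℝ) → 1 ≤ B → (∀ n, ‖g n‖ ≤ B) →
      (∀ n y : ℕ, 1 ≤ n → ‖g (n + y) - g n‖ ≤ y / n) →
      (∑ m ∈ Finset.Ico P (2 * P), ‖rowSum α h q a X Y g m‖) ≤ C * (B * (X : ℝ) ^ (1 - ρ)) := by
  have hα := hadm.pos
  have hch : Ring.choose α (j₀.1 + 1) ≠ 0 := ring_choose_ne_zero hadm.ne_nat _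
  set ch : ℝ := |Ring.choose α (j₀.1 + 1)| with hch_def
  have hch0 : 0 < ch := abs_pos.2 hch
  set K' : ℝ := max 2 (ch⁻¹ * 4 ^ α * 4 ^ (j₀.1 + 1)) with hK'
  have hK'0 : 0 ≤ K' := le_trans (by norm_num) (le_max_left _ _)
  set β : ℝ := α - (j₀.1 + 1 : ℕ) with hβ
  obtain ⟨C₁, hC₁, hred⟩ := exists_sum_norm_rowSum_le_blocks hadm
  obtain ⟨C₂, hC₂, hfam⟩ := exists_weyl_family_le (ω := ω) (η := η) (ρ := ρ) (β := β) hadm.two_le j₀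
    (sub_ne_zero.2 (hadm.ne_nat _)) hK'0 hadm.saving
  obtain ⟨X₀, hX₀, hlarge⟩ := exists_large_conditions hadm
    (8 ^ |β| * (ch * 2 ^ α * 32 ^ (j₀.1 + 1)))
  refine ⟨C₁ + C₂ + 8, X₀, by positivity, hX₀, ?_⟩
  intro X Y h q a P g B hX hY hh1 hh hq hqX hP hPX hB hg hsm
  have hX1 : (1 : ℝ) ≤ X := hX₀.trans hX
  have hXn : 1 ≤ X := by exact_mod_cast hX1
  have hX0 : (0 : ℝ) < X := by linarith
  have hP0 : (0 : ℝ) < P := by exact_mod_cast hP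
  have hP1 : (1 : ℝ) ≤ P := by exact_mod_cast hP
  obtain ⟨l1, l2, l3⟩ := hlarge X hX
  obtain ⟨H, hH, hPH1, hPH2⟩ := exists_block_length hXn hP l2 hPX
  have hH1 : (1 : ℝ) ≤ H := by exact_mod_cast hH
  have hXX : (X : ℝ) ^ γ * (X : ℝ) ^ (1 - γ) = X := by
    rw [← Real.rpow_add hX0]
    simp
  have hp : 0 < (X : ℝ) ^ (1 - γ) := by positivity
  have hXγ : (X : ℝ) ^ (1 - γ) ≤ X := by nlinarith
  have hHleX : (H : ℝ) ≤ X := by nlinarith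
  refine (hred X Y h q a P H g B hXn hY l1 hh hP hH hPH1 hPH2 (by linarith) hg).trans ?_
  set R : ℝ := (X : ℝ) ^ γ / 2 with hR
  have hR1 : 1 ≤ R := by linarith
  have hRX : R ≤ X := by
    have : (X : ℝ) ^ γ ≤ (X : ℝ) ^ (1 : ℝ) := by
      have := hadm.gamma_lt
      gcongr
      linarith
    rw [Real.rpow_one] at this
    linarith
  have hrow : ∀ m ∈ Finset.Ico P (2 * P), ∑ i ∈ blockIndices X Y H m,
      ‖∑ y ∈ Finset.Ico (0 : ℤ) H,
        (if m * (i * H + y.toNat) % q = a then g (i * H + y.toNat) else 0) *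
          e (∑ j : Fin k, phaseCoeff α h m (i * H) j * (y : ℝ) ^ (j.1 + 1))‖ ≤
      B * (C₂ * (1 * R * H * (X : ℝ) ^ (-ρ))) + 8 * H := by
    intro m hm
    rw [Finset.mem_Ico] at hm
    have hm1 : (P : ℝ) ≤ m := by exact_mod_cast hm.1
    have hm2 : (m : ℝ) ≤ 2 * P := by exact_mod_cast hm.2.le
    have hm0 : (0 : ℝ) < m := by linarith
    have hbd := fun i => blockIndices_bounds (i := i) hXn hY hPH1 hPH2 hm.1 hm.2
    have hcard : ((blockIndices X Y H m).card : ℝ) ≤ 4 * (X : ℝ) ^ γ := by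
      refine card_le_of_pos_le (by positivity) fun i hi => ?_
      obtain ⟨b1, b2, -⟩ := hbd i hi
      refine ⟨?_, b2⟩
      have : (1 : ℝ) ≤ i := by linarith
      exact_mod_cast this
    have hpt : ∀ i ∈ blockIndices X Y H m, ‖∑ y ∈ Finset.Ico (0 : ℤ) H,
        (if m * (i * H + y.toNat) % q = a then g (i * H + y.toNat) else 0) *
          e (∑ j : Fin k, phaseCoeff α h m (i * H) j * (y : ℝ) ^ (j.1 + 1))‖ ≤
        B * ‖∑ y ∈ Finset.Ico (0 : ℤ) H,
          (if m * (i * H + y.toNat) % q = a then (1 : ℂ) else 0) *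
          e (∑ j : Fin k, phaseCoeff α h m (i * H) j * (y : ℝ) ^ (j.1 + 1))‖ + H * (1 / R) := by
      intro i hi
      obtain ⟨b1, b2, -⟩ := hbd i hi
      have hi0 : (1 : ℝ) ≤ i := by linarith
      have hin : 1 ≤ i := by exact_mod_cast hi0
      have hiH : 1 ≤ i * H := Nat.mul_pos hin hH
      have hdiff : ‖∑ y ∈ Finset.Ico (0 : ℤ) H,
          (if m * (i * H + y.toNat) % q = a then g (i * H + y.toNat) else 0) *
            e (∑ j : Fin k, phaseCoeff α h m (i * H) j * (y : ℝ) ^ (j.1 + 1)) -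
          g (i * H) * ∑ y ∈ Finset.Ico (0 : ℤ) H,
            (if m * (i * H + y.toNat) % q = a then (1 : ℂ) else 0) *
            e (∑ j : Fin k, phaseCoeff α h m (i * H) j * (y : ℝ) ^ (j.1 + 1))‖ ≤
          H * (1 / R) := by
        rw [Finset.mul_sum, ← Finset.sum_sub_distrib]
        refine (norm_sum_le _ _).trans ?_
        have : ∀ y ∈ Finset.Ico (0 : ℤ) H,
            ‖(if m * (i * H + y.toNat) % q = a then g (i * H + y.toNat) else 0) *
            e (∑ j : Fin k, phaseCoeff α h m (i * H) j * (y : ℝ) ^ (j.1 + 1)) -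
            g (i * H) * ((if m * (i * H + y.toNat) % q = a then (1 : ℂ) else 0) *
            e (∑ j : Fin k, phaseCoeff α h m (i * H) j * (y : ℝ) ^ (j.1 + 1)))‖ ≤ 1 / R := by
          intro y hy
          rw [Finset.mem_Ico] at hy
          split_ifs
          · rw [one_mul, ← sub_mul, norm_mul, norm_e, mul_one]
            refine (hsm (i * H) y.toNat hiH).trans ?_
            have hyH : (y.toNat : ℝ) ≤ H := by
              have : y.toNat ≤ H := by omega
              exact_mod_cast this
            push_cast
            rw [div_le_div_iff₀ (by positivity) (by linarith)]
            calc (y.toNat : ℝ) * R ≤ H * i := by gcongr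
              _ = 1 * (i * H) := by ring
          · simp only [zero_mul, mul_zero, sub_zero, norm_zero]
            positivity
        refine (Finset.sum_le_sum this).trans ?_
        simp
      have h1 := norm_sub_norm_le (∑ y ∈ Finset.Ico (0 : ℤ) H,
          (if m * (i * H + y.toNat) % q = a then g (i * H + y.toNat) else 0) *
            e (∑ j : Fin k, phaseCoeff α h m (i * H) j * (y : ℝ) ^ (j.1 + 1)))
          (g (i * H) * ∑ y ∈ Finset.Ico (0 : ℤ) H,
            (if m * (i * H + y.toNat) % q = a then (1 : ℂ) else 0) *
            e (∑ j : Fin k, phaseCoeff α h m (i * H) j * (y : ℝ) ^ (j.1 + 1)))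
      rw [norm_mul] at h1
      have h2 := mul_le_mul_of_nonneg_right (hg (i * H)) (norm_nonneg (∑ y ∈ Finset.Ico (0 : ℤ) H,
            (if m * (i * H + y.toNat) % q = a then (1 : ℂ) else 0) *
            e (∑ j : Fin k, phaseCoeff α h m (i * H) j * (y : ℝ) ^ (j.1 + 1))))
      linarith
    refine (Finset.sum_le_sum hpt).trans ?_
    rw [Finset.sum_add_distrib, ← Finset.mul_sum]
    refine add_le_add (mul_le_mul_of_nonneg_left ?_ (by linarith)) ?_
    swap
    · rw [Finset.sum_const, nsmul_eq_mul]
      calc ((blockIndices X Y H m).card : ℝ) * (H * (1 / R))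
          ≤ 4 * (X : ℝ) ^ γ * (H * (1 / R)) := by gcongr
        _ = 8 * R * (H * (1 / R)) := by rw [hR]; ring
        _ = 8 * H := by field_simp
    set Z : ℝ := m * H * R with hZ
    have hmH1 : (X : ℝ) ^ (1 - γ) ≤ 2 * (m * H) := by nlinarith
    have hmH2 : (m : ℝ) * H ≤ 2 * (X : ℝ) ^ (1 - γ) := by nlinarith
    have hZ1 : (X : ℝ) ≤ 4 * Z := by
      rw [hZ, ← hXX]
      calc (X : ℝ) ^ γ * (X : ℝ) ^ (1 - γ) ≤ (X : ℝ) ^ γ * (2 * (m * H)) := by gcongr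
        _ = _ := by rw [hR]; ring
    have hZ2 : Z ≤ 2 * X := by
      rw [hZ, ← hXX, hR]
      calc (m : ℝ) * H * ((X : ℝ) ^ γ / 2) ≤ 2 * (X : ℝ) ^ (1 - γ) * ((X : ℝ) ^ γ / 2) := by gcongr
        _ ≤ _ := by nlinarith [Real.rpow_pos_of_pos hX0 γ]
    set A : ℝ := h * (m * H : ℝ) ^ α * Ring.choose α (j₀.1 + 1) / (H : ℝ) ^ (j₀.1 + 1) with hA
    have hβpow : ∀ x : ℝ, 0 < x → x ^ β = x ^ α / x ^ (j₀.1 + 1) := by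
      intro x hx
      rw [hβ, Real.rpow_sub hx, Real.rpow_natCast]
    have hAR : |A| * R ^ β = h * ch * Z ^ α / (H * R) ^ (j₀.1 + 1) := by
      rw [hZ, Real.mul_rpow (by positivity) (by positivity), hA, abs_div, abs_mul, abs_of_nonneg
        (show (0 : ℝ) ≤ h * (m * H : ℝ) ^ α by positivity), abs_of_nonneg
        (show (0 : ℝ) ≤ (H : ℝ) ^ (j₀.1 + 1) by positivity), hβpow R (by linarith), mul_pow]
      field_simp
      rfl
    have hh0 : (1 : ℝ) ≤ h := by exact_mod_cast hh1
    refine le_of_eq_of_le ?_ (hfam H q (blockIndices X Y H m) X R 1 A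
      (fun i j => phaseCoeff α h m (i * H) j)
      (fun r y => if m * (r * H + y.toNat) % q = a then 1 else 0)
      hX1 hH hHleX hq hqX hR1 hRX ?_ (by norm_num) ?_ ?_ ?_ ?_ ?_ ?_)
    · refine Finset.sum_congr rfl fun i _ => ?_
      congr 1
      refine Finset.sum_congr rfl fun y _ => ?_
      have : m * (i % q * H + y.toNat) % q = m * (i * H + y.toNat) % q :=
        Nat.ModEq.mul_left m (((Nat.mod_modEq i q).mul_right H).add_right _)
      rw [this]
    · intro i hi
      obtain ⟨b1, b2, -⟩ := hbd i hi
      exact ⟨b1, by rw [hR]; linarith⟩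
    · intro r y
      split_ifs <;> simp
    · rw [hA]
      positivity
    · intro i hi
      obtain ⟨b1, -⟩ := hbd i hi
      have hi0 : (0 : ℝ) < i := by linarith
      simp only [phaseCoeff]
      rw [hA, hβpow i hi0]
      push_cast
      rw [show (m : ℝ) * (i * H) = m * H * i by ring, Real.mul_rpow (by positivity) hi0.le, mul_pow]
      field_simp
    · rw [mul_left_comm, hAR]
      have h5 : (X : ℝ) ^ (1 / 2 : ℝ) ≤ 32 * (H * R) := by
        have h6 : (X : ℝ) ^ (1 / 2 : ℝ) * (X : ℝ) ^ (1 / 2 : ℝ) = X := by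
          rw [← Real.rpow_add hX0]
          norm_num
        have h7 : 0 < (X : ℝ) ^ (1 / 2 : ℝ) := by positivity
        have h8 : (m : ℝ) * (H * R) ≤ 8 * (X : ℝ) ^ (1 / 2 : ℝ) * (H * R) := by
          gcongr
          linarith
        rw [hZ] at hZ1
        nlinarith
      have h9 := phase_size_le (p := j₀.1 + 1) hα hXn hh
        (show (0 : ℝ) ≤ Z by positivity) hZ2 h5 hch0.le
      push_cast at h9
      refine le_trans (mul_le_mul_of_nonneg_left h9 (by positivity)) ?_
      linarith
    · have h9 : (X : ℝ) ^ ω ≤ (X : ℝ) ^ γ := by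
        have := hadm.omega_le_gamma
        gcongr
      calc (X : ℝ) ^ ω ≤ 2 * R := by rw [hR]; linarith
        _ ≤ K' * R := by gcongr; exact le_max_left _ _
    · rw [hAR]
      have h9 := le_phase_size (p := j₀.1 + 1) (Z := Z) (i := R) (γ := γ) hα hXn hh1
        hZ1 (by linarith) (by rw [hR]; linarith) hch0 (by push_cast; exact hadm.omega_le)
      refine h9.trans ?_
      have h10 : h * ch * Z ^ α / (H * R) ^ (j₀.1 + 1) * (H : ℝ) ^ (j₀.1 + 1) =
          h * ch * Z ^ α / R ^ (j₀.1 + 1) := by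
        rw [mul_pow]
        field_simp
      rw [h10]
      gcongr
      exact le_max_right _ _
  have hfin : ∑ m ∈ Finset.Ico P (2 * P), (B * (C₂ * (1 * R * H * (X : ℝ) ^ (-ρ))) + 8 * H) ≤
      (C₂ + 8) * (B * (X : ℝ) ^ (1 - ρ)) := by
    rw [Finset.sum_const, Nat.card_Ico, nsmul_eq_mul, show 2 * P - P = P by omega]
    have h1 : (P : ℝ) * (8 * H) ≤ 8 * (B * (X : ℝ) ^ (1 - ρ)) := by
      have h2 : (X : ℝ) ^ (1 - γ) ≤ (X : ℝ) ^ (1 - ρ) := by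
        have := hadm.rho_le
        gcongr
      have h3 : 0 < (X : ℝ) ^ (1 - ρ) := by positivity
      nlinarith
    have h4 : (P : ℝ) * (B * (C₂ * (1 * R * H * (X : ℝ) ^ (-ρ)))) ≤
        C₂ * (B * (X : ℝ) ^ (1 - ρ)) := by
      calc (P : ℝ) * (B * (C₂ * (1 * R * H * (X : ℝ) ^ (-ρ))))
          = C₂ * (B * (R * (P * H) * (X : ℝ) ^ (-ρ))) := by ring
        _ ≤ C₂ * (B * (X * (X : ℝ) ^ (-ρ))) := by
          have : R * (P * H) ≤ X := by
            calc R * (P * H) ≤ R * (X : ℝ) ^ (1 - γ) := by gcongr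
              _ = X / 2 := by rw [hR, div_mul_eq_mul_div, hXX]
              _ ≤ X := by linarith
          gcongr
        _ = _ := by rw [sub_eq_add_neg, Real.rpow_add hX0, Real.rpow_one]
    linarith
  have := (Finset.sum_le_sum hrow).trans hfin
  linarith

/-- Dyadic decomposition. -/
lemma sum_Ico_le_dyadic (f : ℕ → ℝ) (hf : ∀ m, 0 ≤ f m) {L M : ℕ} {D : ℝ} (hL : 1 ≤ L)
    (hD : 0 ≤ D) (h : ∀ P, L ≤ P → P < M → ∑ m ∈ Finset.Ico P (2 * P), f m ≤ D) :
    ∑ m ∈ Finset.Ico L M, f m ≤ (Nat.log 2 M + 1 : ℕ) * D := by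
  have key : ∀ J : ℕ, ∑ m ∈ Finset.Ico L M with m < L * 2 ^ J, f m ≤ J * D := by
    intro J
    induction J with
    | zero =>
      rw [Finset.filter_false_of_mem]
      · simp
      · intro m hm
        rw [Finset.mem_Ico] at hm
        simpa using hm.1
    | succ J ih =>
      by_cases hJ : L * 2 ^ J < M
      · have hLJ : L ≤ L * 2 ^ J := Nat.le_mul_of_pos_right _ (by positivity)
        have hsub : (Finset.Ico L M).filter (fun m => m < L * 2 ^ (J + 1)) ⊆
            (Finset.Ico L M).filter (fun m => m < L * 2 ^ J) ∪
              Finset.Ico (L * 2 ^ J) (2 * (L * 2 ^ J)) := by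
          intro m hm
          rw [Finset.mem_filter] at hm
          rw [Finset.mem_union]
          have h2 := hm.2
          rw [pow_succ] at h2
          by_cases hc : m < L * 2 ^ J
          · exact Or.inl (Finset.mem_filter.2 ⟨hm.1, hc⟩)
          · exact Or.inr (Finset.mem_Ico.2 ⟨by omega, by rw [mul_comm 2, mul_assoc]; exact h2⟩)
        have hle := Finset.sum_le_sum_of_subset_of_nonneg hsub (fun m _ _ => hf m)
        have hun := Finset.sum_union_inter (f := f)
          (s₁ := (Finset.Ico L M).filter (fun m => m < L * 2 ^ J))
          (s₂ := Finset.Ico (L * 2 ^ J) (2 * (L * 2 ^ J)))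
        have hin : 0 ≤ ∑ m ∈ (Finset.Ico L M).filter (fun m => m < L * 2 ^ J) ∩
          Finset.Ico (L * 2 ^ J) (2 * (L * 2 ^ J)), f m := Finset.sum_nonneg fun m _ => hf m
        have := h _ hLJ hJ
        push_cast
        linarith
      · have hsub : (Finset.Ico L M).filter (fun m => m < L * 2 ^ (J + 1)) ⊆
            (Finset.Ico L M).filter (fun m => m < L * 2 ^ J) := by
          intro m hm
          rw [Finset.mem_filter, Finset.mem_Ico] at hm ⊢
          exact ⟨hm.1, by omega⟩
        have := Finset.sum_le_sum_of_subset_of_nonneg hsub (fun m _ _ => hf m)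
        push_cast
        linarith
  refine le_trans (le_of_eq ?_) (key (Nat.log 2 M + 1))
  rw [Finset.filter_true_of_mem]
  intro m hm
  rw [Finset.mem_Ico] at hm
  have h1 := Nat.lt_pow_succ_log_self (b := 2) (by norm_num) M
  calc m < M := hm.2
    _ < 2 ^ (Nat.log 2 M + 1) := h1
    _ ≤ L * 2 ^ (Nat.log 2 M + 1) := Nat.le_mul_of_pos_left _ hL

lemma exists_natLog_le {ν : ℝ} (hν : 0 < ν) : ∃ C : ℝ, 0 ≤ C ∧ ∀ X M : ℕ, 1 ≤ X → M ≤ 4 * X →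
    ((Nat.log 2 M + 1 : ℕ) : ℝ) ≤ C * (X : ℝ) ^ ν := by
  refine ⟨1 + 4 ^ ν / ν / Real.log 2, by positivity, fun X M hX hM => ?_⟩
  have hX1 : (1 : ℝ) ≤ X := by exact_mod_cast hX
  have h1 : 1 ≤ (X : ℝ) ^ ν := Real.one_le_rpow hX1 hν.le
  have hl2 : 0 < Real.log 2 := Real.log_pos (by norm_num)
  have h2 : (Nat.log 2 M : ℝ) ≤ 4 ^ ν / ν / Real.log 2 * (X : ℝ) ^ ν := by
    have h3 : Nat.log 2 M ≤ Nat.log 2 (4 * X) := Nat.log_mono_right hM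
    have h4 : 2 ^ Nat.log 2 (4 * X) ≤ 4 * X := Nat.pow_log_le_self 2 (by omega)
    have h5 : (2 : ℝ) ^ Nat.log 2 (4 * X) ≤ 4 * X := by exact_mod_cast h4
    have h6 : (Nat.log 2 (4 * X) : ℝ) * Real.log 2 ≤ Real.log (4 * X) := by
      rw [← Real.log_pow]
      exact Real.log_le_log (by positivity) h5
    have h7 := Real.log_le_rpow_div (x := 4 * X) (by positivity) hν
    rw [Real.mul_rpow (by norm_num) (by positivity)] at h7
    calc (Nat.log 2 M : ℝ) ≤ Nat.log 2 (4 * X) := by exact_mod_cast h3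
      _ ≤ 4 ^ ν * (X : ℝ) ^ ν / ν / Real.log 2 := by
        rw [le_div_iff₀ hl2]
        linarith
      _ = _ := by ring
  push_cast
  linarith

/-- The bilinear form with weights `f` and `g`. -/
noncomputable def bilinearSum (α : ℝ) (h q a X Y : ℕ) (f g : ℕ → ℂ) : ℂ :=
  ∑ m ∈ Finset.range (2 * X), f m * rowSum α h q a X Y g m

lemma bilinearSum_comm (α : ℝ) (h q a X Y : ℕ) (f g : ℕ → ℂ) :
    bilinearSum α h q a X Y f g = bilinearSum α h q a X Y g f := by
  simp only [bilinearSum, rowSum, Finset.mul_sum, Finset.sum_filter]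
  rw [Finset.sum_comm]
  refine Finset.sum_congr rfl fun n _ => Finset.sum_congr rfl fun m _ => ?_
  rw [mul_comm m n]
  split_ifs <;> ring

lemma rowSum_eq_zero {α : ℝ} {h q a X Y : ℕ} {g : ℕ → ℂ} {m : ℕ}
    (hg : ∀ n, X ≤ m * n → m * n < Y → g n = 0) : rowSum α h q a X Y g m = 0 := by
  refine Finset.sum_eq_zero fun n hn => ?_
  rw [Finset.mem_filter] at hn
  rw [hg n hn.2.1 hn.2.2, zero_mul]

lemma norm_bilinearSum_le {α : ℝ} {h q a X Y L M : ℕ} {f g : ℕ → ℂ} {A D : ℝ} (hL : 1 ≤ L)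
    (hA : 0 ≤ A) (hD : 0 ≤ D) (hf : ∀ m, ‖f m‖ ≤ A)
    (hz : ∀ m, m < L ∨ M ≤ m → f m * rowSum α h q a X Y g m = 0)
    (hrow : ∀ P, L ≤ P → P < M →
      ∑ m ∈ Finset.Ico P (2 * P), ‖rowSum α h q a X Y g m‖ ≤ D) :
    ‖bilinearSum α h q a X Y f g‖ ≤ (Nat.log 2 M + 1 : ℕ) * D * A := by
  have h1 : bilinearSum α h q a X Y f g =
      ∑ m ∈ Finset.range (2 * X) with m ∈ Finset.Ico L M, f m * rowSum α h q a X Y g m := by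
    rw [bilinearSum, Finset.sum_filter]
    refine Finset.sum_congr rfl fun m _ => ?_
    split_ifs with hm
    · rfl
    · rw [Finset.mem_Ico] at hm
      exact hz m (by omega)
  rw [h1]
  calc _ ≤ ∑ m ∈ Finset.range (2 * X) with m ∈ Finset.Ico L M, ‖f m * rowSum α h q a X Y g m‖ :=
        norm_sum_le _ _
    _ ≤ ∑ m ∈ Finset.Ico L M, ‖f m * rowSum α h q a X Y g m‖ := by
        refine Finset.sum_le_sum_of_subset_of_nonneg ?_ fun m _ _ => norm_nonneg _
        intro m hm
        exact (Finset.mem_filter.1 hm).2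
    _ ≤ ∑ m ∈ Finset.Ico L M, A * ‖rowSum α h q a X Y g m‖ := by
        refine Finset.sum_le_sum fun m _ => ?_
        rw [norm_mul]
        gcongr
        exact hf m
    _ = A * ∑ m ∈ Finset.Ico L M, ‖rowSum α h q a X Y g m‖ := by rw [Finset.mul_sum]
    _ ≤ A * ((Nat.log 2 M + 1 : ℕ) * D) := by
        gcongr
        exact sum_Ico_le_dyadic _ (fun m => norm_nonneg _) hL hD hrow
    _ = _ := by ring

lemma two_mul_sqrt_succ_le {X : ℕ} (hX : 1 ≤ X) :
    ((2 * (Nat.sqrt X + 1) : ℕ) : ℝ) ≤ 4 * (X : ℝ) ^ (1 / 2 : ℝ) ∧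
      2 * (Nat.sqrt X + 1) ≤ 4 * X := by
  have h1 : (Nat.sqrt X : ℝ) ≤ Real.sqrt X := Real.nat_sqrt_le_real_sqrt
  have h2 : 1 ≤ Real.sqrt X := Real.one_le_sqrt.2 (by exact_mod_cast hX)
  rw [← Real.sqrt_eq_rpow]
  have h3 := Nat.sqrt_le_self X
  refine ⟨by push_cast; linarith, by omega⟩

/-- Bilinear sums with a slowly varying weight. -/
theorem exists_norm_bilinearSum_le_of_smooth {k : ℕ} {j₀ : Fin k} {α γ ω η ρ τ ν : ℝ}
    (hadm : AdmissibleExponents j₀ α γ ω η ρ τ) (hν : 0 < ν) :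
    ∃ C X₀ : ℝ, 0 ≤ C ∧ 1 ≤ X₀ ∧ ∀ (X Y h q a : ℕ) (f g : ℕ → ℂ) (A B : ℝ), X₀ ≤ X →
      Y ≤ 2 * X → 1 ≤ h → (h : ℝ) ≤ (X : ℝ) ^ τ → 1 ≤ q → (q : ℝ) ≤ (X : ℝ) ^ η →
      0 ≤ A → (∀ n, ‖f n‖ ≤ A) → (∀ n, Nat.sqrt X < n → f n = 0) →
      1 ≤ B → (∀ n, ‖g n‖ ≤ B) → (∀ n y : ℕ, 1 ≤ n → ‖g (n + y) - g n‖ ≤ y / n) →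
      ‖bilinearSum α h q a X Y f g‖ ≤ C * (A * B * (X : ℝ) ^ (1 - ρ + ν)) := by
  obtain ⟨C, X₀, hC, hX₀, hmain⟩ := exists_sum_norm_rowSum_le_of_smooth hadm
  obtain ⟨C', hC', hlog⟩ := exists_natLog_le hν
  refine ⟨C' * C, X₀, by positivity, hX₀, ?_⟩
  intro X Y h q a f g A B hX hY hh1 hh hq hqX hA hf hfz hB hg hsm
  have hX1 : (1 : ℝ) ≤ X := hX₀.trans hX
  have hXn : 1 ≤ X := by exact_mod_cast hX1
  obtain ⟨s1, s2⟩ := two_mul_sqrt_succ_le hXn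
  have h1 := norm_bilinearSum_le (α := α) (h := h) (q := q) (a := a) (X := X) (Y := Y) (L := 1)
    (M := 2 * (Nat.sqrt X + 1)) (f := f) (g := g) (D := C * (B * (X : ℝ) ^ (1 - ρ))) le_rfl hA
    (by positivity) hf (by
      rintro m (hm | hm)
      · rw [rowSum_eq_zero, mul_zero]
        intro n h1 h2
        have : m = 0 := by omega
        rw [this, zero_mul] at h1
        omega
      · rw [hfz m (by omega), zero_mul]) (by
      intro P hP1 hP2
      refine hmain X Y h q a P g B hX hY hh1 hh hq hqX hP1 ?_ hB hg hsm
      refine le_trans ?_ s1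
      exact_mod_cast hP2.le)
  refine h1.trans ?_
  calc _ ≤ C' * (X : ℝ) ^ ν * (C * (B * (X : ℝ) ^ (1 - ρ))) * A := by
        gcongr
        exact hlog X _ hXn s2
    _ = _ := by
        rw [Real.rpow_add (by linarith : (0 : ℝ) < X)]
        ring

/-- Bilinear sums over medium ranges. -/
theorem exists_norm_bilinearSum_le_of_large {k : ℕ} {j₀ : Fin k} {α γ ω η ρ τ ν : ℝ}
    (hadm : AdmissibleExponents j₀ α γ ω η ρ τ) (hω : ω ≤ 1 / 3) (hν : 0 < ν) :
    ∃ C X₀ : ℝ, 0 ≤ C ∧ 1 ≤ X₀ ∧ ∀ (X Y h q a L : ℕ) (f g : ℕ → ℂ) (A B : ℝ), X₀ ≤ X →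
      Y ≤ 2 * X → 1 ≤ h → (h : ℝ) ≤ (X : ℝ) ^ τ → 1 ≤ q → (q : ℝ) ≤ (X : ℝ) ^ η →
      1 ≤ L → (X : ℝ) ^ (1 / 3 : ℝ) ≤ 4 * L →
      0 ≤ A → (∀ n, ‖f n‖ ≤ A) → (∀ n < L, f n = 0) →
      0 ≤ B → (∀ n, ‖g n‖ ≤ B) → (∀ n < L, g n = 0) →
      ‖bilinearSum α h q a X Y f g‖ ≤ C * (A * B * (X : ℝ) ^ (1 - ρ + ν)) := by
  obtain ⟨C, X₀, hC, hX₀, hmain⟩ := exists_sum_norm_rowSum_le_of_large hadm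
    (show (0 : ℝ) ≤ 4 by norm_num)
  obtain ⟨C', hC', hlog⟩ := exists_natLog_le hν
  refine ⟨2 * (C' * C), X₀, by positivity, hX₀, ?_⟩
  intro X Y h q a L f g A B hX hY hh1 hh hq hqX hL hLX hA hf hfz hB hg hgz
  have hX1 : (1 : ℝ) ≤ X := hX₀.trans hX
  have hXn : 1 ≤ X := by exact_mod_cast hX1
  obtain ⟨s1, s2⟩ := two_mul_sqrt_succ_le hXn
  set s := Nat.sqrt X with hs
  have hrow : ∀ (g : ℕ → ℂ) (B : ℝ), 0 ≤ B → (∀ n, ‖g n‖ ≤ B) → ∀ P, L ≤ P →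
      P < 2 * (s + 1) → ∑ m ∈ Finset.Ico P (2 * P), ‖rowSum α h q a X Y g m‖ ≤
        C * (B * (X : ℝ) ^ (1 - ρ)) := by
    intro g B hB hg P hP1 hP2
    have hLP : (L : ℝ) ≤ P := by exact_mod_cast hP1
    refine hmain X Y h q a P g B hX hY hh1 hh hq hqX (by omega) ?_ ?_ hB hg
    · refine le_trans ?_ s1
      exact_mod_cast hP2.le
    · calc (X : ℝ) ^ ω ≤ (X : ℝ) ^ (1 / 3 : ℝ) := by gcongr
        _ ≤ 4 * P := by linarith
  have hcomb : ∀ (A B : ℝ), 0 ≤ A → 0 ≤ B → ((Nat.log 2 (2 * (s + 1)) + 1 : ℕ) : ℝ) *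
      (C * (B * (X : ℝ) ^ (1 - ρ))) * A ≤ C' * C * (A * B * (X : ℝ) ^ (1 - ρ + ν)) := by
    intro A B hA hB
    calc _ ≤ C' * (X : ℝ) ^ ν * (C * (B * (X : ℝ) ^ (1 - ρ))) * A := by
          gcongr
          exact hlog X _ hXn s2
      _ = _ := by
          rw [Real.rpow_add (by linarith : (0 : ℝ) < X)]
          ring
  set f₁ : ℕ → ℂ := fun m => if m ≤ s then f m else 0 with hf₁
  set f₂ : ℕ → ℂ := fun m => if m ≤ s then 0 else f m with hf₂
  have hsplit : bilinearSum α h q a X Y f g =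
      bilinearSum α h q a X Y f₁ g + bilinearSum α h q a X Y g f₂ := by
    rw [bilinearSum_comm α h q a X Y g f₂]
    simp only [bilinearSum]
    rw [← Finset.sum_add_distrib]
    refine Finset.sum_congr rfl fun m _ => ?_
    simp only [hf₁, hf₂]
    split_ifs <;> ring
  have b1 := norm_bilinearSum_le (α := α) (h := h) (q := q) (a := a) (X := X) (Y := Y) (L := L)
    (M := 2 * (s + 1)) (f := f₁) (g := g) (A := A) hL hA (by positivity) (by
      intro m
      simp only [hf₁]
      split_ifs
      · exact hf m
      · simpa using hA) (by
      intro m hm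
      have : f₁ m = 0 := by
        simp only [hf₁]
        split_ifs with hms
        · exact hfz m (by omega)
        · rfl
      rw [this, zero_mul]) (hrow g B hB hg)
  have b2 := norm_bilinearSum_le (α := α) (h := h) (q := q) (a := a) (X := X) (Y := Y) (L := L)
    (M := 2 * (s + 1)) (f := g) (g := f₂) (A := B) hL hB (by positivity) hg (by
      rintro m (hm | hm)
      · rw [hgz m hm, zero_mul]
      · rw [rowSum_eq_zero, mul_zero]
        intro n h1 h2
        simp only [hf₂]
        rw [if_pos]
        by_contra hn
        have h3 : X < (s + 1) * (s + 1) := Nat.lt_succ_sqrt X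
        have h4 : 2 * (s + 1) * (s + 1) ≤ m * n := Nat.mul_le_mul hm (by omega)
        rw [mul_assoc] at h4
        omega) (hrow f₂ A hA (by
      intro m
      simp only [hf₂]
      split_ifs
      · simpa using hA
      · exact hf m))
  rw [hsplit]
  have c1 := hcomb A B hA hB
  have c2 := hcomb B A hB hA
  rw [mul_comm B A] at c2
  have := norm_add_le (bilinearSum α h q a X Y f₁ g) (bilinearSum α h q a X Y g f₂)
  linarith

/-- The divisor bound. -/
lemma exists_card_divisors_le {ν : ℝ} (hν : 0 < ν) :
    ∃ C : ℝ, 0 ≤ C ∧ ∀ n : ℕ, (n.divisors.card : ℝ) ≤ C * (n : ℝ) ^ ν := by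
  have hl2 : 0 < Real.log 2 := Real.log_pos (by norm_num)
  set Q : ℕ := ⌈(2 : ℝ) ^ (1 / ν)⌉₊ with hQ
  set K : ℝ := 1 + 1 / (ν * Real.log 2) with hK
  have hK1 : 1 ≤ K := by
    have : 0 < 1 / (ν * Real.log 2) := by positivity
    linarith
  refine ⟨K ^ Q, by positivity, fun n => ?_⟩
  rcases Nat.eq_zero_or_pos n with rfl | hn
  · simp only [Nat.divisors_zero, Finset.card_empty, Nat.cast_zero]
    positivity
  rw [Nat.card_divisors hn.ne']
  push_cast
  have hfac : ∀ p ∈ n.primeFactors, ((n.factorization p : ℝ) + 1) ≤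
      (if p < Q then K else 1) * ((p : ℝ) ^ n.factorization p) ^ ν := by
    intro p hp
    have hp2 : (2 : ℝ) ≤ p := by exact_mod_cast (Nat.prime_of_mem_primeFactors hp).two_le
    set b := n.factorization p
    rw [← Real.rpow_natCast_mul (by positivity), mul_comm (b : ℝ), Real.rpow_mul_natCast
      (by positivity)]
    split_ifs with hpQ
    · have h1 : 1 + ν * Real.log 2 ≤ (p : ℝ) ^ ν := by
        calc 1 + ν * Real.log 2 ≤ Real.exp (Real.log 2 * ν) := by
              have := Real.add_one_le_exp (Real.log 2 * ν)
              linarith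
          _ = 2 ^ ν := by rw [Real.rpow_def_of_pos (by norm_num)]
          _ ≤ (p : ℝ) ^ ν := by gcongr
      have h2 : 1 + (b : ℝ) * (ν * Real.log 2) ≤ ((p : ℝ) ^ ν) ^ b := by
        refine (one_add_mul_le_pow ?_ b).trans ?_
        · have : 0 < ν * Real.log 2 := by positivity
          linarith
        · gcongr
      have h3 : (b : ℝ) + 1 ≤ K * (1 + (b : ℝ) * (ν * Real.log 2)) := by
        have h4 : K * (ν * Real.log 2) = ν * Real.log 2 + 1 := by
          rw [hK]
          field_simp
        have : (0 : ℝ) ≤ b * (ν * Real.log 2) := by positivity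
        calc (b : ℝ) + 1 ≤ K + b * (ν * Real.log 2 + 1) := by linarith
          _ = K + b * (K * (ν * Real.log 2)) := by rw [h4]
          _ = _ := by ring
      exact h3.trans (by gcongr)
    · have h1 : (2 : ℝ) ≤ (p : ℝ) ^ ν := by
        have h2 : (2 : ℝ) ^ (1 / ν) ≤ p := by
          refine (Nat.le_ceil _).trans ?_
          exact_mod_cast not_lt.1 hpQ
        calc (2 : ℝ) = ((2 : ℝ) ^ (1 / ν)) ^ ν := by
              rw [← Real.rpow_mul (by norm_num), one_div_mul_cancel hν.ne', Real.rpow_one]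
          _ ≤ _ := by gcongr
      have h2 : b + 1 ≤ 2 ^ b := Nat.lt_two_pow_self
      calc ((b : ℝ) + 1) ≤ 2 ^ b := by exact_mod_cast h2
        _ ≤ 1 * ((p : ℝ) ^ ν) ^ b := by rw [one_mul]; gcongr
  refine (Finset.prod_le_prod (fun p _ => by positivity) hfac).trans ?_
  rw [Finset.prod_mul_distrib, Real.finsetProd_rpow _ _ (fun p _ => by positivity)]
  have h1 : ∏ p ∈ n.primeFactors, ((p : ℝ) ^ n.factorization p) = n := by
    have := Nat.prod_factorization_pow_eq_self hn.ne'
    rw [Finsupp.prod, Nat.support_factorization] at this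
    exact_mod_cast this
  rw [h1, ← Finset.prod_filter, Finset.prod_const]
  gcongr
  · have : n.primeFactors.filter (fun p => p < Q) ⊆ Finset.range Q := by
      intro p hp
      exact Finset.mem_range.2 (Finset.mem_filter.1 hp).2
    simpa using Finset.card_le_card this

/-- The restriction of an arithmetic function to `n ≤ u`. -/
noncomputable def truncLE (u : ℕ) (F : ArithmeticFunction ℝ) : ArithmeticFunction ℝ :=
  ⟨fun n => if n ≤ u then F n else 0, by simp⟩

/-- The restriction of an arithmetic function to `n > u`. -/
noncomputable def truncGT (u : ℕ) (F : ArithmeticFunction ℝ) : ArithmeticFunction ℝ :=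
  ⟨fun n => if n ≤ u then 0 else F n, by simp⟩

lemma truncLE_apply (u : ℕ) (F : ArithmeticFunction ℝ) (n : ℕ) :
    truncLE u F n = if n ≤ u then F n else 0 := rfl

lemma truncGT_apply (u : ℕ) (F : ArithmeticFunction ℝ) (n : ℕ) :
    truncGT u F n = if n ≤ u then 0 else F n := rfl

lemma truncLE_add_truncGT (u : ℕ) (F : ArithmeticFunction ℝ) :
    truncLE u F + truncGT u F = F := by
  ext n
  rw [ArithmeticFunction.add_apply, truncLE_apply, truncGT_apply]
  split_ifs <;> simp

/-- Vaughan's identity. -/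
lemma vonMangoldt_eq_vaughan (u : ℕ) : Λ = truncLE u Λ +
    truncLE u (moebius : ArithmeticFunction ℝ) * log -
    truncLE u (moebius : ArithmeticFunction ℝ) * truncLE u Λ * (zeta : ArithmeticFunction ℝ) +
    truncGT u (moebius : ArithmeticFunction ℝ) * (zeta : ArithmeticFunction ℝ) * truncGT u Λ := by
  have h1 := truncLE_add_truncGT u (moebius : ArithmeticFunction ℝ)
  have h2 := truncLE_add_truncGT u Λ
  have h3 : (moebius : ArithmeticFunction ℝ) * (zeta : ArithmeticFunction ℝ) = 1 :=
    coe_moebius_mul_coe_zeta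
  have h4 : log = (truncLE u Λ + truncGT u Λ) * (zeta : ArithmeticFunction ℝ) := by
    rw [h2, vonMangoldt_mul_zeta]
  have h5 : (truncLE u (moebius : ArithmeticFunction ℝ) + truncGT u (moebius : ArithmeticFunction ℝ)) *
      (zeta : ArithmeticFunction ℝ) = 1 := by rw [h1, h3]
  rw [h4]
  conv_lhs => rw [← h2]
  linear_combination (-truncGT u Λ) * h5

/-- The sum of `F(n) e(h n^α)` over `n ≡ a (mod q)` in `[X, Y)`. -/
noncomputable def apSum (α : ℝ) (h q a X Y : ℕ) (F : ArithmeticFunction ℝ) : ℂ :=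
  ∑ n ∈ Finset.range (2 * X) with X ≤ n ∧ n < Y, (F n : ℂ) * apPhase α h q a n

lemma apSum_add (α : ℝ) (h q a X Y : ℕ) (F G : ArithmeticFunction ℝ) :
    apSum α h q a X Y (F + G) = apSum α h q a X Y F + apSum α h q a X Y G := by
  simp only [apSum, ArithmeticFunction.add_apply, Complex.ofReal_add, add_mul, Finset.sum_add_distrib]

lemma apSum_neg (α : ℝ) (h q a X Y : ℕ) (F : ArithmeticFunction ℝ) :
    apSum α h q a X Y (-F) = -apSum α h q a X Y F := by
  simp only [apSum, ArithmeticFunction.neg_apply, Complex.ofReal_neg, neg_mul, Finset.sum_neg_distrib]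

lemma apSum_mul {α : ℝ} {h q a X Y : ℕ} (hY : Y ≤ 2 * X)
    (F G : ArithmeticFunction ℝ) : apSum α h q a X Y (F * G) =
      bilinearSum α h q a X Y (fun n => (F n : ℂ)) (fun n => (G n : ℂ)) := by
  simp only [bilinearSum, rowSum, Finset.mul_sum, Finset.sum_filter]
  rw [← Finset.sum_product']
  simp only [mul_ite, mul_zero]
  rw [← Finset.sum_filter, apSum]
  rw [← Finset.sum_fiberwise_of_maps_to (s := (Finset.range (2 * X) ×ˢ Finset.range (2 * X)).filter
    fun x => X ≤ x.1 * x.2 ∧ x.1 * x.2 < Y)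
    (t := (Finset.range (2 * X)).filter fun n => X ≤ n ∧ n < Y) (g := fun x => x.1 * x.2)]
  · refine Finset.sum_congr rfl fun n hn => ?_
    rw [Finset.mem_filter] at hn
    rw [mul_apply, Complex.ofReal_sum, Finset.sum_mul]
    refine Finset.sum_congr ?_ ?_
    · ext ⟨c, d⟩
      simp only [Nat.mem_divisorsAntidiagonal, Finset.mem_filter, Finset.mem_product,
        Finset.mem_range]
      constructor
      · rintro ⟨h1, h2⟩
        have hc : c ∣ n := ⟨d, h1.symm⟩
        have hd : d ∣ n := ⟨c, by rw [mul_comm]; exact h1.symm⟩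
        have hc' := Nat.le_of_dvd (by omega) hc
        have hd' := Nat.le_of_dvd (by omega) hd
        exact ⟨⟨⟨by omega, by omega⟩, by omega, by omega⟩, h1⟩
      · rintro ⟨-, h1⟩
        exact ⟨h1, by omega⟩
    · rintro ⟨c, d⟩ hcd
      have hcd := (Finset.mem_filter.1 hcd).2
      simp only at hcd ⊢
      rw [hcd]
      push_cast
      ring
  · intro x hx
    rw [Finset.mem_filter] at hx
    exact Finset.mem_filter.2 ⟨Finset.mem_range.2 (by omega), hx.2⟩

lemma bilinearSum_congr {α : ℝ} {h q a X Y : ℕ} {f g f' g' : ℕ → ℂ}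
    (hfg : ∀ m n, m < 2 * X → n < 2 * X → X ≤ m * n → m * n < Y → f m * g n = f' m * g' n) :
    bilinearSum α h q a X Y f g = bilinearSum α h q a X Y f' g' := by
  simp only [bilinearSum, rowSum, Finset.mul_sum]
  refine Finset.sum_congr rfl fun m hm => Finset.sum_congr rfl fun n hn => ?_
  rw [Finset.mem_filter, Finset.mem_range] at hn
  rw [← mul_assoc, ← mul_assoc, hfg m n (Finset.mem_range.1 hm) hn.1 hn.2.1 hn.2.2]

lemma exists_one_add_log_le {ν : ℝ} (hν : 0 < ν) : ∃ C : ℝ, 1 ≤ C ∧ ∀ X : ℕ, 1 ≤ X →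
    1 + Real.log (2 * X : ℕ) ≤ C * (X : ℝ) ^ ν := by
  refine ⟨1 + 2 ^ ν / ν, by have : (0:ℝ) ≤ 2 ^ ν / ν := by positivity
                            linarith, fun X hX => ?_⟩
  have h1 := Real.log_le_rpow_div (x := ((2 * X : ℕ) : ℝ)) (by positivity) hν
  have h2 : (1 : ℝ) ≤ (X : ℝ) ^ ν := Real.one_le_rpow (by exact_mod_cast hX) hν.le
  push_cast at h1 ⊢
  rw [Real.mul_rpow (by norm_num) (by positivity)] at h1
  calc _ ≤ (X : ℝ) ^ ν + 2 ^ ν * (X : ℝ) ^ ν / ν := by linarith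
    _ = _ := by ring

lemma norm_log_min_sub_le {Z n y : ℕ} (hZ : 1 ≤ Z) (hn : 1 ≤ n) :
    |Real.log (min (n + y) Z : ℕ) - Real.log (min n Z : ℕ)| ≤ y / n := by
  have hn' : (0 : ℝ) < n := by exact_mod_cast hn
  have h1 : 1 ≤ min n Z := le_min hn hZ
  have h2 : min n Z ≤ min (n + y) Z := min_le_min_right _ (by omega)
  have h1' : (0 : ℝ) < (min n Z : ℕ) := by exact_mod_cast h1
  have h2' : ((min n Z : ℕ) : ℝ) ≤ (min (n + y) Z : ℕ) := by exact_mod_cast h2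
  rw [abs_of_nonneg (sub_nonneg.2 (Real.log_le_log h1' h2')),
    ← Real.log_div (by linarith) h1'.ne']
  refine (Real.log_le_sub_one_of_pos (by positivity)).trans ?_
  rcases le_total Z n with hc | hc
  · rw [min_eq_right hc, min_eq_right (by omega : Z ≤ n + y), div_self, sub_self]
    · positivity
    · have : (0 : ℝ) < Z := by exact_mod_cast hZ
      exact this.ne'
  · rw [min_eq_left hc, sub_le_iff_le_add, div_le_iff₀ hn', add_mul, div_mul_cancel₀ _ hn'.ne']
    have : ((min (n + y) Z : ℕ) : ℝ) ≤ (n + y : ℕ) := by exact_mod_cast min_le_left _ _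
    push_cast at this ⊢
    linarith

lemma abs_truncLE_moebius_le (u n : ℕ) : |truncLE u (moebius : ArithmeticFunction ℝ) n| ≤ 1 := by
  rw [truncLE_apply]
  split_ifs
  · rw [intCoe_apply]
    exact_mod_cast abs_moebius_le_one
  · simp

lemma abs_truncGT_moebius_le (u n : ℕ) : |truncGT u (moebius : ArithmeticFunction ℝ) n| ≤ 1 := by
  rw [truncGT_apply]
  split_ifs
  · simp
  · rw [intCoe_apply]
    exact_mod_cast abs_moebius_le_one

lemma abs_truncLE_mul_truncLE_le (u n : ℕ) :
    |(truncLE u (moebius : ArithmeticFunction ℝ) * truncLE u Λ) n| ≤ Real.log n := by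
  rw [← log_apply, ← zeta_mul_vonMangoldt, mul_apply, mul_apply]
  refine (Finset.abs_sum_le_sum_abs _ _).trans (Finset.sum_le_sum fun x hx => ?_)
  rw [Nat.mem_divisorsAntidiagonal] at hx
  have hx1 : x.1 ≠ 0 := fun h0 => hx.2 (by rw [← hx.1, h0, zero_mul])
  rw [abs_mul, natCoe_apply, zeta_apply_ne hx1, Nat.cast_one]
  refine mul_le_mul (abs_truncLE_moebius_le u x.1) ?_ (abs_nonneg _) zero_le_one
  rw [truncLE_apply]
  split_ifs
  · rw [abs_of_nonneg vonMangoldt_nonneg]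
  · simp

lemma truncLE_mul_truncLE_eq_zero {u n : ℕ} (F G : ArithmeticFunction ℝ) (hn : u * u < n) :
    (truncLE u F * truncLE u G) n = 0 := by
  rw [mul_apply]
  refine Finset.sum_eq_zero fun x hx => ?_
  rw [Nat.mem_divisorsAntidiagonal] at hx
  rw [truncLE_apply, truncLE_apply]
  split_ifs with h1 h2
  · have := Nat.mul_le_mul h1 h2
    omega
  all_goals simp

lemma abs_truncGT_mul_zeta_le (u n : ℕ) :
    |(truncGT u (moebius : ArithmeticFunction ℝ) * (zeta : ArithmeticFunction ℝ)) n| ≤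
      n.divisors.card := by
  rw [coe_mul_zeta_apply]
  refine (Finset.abs_sum_le_sum_abs _ _).trans ?_
  refine (Finset.sum_le_sum fun i _ => abs_truncGT_moebius_le u i).trans ?_
  simp

lemma truncGT_mul_zeta_eq_zero {u n : ℕ} (F : ArithmeticFunction ℝ) (hn : n ≤ u) :
    (truncGT u F * (zeta : ArithmeticFunction ℝ)) n = 0 := by
  rw [coe_mul_zeta_apply]
  refine Finset.sum_eq_zero fun i hi => ?_
  rw [truncGT_apply, if_pos ((Nat.divisor_le hi).trans hn)]

lemma exists_vaughan_parameter {X : ℕ} (hX : 2 ≤ X) : ∃ u : ℕ, 1 ≤ u ∧ u * u * u ≤ X ∧ u < X ∧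
    u ≤ Nat.sqrt X ∧ (X : ℝ) ^ (1 / 3 : ℝ) ≤ 4 * u := by
  have hX0 : (0 : ℝ) ≤ X := by positivity
  have hX1 : (1 : ℝ) ≤ X := by exact_mod_cast (by omega : 1 ≤ X)
  have h1 : (1 : ℝ) ≤ (X : ℝ) ^ (1 / 3 : ℝ) := Real.one_le_rpow hX1 (by norm_num)
  set u := ⌊(X : ℝ) ^ (1 / 3 : ℝ)⌋₊ with hu
  have hu1 : 1 ≤ u := Nat.le_floor (by exact_mod_cast h1)
  have hu2 : (u : ℝ) ≤ (X : ℝ) ^ (1 / 3 : ℝ) := Nat.floor_le (by positivity)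
  have hu3 : (X : ℝ) ^ (1 / 3 : ℝ) < u + 1 := Nat.lt_floor_add_one _
  have hcube : u * u * u ≤ X := by
    have : (u : ℝ) ^ (3 : ℕ) ≤ X := by
      calc (u : ℝ) ^ (3 : ℕ) ≤ ((X : ℝ) ^ (1 / 3 : ℝ)) ^ (3 : ℕ) := by gcongr
        _ = X := by
          rw [← Real.rpow_natCast, ← Real.rpow_mul hX0]
          norm_num
    have h4 : u ^ 3 ≤ X := by exact_mod_cast this
    calc u * u * u = u ^ 3 := by ring
      _ ≤ X := h4
  have hsq : u * u ≤ X := le_trans (Nat.le_mul_of_pos_right _ hu1) hcube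
  have hu1' : (1 : ℝ) ≤ u := by exact_mod_cast hu1
  refine ⟨u, hu1, hcube, ?_, Nat.le_sqrt.2 hsq, by linarith⟩
  by_contra! hc
  nlinarith

lemma apSum_truncLE_eq_zero {α : ℝ} {h q a X Y u : ℕ} (hu : u < X) (F : ArithmeticFunction ℝ) :
    apSum α h q a X Y (truncLE u F) = 0 := by
  refine Finset.sum_eq_zero fun n hn => ?_
  have := (Finset.mem_filter.1 hn).2.1
  rw [truncLE_apply, if_neg (by omega)]
  simp

/-- The bound for `∑ Λ(n) e(h n^α)` over an arithmetic progression under general exponents. -/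
theorem exists_norm_apSum_vonMangoldt_le {k : ℕ} {j₀ : Fin k} {α γ ω η ρ τ ν : ℝ}
    (hadm : AdmissibleExponents j₀ α γ ω η ρ τ) (hω : ω ≤ 1 / 3) (hν : 0 < ν) :
    ∃ C X₀ : ℝ, 0 ≤ C ∧ 1 ≤ X₀ ∧ ∀ (X Y h q a : ℕ), X₀ ≤ X →
      Y ≤ 2 * X → 1 ≤ h → (h : ℝ) ≤ (X : ℝ) ^ τ → 1 ≤ q → (q : ℝ) ≤ (X : ℝ) ^ η →
      ‖apSum α h q a X Y Λ‖ ≤ C * (X : ℝ) ^ (1 - ρ + 3 * ν) := by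
  obtain ⟨C₁, X₁, hC₁, hX₁, hI⟩ := exists_norm_bilinearSum_le_of_smooth hadm hν
  obtain ⟨C₂, X₂, hC₂, hX₂, hII⟩ := exists_norm_bilinearSum_le_of_large hadm hω hν
  obtain ⟨c, hc, hlog⟩ := exists_one_add_log_le hν
  obtain ⟨d, hd, hdiv⟩ := exists_card_divisors_le hν
  refine ⟨2 * (C₁ * c) + C₂ * c + C₂ * (d * 2 ^ ν * c), max 2 (max X₁ X₂), by positivity,
    (by norm_num : (1 : ℝ) ≤ 2).trans (le_max_left _ _), ?_⟩
  intro X Y h q a hX hY hh1 hh hq hqX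
  have hX2 : 2 ≤ X := by exact_mod_cast (le_max_left _ _).trans hX
  have hXX₁ : X₁ ≤ X := ((le_max_left _ _).trans (le_max_right _ _)).trans hX
  have hXX₂ : X₂ ≤ X := ((le_max_right _ _).trans (le_max_right _ _)).trans hX
  have hX1 : (1 : ℝ) ≤ X := by exact_mod_cast (by omega : 1 ≤ X)
  have hX0 : (0 : ℝ) < X := by linarith
  obtain ⟨u, hu1, hucube, huX, hus, hu4⟩ := exists_vaughan_parameter hX2
  have hlogX : 1 + Real.log (2 * X : ℕ) ≤ c * (X : ℝ) ^ ν := hlog X (by omega)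
  have hlog0 : 0 ≤ Real.log (2 * X : ℕ) := Real.log_natCast_nonneg _
  have hlogn : ∀ n, n < 2 * X → Real.log n ≤ Real.log (2 * X : ℕ) := by
    intro n hn
    rcases Nat.eq_zero_or_pos n with h0 | h0
    · rw [h0, Nat.cast_zero, Real.log_zero]
      exact hlog0
    · exact Real.log_le_log (by exact_mod_cast h0) (by exact_mod_cast hn.le)
  have hν1 : (1 : ℝ) ≤ (X : ℝ) ^ ν := Real.one_le_rpow hX1 hν.le
  have hpow : (X : ℝ) ^ (1 - ρ + 3 * ν) = (X : ℝ) ^ ν * (X : ℝ) ^ ν * (X : ℝ) ^ (1 - ρ + ν) := by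
    rw [← Real.rpow_add hX0, ← Real.rpow_add hX0]
    ring_nf
  have hR : 0 ≤ (X : ℝ) ^ (1 - ρ + ν) := by positivity
  set R := (X : ℝ) ^ (1 - ρ + ν) with hRdef
  have hc0 : 0 ≤ c := by linarith
  have hcν : c * (X : ℝ) ^ ν ≤ c * ((X : ℝ) ^ ν * (X : ℝ) ^ ν) := by
    gcongr
    nlinarith
  have hμlog : ‖apSum α h q a X Y (truncLE u (moebius : ArithmeticFunction ℝ) * log)‖ ≤
      C₁ * (c * ((X : ℝ) ^ ν * (X : ℝ) ^ ν) * R) := by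
    rw [apSum_mul hY, bilinearSum_congr
      (f' := fun n => (truncLE u (moebius : ArithmeticFunction ℝ) n : ℂ))
      (g' := fun n => (Real.log (min n (2 * X) : ℕ) : ℂ))
      (by intro m n _ hn _ _
          simp only [min_eq_left hn.le, log_apply])]
    refine (hI X Y h q a _ _ 1 (1 + Real.log (2 * X : ℕ)) hXX₁ hY hh1 hh hq hqX zero_le_one ?_ ?_
      (by linarith) ?_ ?_).trans ?_
    · intro n
      rw [Complex.norm_real]
      exact abs_truncLE_moebius_le u n
    · intro n hn
      rw [truncLE_apply, if_neg (by omega), Complex.ofReal_zero]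
    · intro n
      rw [Complex.norm_real, Real.norm_of_nonneg (Real.log_natCast_nonneg _)]
      have : Real.log (min n (2 * X) : ℕ) ≤ Real.log (2 * X : ℕ) := by
        rcases Nat.eq_zero_or_pos n with h0 | h0
        · rw [h0]
          simpa using hlog0
        · refine Real.log_le_log ?_ (by exact_mod_cast min_le_right _ _)
          exact_mod_cast lt_min h0 (by omega)
      linarith
    · intro n y hn
      rw [← Complex.ofReal_sub, Complex.norm_real]
      exact norm_log_min_sub_le (by omega) hn
    · rw [one_mul]
      gcongr
      exact hlogX.trans hcν
  have hμΛ1 : ‖apSum α h q a X Y (truncLE u (truncLE u (moebius : ArithmeticFunction ℝ) *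
      truncLE u Λ) * (zeta : ArithmeticFunction ℝ))‖ ≤
      C₁ * (c * ((X : ℝ) ^ ν * (X : ℝ) ^ ν) * R) := by
    rw [apSum_mul hY, bilinearSum_congr
      (f' := fun n => (truncLE u (truncLE u (moebius : ArithmeticFunction ℝ) * truncLE u Λ) n : ℂ))
      (g' := fun _ => 1)
      (by intro m n _ _ h1 _
          have hn : n ≠ 0 := by
            rintro rfl
            omega
          simp [natCoe_apply, zeta_apply_ne hn])]
    refine (hI X Y h q a _ _ (Real.log (2 * X : ℕ)) 1 hXX₁ hY hh1 hh hq hqX hlog0 ?_ ?_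
      le_rfl ?_ ?_).trans ?_
    · intro n
      rw [Complex.norm_real, truncLE_apply]
      split_ifs with hn
      · exact (abs_truncLE_mul_truncLE_le u n).trans (hlogn n (by omega))
      · simpa using hlog0
    · intro n hn
      rw [truncLE_apply, if_neg (by omega), Complex.ofReal_zero]
    · simp
    · intro n y _
      rw [sub_self, norm_zero]
      positivity
    · rw [mul_one]
      gcongr
      linarith
  have hμΛ2 : ‖apSum α h q a X Y (truncGT u (truncLE u (moebius : ArithmeticFunction ℝ) *
      truncLE u Λ) * (zeta : ArithmeticFunction ℝ))‖ ≤
      C₂ * (c * ((X : ℝ) ^ ν * (X : ℝ) ^ ν) * R) := by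
    rw [apSum_mul hY, bilinearSum_congr
      (f' := fun n => (truncGT u (truncLE u (moebius : ArithmeticFunction ℝ) * truncLE u Λ) n : ℂ))
      (g' := fun n => if n < u then 0 else 1)
      (by intro m n _ _ h1 _
          have hn : n ≠ 0 := by
            rintro rfl
            omega
          simp only [natCoe_apply, zeta_apply_ne hn]
          split_ifs with hnu
          · have hm : u * u < m := by
              by_contra! hm
              have := Nat.mul_le_mul_right n hm
              have := Nat.mul_lt_mul_of_pos_left hnu (by positivity : 0 < u * u)
              omega
            rw [truncGT_apply, truncLE_mul_truncLE_eq_zero _ _ hm]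
            simp
          · simp)]
    refine (hII X Y h q a u _ _ (Real.log (2 * X : ℕ)) 1 hXX₂ hY hh1 hh hq hqX hu1 hu4 hlog0 ?_ ?_
      zero_le_one ?_ ?_).trans ?_
    · intro n
      rw [Complex.norm_real, truncGT_apply]
      split_ifs with hn
      · simpa using hlog0
      · by_cases hn2 : u * u < n
        · rw [truncLE_mul_truncLE_eq_zero _ _ hn2]
          simpa using hlog0
        · have : u * u ≤ X := Nat.le_sqrt.1 hus
          exact (abs_truncLE_mul_truncLE_le u n).trans (hlogn n (by omega))
    · intro n hn
      rw [truncGT_apply, if_pos hn.le, Complex.ofReal_zero]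
    · intro n
      split_ifs <;> simp
    · intro n hn
      rw [if_pos hn]
    · rw [mul_one]
      gcongr
      linarith
  have hGT : ‖apSum α h q a X Y (truncGT u (moebius : ArithmeticFunction ℝ) *
      (zeta : ArithmeticFunction ℝ) * truncGT u Λ)‖ ≤
      C₂ * (d * 2 ^ ν * c * ((X : ℝ) ^ ν * (X : ℝ) ^ ν) * R) := by
    rw [apSum_mul hY, bilinearSum_congr
      (f' := fun n => if n < 2 * X then ((truncGT u (moebius : ArithmeticFunction ℝ) *
        (zeta : ArithmeticFunction ℝ)) n : ℂ) else 0)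
      (g' := fun n => if n < 2 * X then (truncGT u Λ n : ℂ) else 0)
      (by intro m n hm hn _ _
          simp only [if_pos hm, if_pos hn])]
    refine (hII X Y h q a u _ _ (d * ((2 * X : ℕ) : ℝ) ^ ν) (Real.log (2 * X : ℕ)) hXX₂ hY hh1 hh hq
      hqX hu1 hu4 (by positivity) ?_ ?_ hlog0 ?_ ?_).trans ?_
    · intro n
      split_ifs with hn
      · rw [Complex.norm_real]
        refine (abs_truncGT_mul_zeta_le u n).trans ((hdiv n).trans ?_)
        gcongr
      · simpa using (by positivity : 0 ≤ d * ((2 * X : ℕ) : ℝ) ^ ν)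
    · intro n hn
      rw [truncGT_mul_zeta_eq_zero _ hn.le]
      simp
    · intro n
      split_ifs with hn
      · rw [Complex.norm_real, truncGT_apply]
        split_ifs
        · simpa using hlog0
        · rw [Real.norm_of_nonneg vonMangoldt_nonneg]
          exact vonMangoldt_le_log.trans (hlogn n hn)
      · simpa using hlog0
    · intro n hn
      rw [truncGT_apply, if_pos hn.le]
      simp
    · push_cast
      rw [Real.mul_rpow (by norm_num) hX0.le]
      push_cast at hlogX
      calc _ ≤ C₂ * (d * (2 ^ ν * (X : ℝ) ^ ν) * (c * (X : ℝ) ^ ν) * R) := by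
            gcongr
            linarith
        _ = _ := by ring
  have hsplit := truncLE_add_truncGT u (truncLE u (moebius : ArithmeticFunction ℝ) * truncLE u Λ)
  rw [vonMangoldt_eq_vaughan u]
  conv_lhs => rw [← hsplit]
  rw [add_mul, sub_eq_add_neg, apSum_add, apSum_add, apSum_add, apSum_neg, apSum_add,
    apSum_truncLE_eq_zero huX, zero_add, hpow]
  refine (norm_add_le _ _).trans ?_
  refine (add_le_add_left (norm_add_le _ _) _).trans ?_
  rw [norm_neg]
  refine (add_le_add_left (add_le_add_right (norm_add_le _ _) _) _).trans ?_
  calc _ ≤ _ := add_le_add (add_le_add hμlog (add_le_add hμΛ1 hμΛ2)) hGT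
    _ = _ := by ring

lemma card_residue_class_le (N q a : ℕ) :
    ((Finset.range N).filter fun n => n % q = a).card ≤ N / q + 1 := by
  rw [← Finset.card_range (N / q + 1)]
  refine Finset.card_le_card_of_injOn (fun n => n / q) ?_ ?_
  · intro n hn
    have hn := Finset.mem_range.1 (Finset.mem_filter.1 hn).1
    exact Finset.mem_coe.2 (Finset.mem_range.2 (Nat.lt_succ_of_le (Nat.div_le_div_right hn.le)))
  · intro n hn n' hn' h
    have h1 := (Finset.mem_filter.1 hn).2
    have h2 := (Finset.mem_filter.1 hn').2
    simp only at h
    rw [← Nat.div_add_mod n q, ← Nat.div_add_mod n' q, h, h1, h2]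

/-- The trivial bound. -/
lemma norm_apSum_vonMangoldt_le (α : ℝ) (h q a X Y : ℕ) :
    ‖apSum α h q a X Y Λ‖ ≤ (2 * X / q + 1) * Real.log (2 * X : ℕ) := by
  have hlog0 : 0 ≤ Real.log (2 * X : ℕ) := Real.log_natCast_nonneg _
  have hterm : ∀ n ∈ Finset.range (2 * X), ‖(Λ n : ℂ) * apPhase α h q a n‖ ≤
      if n % q = a then Real.log (2 * X : ℕ) else 0 := by
    intro n hn
    rw [apPhase]
    split_ifs
    · rw [norm_mul, norm_e, mul_one, Complex.norm_real, Real.norm_of_nonneg vonMangoldt_nonneg]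
      refine vonMangoldt_le_log.trans ?_
      rcases Nat.eq_zero_or_pos n with h0 | h0
      · rw [h0, Nat.cast_zero, Real.log_zero]
        exact hlog0
      · exact Real.log_le_log (by exact_mod_cast h0)
          (by exact_mod_cast (Finset.mem_range.1 hn).le)
    · simp
  calc ‖apSum α h q a X Y Λ‖
      ≤ ∑ n ∈ Finset.range (2 * X) with X ≤ n ∧ n < Y, ‖(Λ n : ℂ) * apPhase α h q a n‖ :=
        norm_sum_le _ _
    _ ≤ ∑ n ∈ Finset.range (2 * X), ‖(Λ n : ℂ) * apPhase α h q a n‖ :=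
        Finset.sum_le_sum_of_subset_of_nonneg (Finset.filter_subset _ _) fun _ _ _ => norm_nonneg _
    _ ≤ ∑ n ∈ Finset.range (2 * X), if n % q = a then Real.log (2 * X : ℕ) else 0 :=
        Finset.sum_le_sum hterm
    _ = ((Finset.range (2 * X)).filter fun n => n % q = a).card * Real.log (2 * X : ℕ) := by
        rw [← Finset.sum_filter, Finset.sum_const, nsmul_eq_mul]
    _ ≤ (2 * X / q + 1) * Real.log (2 * X : ℕ) := by
        gcongr
        calc (((Finset.range (2 * X)).filter fun n => n % q = a).card : ℝ)
            ≤ ((2 * X / q + 1 : ℕ) : ℝ) := by exact_mod_cast card_residue_class_le (2 * X) q a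
          _ ≤ 2 * X / q + 1 := by
            push_cast
            have := Nat.cast_div_le (α := ℝ) (m := 2 * X) (n := q)
            push_cast at this
            linarith

/-- The size conditions needed for the final choice of exponents. -/
lemma saving_numerics {α ε j k : ℝ} (hα : 0 < α) (hε : 0 < ε) (hε3 : ε < 1 / 3)
    (hεα : ε < α / 20) (hj0 : 0 < j) (hj : j ≤ 2 * α + 1) (hk0 : 0 ≤ k) (hk : k ≤ (4 * j + 2) / 3) :
    2 * (2 * ε ^ 3 / (5 * α ^ 2)) + 2 * (k + k * k) * (2 * ε ^ 3 / (5 * α ^ 2)) <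
      min (1 / 3) (min (3 / 4 * α / j) (α / 4)) := by
  set κ := 2 * ε ^ 3 / (5 * α ^ 2) with hκ
  have hκ0 : 0 ≤ κ := by positivity
  have hk' : k ≤ (8 * α + 6) / 3 := by linarith
  have hkk : 2 + 2 * (k + k * k) ≤ (128 * α ^ 2 + 240 * α + 126) / 9 := by nlinarith
  have hγ : 3 / 4 * α / (2 * α + 1) ≤ 3 / 4 * α / j := by gcongr
  have hmain : 2 * κ + 2 * (k + k * k) * κ ≤ (128 * α ^ 2 + 240 * α + 126) / 9 * κ := by
    calc _ = (2 + 2 * (k + k * k)) * κ := by ring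
      _ ≤ _ := by gcongr
  refine lt_of_le_of_lt hmain ?_
  rcases le_or_gt (20 / 3) α with hc | hc
  · have hε3' : ε ^ 3 ≤ 1 / 27 := by
      calc ε ^ 3 ≤ (1 / 3) ^ 3 := by gcongr
        _ = 1 / 27 := by norm_num
    have h1 : κ ≤ 2 * (1 / 27) / (5 * α ^ 2) := by
      rw [hκ]
      gcongr
    have h2 : (128 * α ^ 2 + 240 * α + 126) / 9 * κ < 1 / 3 := by
      refine (mul_le_mul_of_nonneg_left h1 (by positivity)).trans_lt ?_
      rw [div_mul_div_comm, div_lt_div_iff₀ (by positivity) (by norm_num)]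
      nlinarith
    refine h2.trans_le (le_min le_rfl (le_min (le_trans ?_ hγ) (by linarith)))
    rw [le_div_iff₀ (by positivity)]
    linarith
  · have hε3' : ε ^ 3 ≤ (α / 20) ^ 3 := by gcongr
    have h1 : κ ≤ α / 20000 := by
      rw [hκ, div_le_div_iff₀ (by positivity) (by norm_num)]
      nlinarith
    have h2 : (128 * α ^ 2 + 240 * α + 126) / 9 * κ < α / 20 := by
      calc _ ≤ (128 * α ^ 2 + 240 * α + 126) / 9 * (α / 20000) := by gcongr
        _ = α * ((128 * α ^ 2 + 240 * α + 126) / 180000) := by ring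
        _ < α * (1 / 20) := by
          refine mul_lt_mul_of_pos_left ?_ hα
          rw [div_lt_div_iff₀ (by norm_num) (by norm_num)]
          nlinarith
        _ = α / 20 := by ring
    refine h2.trans_le (le_min (by linarith) (le_min (le_trans ?_ hγ) (by linarith)))
    rw [div_le_div_iff₀ (by norm_num) (by positivity)]
    nlinarith

lemma exists_admissibleExponents {α ε : ℝ} (hα : 0 < α) (hαn : ∀ n : ℕ, α ≠ n) (hε : 0 < ε)
    (hε3 : ε < 1 / 3) (hεα : ε < α / 20) :
    ∃ (k : ℕ) (j₀ : Fin k) (γ ω ρ τ : ℝ),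
      AdmissibleExponents j₀ α γ ω (2 * (2 * ε ^ 3 / (5 * α ^ 2))) ρ τ ∧ ω ≤ 1 / 3 ∧
        2 * ε ^ 3 / (5 * α ^ 2) < ρ ∧ 2 * ε ^ 3 / (5 * α ^ 2) ≤ 1 / 3 ∧ 0 < τ := by
  set m := ⌊2 * α⌋₊ with hm
  have hm1 : (m : ℝ) ≤ 2 * α := Nat.floor_le (by positivity)
  have hm2 : 2 * α < m + 1 := Nat.lt_floor_add_one _
  set k := (4 * (m + 1) + 2) / 3 with hk
  have hk3 : 3 * k ≤ 4 * (m + 1) + 2 := by omega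
  have hk4 : 4 * (m + 1) ≤ 3 * k := by omega
  have hk3' : 3 * (k : ℝ) ≤ 4 * (m + 1) + 2 := by exact_mod_cast hk3
  have hk4' : 4 * ((m : ℝ) + 1) ≤ 3 * k := by exact_mod_cast hk4
  have hnum := saving_numerics (j := (m : ℝ) + 1) (k := k) hα hε hε3 hεα (by positivity)
    (by linarith) (by positivity) (by linarith)
  set κ := 2 * ε ^ 3 / (5 * α ^ 2) with hκ
  have hκ0 : 0 ≤ κ := by positivity
  set γ := 3 / 4 * α / ((m : ℝ) + 1) with hγ
  have hγ0 : 0 < γ := by positivity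
  have hγm : γ * (m + 1) = 3 / 4 * α := by
    rw [hγ]
    field_simp
  set ω := min (1 / 3) (min γ (α / 4)) with hω
  have hω1 : ω ≤ 1 / 3 := min_le_left _ _
  have hω2 : ω ≤ γ := (min_le_right _ _).trans (min_le_left _ _)
  have hω3 : ω ≤ α / 4 := (min_le_right _ _).trans (min_le_right _ _)
  have hs0 : (0 : ℝ) < 2 * ((k : ℝ) + k * k) := by
    have : (0 : ℝ) < k := by exact_mod_cast (by omega : 0 < k)
    positivity
  have hκω : 2 * κ < ω := by nlinarith
  obtain ⟨t, ht0, ht1, ht2, ht3⟩ : ∃ t : ℝ, 0 < t ∧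
      2 * ((k : ℝ) + k * k) * t < ω - (2 * κ + 2 * (k + k * k) * κ) ∧ 2 * t < γ - κ ∧
      t < (m + 1) / 2 - α := by
    refine ⟨min ((ω - (2 * κ + 2 * (k + k * k) * κ)) / (2 * (2 * ((k : ℝ) + k * k))))
      (min ((γ - κ) / 4) (((m + 1) / 2 - α) / 2)), ?_, ?_, ?_, ?_⟩
    · refine lt_min (div_pos (by linarith) (by positivity)) (lt_min ?_ ?_) <;> linarith
    · have h1 := min_le_left ((ω - (2 * κ + 2 * (k + k * k) * κ)) / (2 * (2 * ((k : ℝ) + k * k))))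
        (min ((γ - κ) / 4) (((m + 1) / 2 - α) / 2))
      rw [le_div_iff₀ (by positivity)] at h1
      nlinarith
    · have h1 := (min_le_right ((ω - (2 * κ + 2 * (k + k * k) * κ)) / (2 * (2 * ((k : ℝ) + k * k))))
        (min ((γ - κ) / 4) (((m + 1) / 2 - α) / 2))).trans (min_le_left _ _)
      linarith
    · have h1 := (min_le_right ((ω - (2 * κ + 2 * (k + k * k) * κ)) / (2 * (2 * ((k : ℝ) + k * k))))
        (min ((γ - κ) / 4) (((m + 1) / 2 - α) / 2))).trans (min_le_right _ _)
      linarith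
  refine ⟨k, ⟨m, by omega⟩, γ, ω, κ + t, t, ?_, hω1, by linarith, by linarith, ht0⟩
  have hγk : α ≤ γ * k := by nlinarith
  refine ⟨by omega, hα, hαn, hγ0, ?_, ?_, hω2, ?_, ?_, ?_, by linarith⟩
  · rw [hγ, div_lt_div_iff₀ (by positivity) (by norm_num)]
    linarith
  · push_cast
    linarith
  · simp only
    linarith
  · linarith
  · simp only
    linarith

/-- Let `α > 0` be a fixed non-integer, `θ, ε, D` fixed with
`0 < ε < θ < 1/3`, `ε < α/20`, `D > 1`.  Suppose `1 ≤ h ≤ (log X)^D`, `2 < q ≤ X^{θ-ε}`,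
`1 ≤ a ≤ q-1`, `gcd(a,q) = 1`, `X < Y ≤ 2X`.  Then the von Mangoldt-weighted exponential
sum `W(Y) = ∑_{X ≤ n < Y, n ≡ a (mod q)} Λ(n) e(h n^α)` satisfies
`W(Y) ≪ X^{1+3δ-2ε³/(5α²)}` for any `0 < δ ≤ ε³/(50α²)`, the implied constant depending
on `α, ε, D`. -/
theorem vonMangoldt_weighted_exponential_sum_bound
    (α θ ε D : ℝ) (hα : 0 < α) (hαnonint : ∀ n : ℤ, α ≠ (n : ℝ))
    (hε : 0 < ε) (hεθ : ε < θ) (hθ : θ < 1/3) (hεα : ε < α / 20) (hD : 1 < D) :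
    ∃ C : ℝ, 0 < C ∧ ∀ (X h q a : ℕ) (Y δ : ℝ),
      1 ≤ h → (h : ℝ) ≤ (Real.log X) ^ D →
      2 < q → (q : ℝ) ≤ (X : ℝ) ^ (θ - ε) →
      1 ≤ a → a ≤ q - 1 → Nat.Coprime a q →
      (X : ℝ) < Y → Y ≤ 2 * X →
      0 < δ → δ ≤ ε ^ 3 / (50 * α ^ 2) →
      ‖∑ n ∈ (Finset.range (2 * X)).filter
          (fun n => X ≤ n ∧ (n : ℝ) < Y ∧ n % q = a),
          (Λ n : ℂ) * e ((h : ℝ) * (n : ℝ) ^ α)‖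
        ≤ C * (X : ℝ) ^ (1 + 3 * δ - 2 * ε ^ 3 / (5 * α ^ 2)) := by
  obtain ⟨k, j₀, γ, ω, ρ, τ, hadm, hω, hκρ, hκ1, hτ⟩ := exists_admissibleExponents hα
    (fun n => by exact_mod_cast hαnonint n) hε (hεθ.trans hθ) hεα
  have hκ0 : 0 < 2 * ε ^ 3 / (5 * α ^ 2) := by positivity
  set κ := 2 * ε ^ 3 / (5 * α ^ 2) with hκ
  obtain ⟨C₁, X₁, hC₁, hX₁, hmain⟩ := exists_norm_apSum_vonMangoldt_le hadm hω
    (ν := (ρ - κ) / 3) (by linarith)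
  obtain ⟨X₂, hX₂⟩ := Filter.eventually_atTop.1
    ((isLittleO_log_rpow_rpow_atTop D hτ).bound zero_lt_one)
  obtain ⟨c, hc, hlog⟩ := exists_one_add_log_le hκ0
  set Z := max X₁ X₂ with hZ
  have hZ1 : 1 ≤ Z := hX₁.trans (le_max_left _ _)
  have hlogZ : 0 ≤ Real.log (2 * Z) := Real.log_nonneg (by linarith)
  refine ⟨C₁ + 3 * c + (2 * Z + 1) * Real.log (2 * Z), by positivity, ?_⟩
  intro X h q a Y δ hh1 hh hq hqX _ _ _ _ hY hδ _
  have hX1 : 1 ≤ X := by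
    by_contra! h0
    rw [Nat.lt_one_iff.1 h0, Nat.cast_zero, Real.log_zero, Real.zero_rpow (by linarith)] at hh
    have : (1 : ℝ) ≤ h := by exact_mod_cast hh1
    linarith
  have hX1' : (1 : ℝ) ≤ X := by exact_mod_cast hX1
  have hX0 : (0 : ℝ) < X := by linarith
  have hq0 : (0 : ℝ) < q := by exact_mod_cast (by omega : 0 < q)
  have hsum : ∑ n ∈ (Finset.range (2 * X)).filter (fun n => X ≤ n ∧ (n : ℝ) < Y ∧ n % q = a),
      (Λ n : ℂ) * e ((h : ℝ) * (n : ℝ) ^ α) = apSum α h q a X ⌈Y⌉₊ Λ := by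
    simp only [apSum, apPhase, mul_ite, mul_zero]
    rw [← Finset.sum_filter, Finset.filter_filter]
    refine Finset.sum_congr ?_ fun _ _ => rfl
    ext n
    simp only [Finset.mem_filter, Nat.lt_ceil, and_assoc]
  have hYX : ⌈Y⌉₊ ≤ 2 * X := Nat.ceil_le.2 (by exact_mod_cast hY)
  rw [hsum]
  have hpow : (X : ℝ) ^ (1 - κ) ≤ (X : ℝ) ^ (1 + 3 * δ - κ) :=
    Real.rpow_le_rpow_of_exponent_le hX1' (by linarith)
  have hpow1 : 1 ≤ (X : ℝ) ^ (1 - κ) := Real.one_le_rpow hX1' (by linarith)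
  refine le_trans ?_ (mul_le_mul_of_nonneg_left hpow (by positivity))
  have hB₁ : 0 ≤ C₁ * (X : ℝ) ^ (1 - κ) := by positivity
  have hB₂ : 0 ≤ 3 * c * (X : ℝ) ^ (1 - κ) := by positivity
  have hB₃ : 0 ≤ (2 * Z + 1) * Real.log (2 * Z) * (X : ℝ) ^ (1 - κ) := by positivity
  have htriv := norm_apSum_vonMangoldt_le α h q a X ⌈Y⌉₊
  have hlog0 : 0 ≤ Real.log (2 * X : ℕ) := Real.log_natCast_nonneg _
  rw [add_mul, add_mul]
  rcases lt_or_ge (X : ℝ) Z with hXZ | hXZ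
  · refine (htriv.trans ?_).trans (by linarith :
      (2 * Z + 1) * Real.log (2 * Z) * (X : ℝ) ^ (1 - κ) ≤ _)
    have h1 : (2 * (X : ℝ) / q + 1) ≤ 2 * Z + 1 := by
      have : 2 * (X : ℝ) / q ≤ 2 * X := div_le_self (by positivity)
        (by exact_mod_cast (by omega : 1 ≤ q))
      linarith
    have h2 : Real.log (2 * X : ℕ) ≤ Real.log (2 * Z) := by
      refine Real.log_le_log (by positivity) ?_
      push_cast
      linarith
    calc _ ≤ (2 * Z + 1) * Real.log (2 * Z) := by gcongr
      _ ≤ _ := le_mul_of_one_le_right (by positivity) hpow1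
  · rcases le_or_gt (q : ℝ) ((X : ℝ) ^ (2 * κ)) with hqκ | hqκ
    · have hhX : (h : ℝ) ≤ (X : ℝ) ^ τ := by
        have h1 := hX₂ X ((le_max_right _ _).trans hXZ)
        rw [one_mul, Real.norm_of_nonneg (Real.rpow_nonneg hX0.le τ)] at h1
        exact hh.trans ((le_abs_self _).trans h1)
      have h1 := hmain X ⌈Y⌉₊ h q a ((le_max_left _ _).trans hXZ) hYX hh1 hhX (by omega) hqκ
      rw [show 1 - ρ + 3 * ((ρ - κ) / 3) = 1 - κ by ring] at h1
      linarith
    · refine (htriv.trans ?_).trans (by linarith : 3 * c * (X : ℝ) ^ (1 - κ) ≤ _)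
      have hqX' : (q : ℝ) ≤ X := by
        refine hqX.trans ?_
        calc (X : ℝ) ^ (θ - ε) ≤ (X : ℝ) ^ (1 : ℝ) :=
              Real.rpow_le_rpow_of_exponent_le hX1' (by linarith)
          _ = X := Real.rpow_one _
      have h1 : 1 ≤ (X : ℝ) / q := (one_le_div hq0).2 hqX'
      have h2 : (X : ℝ) / q ≤ (X : ℝ) ^ (1 - 2 * κ) := by
        rw [Real.rpow_sub hX0, Real.rpow_one]
        gcongr
      have h3 : Real.log (2 * X : ℕ) ≤ c * (X : ℝ) ^ κ := by
        have := hlog X hX1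
        linarith
      calc _ ≤ (3 * (X : ℝ) ^ (1 - 2 * κ)) * (c * (X : ℝ) ^ κ) := by
            gcongr
            rw [mul_div_assoc]
            linarith
        _ = 3 * c * ((X : ℝ) ^ (1 - 2 * κ) * (X : ℝ) ^ κ) := by ring
        _ = 3 * c * (X : ℝ) ^ (1 - κ) := by
          rw [← Real.rpow_add hX0]
          ring_nf
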